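/- Let d ≥ 1, β > 0 and let U = V + g be symmetric (U(−s) = U(s)) and satisfy assumptions (A0), (A1) and (A2). Then the thermodynamic limit σ^β(u) = lim_{N→∞, N even} σ_{T_N}^β(u) exists for every u ∈ ℝ^d, and the surface tension σ^β is strictly convex on ℝ^d: there is a constant c > 0 (the constant of the uniform torus bound) such that u ↦ σ^β(u) − c·‖u‖² is convex. -/

import Mathlib

open MeasureTheory Real Filter

noncomputable section
open scoped Classical

/-- `L^q(ℝ)` norm. -/
def LqNorm (f : ℝ → ℝ) (q : ℝ) : ℝ := (∫ t : ℝ, |f t| ^ q) ^ (1/q)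

/-- Torus Hamiltonian with tilt `u`. -/
def torusH (d N : ℕ) [NeZero N] (U : ℝ → ℝ) (φ : (Fin d → ZMod N) → ℝ)
    (u : Fin d → ℝ) : ℝ :=
  ∑ x : Fin d → ZMod N, ∑ i : Fin d, U (φ (x + Pi.single i 1) - φ x + u i)

/-- Extension of a configuration on the torus minus the origin by `0` at the origin. -/
def torusExt (d N : ℕ) [NeZero N] (ψ : {x : Fin d → ZMod N // x ≠ 0} → ℝ) :
    (Fin d → ZMod N) → ℝ :=
  fun x => if h : x = 0 then 0 else ψ ⟨x, h⟩

/-- Torus partition function. -/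
def torusZ (β : ℝ) (d N : ℕ) [NeZero N] (U : ℝ → ℝ) (u : Fin d → ℝ) : ℝ :=
  ∫ ψ : {x : Fin d → ZMod N // x ≠ 0} → ℝ,
    Real.exp (-β * torusH d N U (torusExt d N ψ) u)

/-- Torus surface tension. -/
def torusSigmaAux (β : ℝ) (d N : ℕ) [NeZero N] (U : ℝ → ℝ) (u : Fin d → ℝ) : ℝ :=
  -(1/(N^d : ℝ)) * Real.log (torusZ β d N U u / torusZ β d N U 0)

/-- Torus surface tension (junk value `0` for `N = 0`). -/
def torusSigma (β : ℝ) (d : ℕ) (U : ℝ → ℝ) (N : ℕ) (u : Fin d → ℝ) : ℝ :=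
  if hN : N = 0 then 0 else @torusSigmaAux β d N ⟨hN⟩ U u

open scoped ENNReal in
lemma bm1_compact {s t : ℝ} (hs : 0 < s) (ht : 0 < t) {A B C : Set ℝ} (hA : IsCompact A)
    (hB : IsCompact B) (hAn : A.Nonempty) (hBn : B.Nonempty)
    (hC : ∀ a ∈ A, ∀ b ∈ B, s * a + t * b ∈ C) :
    ENNReal.ofReal s * volume A + ENNReal.ofReal t * volume B ≤ volume C := by
  obtain ⟨a1, ha1, ha1'⟩ := hA.exists_isGreatest hAn
  obtain ⟨b0, hb0, hb0'⟩ := hB.exists_isLeast hBn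
  set A' : Set ℝ := Set.image (fun x => x + t * b0) (Set.image (fun x => s • x) A) with hA'
  set B' : Set ℝ := Set.image (fun x => x + s * a1) (Set.image (fun x => t • x) B) with hB'
  have mA : volume A' = ENNReal.ofReal s * volume A := by
    rw [hA', Set.image_add_right, measure_preimage_add_right]
    have := Measure.addHaar_image_homothety (volume : Measure ℝ) (0:ℝ) s A
    have e : Set.image (fun x : ℝ => s • x) A = Set.image (AffineMap.homothety (0:ℝ) s) A := by
      apply Set.image_congr; intro x _; simp [AffineMap.homothety_apply]
    rw [e, this]; simp [abs_of_pos hs]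
  have mB : volume B' = ENNReal.ofReal t * volume B := by
    rw [hB', Set.image_add_right, measure_preimage_add_right]
    have := Measure.addHaar_image_homothety (volume : Measure ℝ) (0:ℝ) t B
    have e : Set.image (fun x : ℝ => t • x) B = Set.image (AffineMap.homothety (0:ℝ) t) B := by
      apply Set.image_congr; intro x _; simp [AffineMap.homothety_apply]
    rw [e, this]; simp [abs_of_pos ht]
  have hBc : IsCompact B' := by
    rw [hB', Set.image_image]
    exact hB.image (by fun_prop)
  have hd : AEDisjoint volume A' B' := by
    apply measure_mono_null (t := {s * a1 + t * b0})
    · rintro x ⟨⟨_, ⟨a, ha, rfl⟩, rfl⟩, ⟨_, ⟨b, hb, rfl⟩, hx⟩⟩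
      have h1 := ha1' ha
      have h2 := hb0' hb
      simp only [smul_eq_mul, Set.mem_singleton_iff] at *
      nlinarith
    · simp
  rw [← mA, ← mB, ← measure_union₀ hBc.measurableSet.nullMeasurableSet hd]
  apply measure_mono
  rintro x (⟨_, ⟨a, ha, rfl⟩, rfl⟩ | ⟨_, ⟨b, hb, rfl⟩, rfl⟩)
  · exact hC a ha b0 hb0
  · have := hC a1 ha1 b hb
    simpa [add_comm] using this

lemma bm1 {s t : ℝ} (hs : 0 < s) (ht : 0 < t) {A B C : Set ℝ} (hA : MeasurableSet A)
    (hB : MeasurableSet B) (hAn : A.Nonempty) (hBn : B.Nonempty)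
    (hC : ∀ a ∈ A, ∀ b ∈ B, s * a + t * b ∈ C) :
    ENNReal.ofReal s * volume A + ENNReal.ofReal t * volume B ≤ volume C := by
  obtain ⟨a, ha⟩ := hAn
  obtain ⟨b, hb⟩ := hBn
  rw [hA.measure_eq_iSup_isCompact, hB.measure_eq_iSup_isCompact]
  simp only [ENNReal.mul_iSup]
  simp only [iSup_and']
  refine ENNReal.biSup_add_biSup_le' (p := fun K => K ⊆ A ∧ IsCompact K)
    (q := fun K => K ⊆ B ∧ IsCompact K) ⟨∅, by simp⟩ ⟨∅, by simp⟩ ?_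
  rintro K ⟨hK, hKc⟩ K' ⟨hK', hKc'⟩
  have h := bm1_compact hs ht (hKc.insert a) (hKc'.insert b) ⟨a, by simp⟩ ⟨b, by simp⟩ (C := C) (by
    intro x hx y hy
    apply hC
    · rcases hx with rfl | hx
      · exact ha
      · exact hK hx
    · rcases hy with rfl | hy
      · exact hb
      · exact hK' hy)
  refine le_trans ?_ h
  gcongr <;> exact Set.subset_insert _ _

lemma pl1_norm {s t : ℝ} (hs : 0 < s) (ht : 0 < t) {f g h : ℝ → ℝ}
    (hf : Measurable f) (hg : Measurable g) (hh : Measurable h)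
    (hf0 : ∀ x, 0 ≤ f x) (hg0 : ∀ x, 0 ≤ g x) (hh0 : ∀ x, 0 ≤ h x)
    (hf1 : ∀ x, f x ≤ 1) (hg1 : ∀ x, g x ≤ 1)
    (hfs : ∀ τ < 1, ∃ x, τ < f x) (hgs : ∀ τ < 1, ∃ x, τ < g x)
    (H : ∀ τ, 0 < τ → τ < 1 → ∀ x y, τ < f x → τ < g y → τ < h (s * x + t * y)) :
    ENNReal.ofReal s * (∫⁻ x, ENNReal.ofReal (f x)) + ENNReal.ofReal t * (∫⁻ x, ENNReal.ofReal (g x))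
      ≤ ∫⁻ x, ENNReal.ofReal (h x) := by
  rw [lintegral_eq_lintegral_meas_lt _ (ae_of_all _ hf0) hf.aemeasurable,
    lintegral_eq_lintegral_meas_lt _ (ae_of_all _ hg0) hg.aemeasurable,
    lintegral_eq_lintegral_meas_lt _ (ae_of_all _ hh0) hh.aemeasurable]
  have mf : Measurable fun τ : ℝ => volume {a | τ < f a} :=
    Antitone.measurable (fun a b hab => measure_mono (fun x hx => lt_of_le_of_lt hab hx))
  have mg : Measurable fun τ : ℝ => volume {a | τ < g a} :=
    Antitone.measurable (fun a b hab => measure_mono (fun x hx => lt_of_le_of_lt hab hx))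
  rw [← lintegral_const_mul _ mf, ← lintegral_const_mul _ mg,
    ← lintegral_add_left (mf.const_mul _)]
  apply setLIntegral_mono' measurableSet_Ioi
  intro τ hτ
  simp only [Set.mem_Ioi] at hτ
  by_cases h1 : τ < 1
  · apply bm1 hs ht (measurableSet_lt measurable_const hf) (measurableSet_lt measurable_const hg)
      (hfs τ h1) (hgs τ h1)
    intro a ha b hb
    exact H τ hτ h1 a b ha hb
  · have e1 : {a | τ < f a} = ∅ := by
      ext x; simp; linarith [hf1 x]
    have e2 : {a | τ < g a} = ∅ := by
      ext x; simp; linarith [hg1 x]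
    simp [e1, e2]

open scoped ENNReal

lemma ennreal_amgm {s t : ℝ} (hs : 0 < s) (ht : 0 < t) (hst : s + t = 1) (a b : ℝ≥0∞) :
    a ^ s * b ^ t ≤ ENNReal.ofReal s * a + ENNReal.ofReal t * b := by
  by_cases ha : a = ∞
  · subst ha; simp [ENNReal.mul_top, hs]
  by_cases hb : b = ∞
  · subst hb; simp [ENNReal.mul_top, ht]
  lift a to NNReal using ha
  lift b to NNReal using hb
  lift s to NNReal using hs.le
  lift t to NNReal using ht.le
  have := NNReal.geom_mean_le_arith_mean2_weighted s t a b (by exact_mod_cast hst)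
  rw [← ENNReal.coe_rpow_of_nonneg a s.coe_nonneg, ← ENNReal.coe_rpow_of_nonneg b t.coe_nonneg]
  simp only [ENNReal.ofReal_coe_nnreal]
  exact_mod_cast this

lemma pl1_bdd {s t : ℝ} (hs : 0 < s) (ht : 0 < t) (hst : s + t = 1) {f g h : ℝ → ℝ≥0∞}
    (hf : Measurable f) (hg : Measurable g) (hh : Measurable h)
    (hfb : ⨆ x, f x ≠ ∞) (hgb : ⨆ x, g x ≠ ∞)
    (H : ∀ x y, f x ^ s * g y ^ t ≤ h (s * x + t * y)) :
    (∫⁻ x, f x) ^ s * (∫⁻ x, g x) ^ t ≤ ∫⁻ x, h x := by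
  set F := ⨆ x, f x with hF
  set G := ⨆ x, g x with hG
  have hfF : ∀ x, f x ≤ F := fun x => le_iSup f x
  have hgG : ∀ x, g x ≤ G := fun x => le_iSup g x
  by_cases F0 : F = 0
  · have : ∀ x, f x = 0 := fun x => le_antisymm (F0 ▸ hfF x) bot_le
    simp [this, hs]
  by_cases G0 : G = 0
  · have : ∀ x, g x = 0 := fun x => le_antisymm (G0 ▸ hgG x) bot_le
    simp [this, ht]
  set K := F ^ s * G ^ t with hK
  have K0 : K ≠ 0 := by
    simp only [hK, ne_eq, mul_eq_zero, not_or]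
    exact ⟨(ENNReal.rpow_pos (pos_iff_ne_zero.2 F0) hfb).ne', (ENNReal.rpow_pos (pos_iff_ne_zero.2 G0) hgb).ne'⟩
  have Kt : K ≠ ∞ := ENNReal.mul_ne_top (ENNReal.rpow_ne_top_of_nonneg hs.le hfb)
    (ENNReal.rpow_ne_top_of_nonneg ht.le hgb)
  have ef : ∀ x, ENNReal.ofReal ((f x / F).toReal) = f x / F := fun x =>
    ENNReal.ofReal_toReal (ENNReal.div_ne_top ((hfF x).trans_lt hfb.lt_top).ne F0)
  have eg : ∀ x, ENNReal.ofReal ((g x / G).toReal) = g x / G := fun x =>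
    ENNReal.ofReal_toReal (ENNReal.div_ne_top ((hgG x).trans_lt hgb.lt_top).ne G0)
  have key := pl1_norm hs ht (f := fun x => (f x / F).toReal) (g := fun x => (g x / G).toReal)
    (h := fun x => (min (h x / K) 1).toReal) (by fun_prop) (by fun_prop) (by fun_prop)
    (fun _ => ENNReal.toReal_nonneg) (fun _ => ENNReal.toReal_nonneg)
    (fun _ => ENNReal.toReal_nonneg)
    (fun x => by
      have : f x / F ≤ 1 := ENNReal.div_le_of_le_mul (by simpa using hfF x)
      exact ENNReal.toReal_le_of_le_ofReal (by norm_num) (by simpa using this))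
    (fun x => by
      have : g x / G ≤ 1 := ENNReal.div_le_of_le_mul (by simpa using hgG x)
      exact ENNReal.toReal_le_of_le_ofReal (by norm_num) (by simpa using this))
    (fun τ hτ => by
      have : ENNReal.ofReal τ * F < F := by
        calc ENNReal.ofReal τ * F < 1 * F :=
          ENNReal.mul_lt_mul_left F0 hfb (by simpa using hτ)
          _ = F := one_mul _
      obtain ⟨x, hx⟩ := lt_iSup_iff.1 this
      refine ⟨x, ?_⟩
      rw [← ENNReal.lt_div_iff_mul_lt (Or.inl F0) (Or.inl hfb), ← ef] at hx
      exact lt_of_not_ge fun h => hx.not_ge (ENNReal.ofReal_le_ofReal h))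
    (fun τ hτ => by
      have : ENNReal.ofReal τ * G < G := by
        calc ENNReal.ofReal τ * G < 1 * G :=
          ENNReal.mul_lt_mul_left G0 hgb (by simpa using hτ)
          _ = G := one_mul _
      obtain ⟨x, hx⟩ := lt_iSup_iff.1 this
      refine ⟨x, ?_⟩
      rw [← ENNReal.lt_div_iff_mul_lt (Or.inl G0) (Or.inl hgb), ← eg] at hx
      exact lt_of_not_ge fun h => hx.not_ge (ENNReal.ofReal_le_ofReal h))
    (fun τ h0 h1 x y hx hy => by
      have hx' : ENNReal.ofReal τ * F < f x := by
        rw [← ENNReal.lt_div_iff_mul_lt (Or.inl F0) (Or.inl hfb), ← ef]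
        exact (ENNReal.ofReal_lt_ofReal_iff_of_nonneg h0.le).2 hx
      have hy' : ENNReal.ofReal τ * G < g y := by
        rw [← ENNReal.lt_div_iff_mul_lt (Or.inl G0) (Or.inl hgb), ← eg]
        exact (ENNReal.ofReal_lt_ofReal_iff_of_nonneg h0.le).2 hy
      have h3 : ENNReal.ofReal τ * K < h (s * x + t * y) := by
        refine lt_of_lt_of_le ?_ (H x y)
        have e : ENNReal.ofReal τ * K = (ENNReal.ofReal τ * F) ^ s * (ENNReal.ofReal τ * G) ^ t := by
          rw [ENNReal.mul_rpow_of_nonneg _ _ hs.le, ENNReal.mul_rpow_of_nonneg _ _ ht.le, hK]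
          have : ENNReal.ofReal τ = ENNReal.ofReal τ ^ s * ENNReal.ofReal τ ^ t := by
            rw [← ENNReal.rpow_add _ _ (by simpa using h0) (by simp), hst, ENNReal.rpow_one]
          nth_rw 1 [this]
          ring
        rw [e]
        exact ENNReal.mul_lt_mul (ENNReal.rpow_lt_rpow hx' hs) (ENNReal.rpow_lt_rpow hy' ht)
      rw [← ENNReal.lt_div_iff_mul_lt (Or.inl K0) (Or.inl Kt)] at h3
      have h4 : ENNReal.ofReal τ < min (h (s * x + t * y) / K) 1 := lt_min h3 (by simpa using h1)
      rwa [ENNReal.ofReal_lt_iff_lt_toReal h0.le (by simp)] at h4)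
  simp only [ef, eg] at key
  have i1 : ∫⁻ x, f x / F = (∫⁻ x, f x) / F := by
    simp only [div_eq_mul_inv]; rw [lintegral_mul_const _ hf]
  have i2 : ∫⁻ x, g x / G = (∫⁻ x, g x) / G := by
    simp only [div_eq_mul_inv]; rw [lintegral_mul_const _ hg]
  have i3 : ∫⁻ x, ENNReal.ofReal (min (h x / K) 1).toReal ≤ (∫⁻ x, h x) / K := by
    rw [div_eq_mul_inv, ← lintegral_mul_const _ hh]
    apply lintegral_mono
    intro x
    exact ENNReal.ofReal_toReal_le.trans (min_le_left _ _)
  have k2 := (ennreal_amgm hs ht hst _ _).trans (key.trans i3)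
  rw [i1, i2, ENNReal.div_rpow_of_nonneg _ _ hs.le, ENNReal.div_rpow_of_nonneg _ _ ht.le] at k2
  have k3 := mul_le_mul_left k2 K
  rw [ENNReal.div_mul_cancel K0 Kt] at k3
  refine le_trans (le_of_eq ?_) k3
  have a1 : F ^ s ≠ 0 := (ENNReal.rpow_pos (pos_iff_ne_zero.2 F0) hfb).ne'
  have a2 : G ^ t ≠ 0 := (ENNReal.rpow_pos (pos_iff_ne_zero.2 G0) hgb).ne'
  have a3 := (ENNReal.rpow_ne_top_of_nonneg hs.le hfb)
  have a4 := (ENNReal.rpow_ne_top_of_nonneg ht.le hgb)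
  calc _ = ((∫⁻ x, f x) ^ s / F ^ s * F ^ s) * ((∫⁻ x, g x) ^ t / G ^ t * G ^ t) := by
        rw [ENNReal.div_mul_cancel a1 a3, ENNReal.div_mul_cancel a2 a4]
    _ = _ := by rw [hK]; ring

lemma lintegral_min_iSup {α : Type*} [MeasurableSpace α] (μ : Measure α) {f : α → ℝ≥0∞}
    (hf : Measurable f) : ∫⁻ x, f x ∂μ = ⨆ n : ℕ, ∫⁻ x, min (f x) n ∂μ := by
  rw [← lintegral_iSup (fun n => hf.min measurable_const)]
  · congr with x
    apply le_antisymm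
    · rcases eq_or_ne (f x) ∞ with h | h
      · simp [h, ENNReal.iSup_natCast]
      · obtain ⟨n, hn⟩ := ENNReal.exists_nat_gt h
        exact le_iSup_of_le n (by simp [hn.le])
    · exact iSup_le fun n => min_le_left _ _
  · intro m n hmn x
    exact min_le_min le_rfl (by exact_mod_cast hmn)

lemma pl1 {s t : ℝ} (hs : 0 < s) (ht : 0 < t) (hst : s + t = 1) {f g h : ℝ → ℝ≥0∞}
    (hf : Measurable f) (hg : Measurable g) (hh : Measurable h)
    (H : ∀ x y, f x ^ s * g y ^ t ≤ h (s * x + t * y)) :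
    (∫⁻ x, f x) ^ s * (∫⁻ x, g x) ^ t ≤ ∫⁻ x, h x := by
  rw [lintegral_min_iSup _ hf, lintegral_min_iSup _ hg]
  have e1 : ∀ {r : ℝ} (_ : 0 < r) (F : ℕ → ℝ≥0∞), (⨆ n, F n) ^ r = ⨆ n, F n ^ r := fun hr F =>
    (ENNReal.orderIsoRpow _ hr).map_iSup F
  have mono : ∀ {f : ℝ → ℝ≥0∞} {r : ℝ} (_ : 0 < r), Monotone fun n : ℕ => (∫⁻ x, min (f x) n) ^ r := by
    intro f r hr m n hmn
    apply ENNReal.rpow_le_rpow _ hr.le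
    apply lintegral_mono
    intro x
    exact min_le_min le_rfl (by exact_mod_cast hmn)
  rw [e1 hs, e1 ht, ENNReal.iSup_mul]
  simp only [ENNReal.mul_iSup]
  refine iSup_le fun m₁ => iSup_le fun m₂ => ?_
  set n := max m₁ m₂
  refine (mul_le_mul' (mono (f := f) hs (le_max_left m₁ m₂))
    (mono (f := g) ht (le_max_right m₁ m₂))).trans ?_
  apply pl1_bdd hs ht hst (hf.min measurable_const) (hg.min measurable_const) hh
  · exact ne_top_of_le_ne_top (ENNReal.natCast_ne_top n) (iSup_le fun x => min_le_right _ _)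
  · exact ne_top_of_le_ne_top (ENNReal.natCast_ne_top n) (iSup_le fun x => min_le_right _ _)
  · intro x y
    refine le_trans ?_ (H x y)
    gcongr
    · exact min_le_left _ _
    · exact min_le_left _ _

lemma pl_fin {s t : ℝ} (hs : 0 < s) (ht : 0 < t) (hst : s + t = 1) (n : ℕ) :
    ∀ {f g h : (Fin n → ℝ) → ℝ≥0∞}
    (hf : Measurable f) (hg : Measurable g) (hh : Measurable h)
    (H : ∀ x y, f x ^ s * g y ^ t ≤ h (s • x + t • y)),
    (∫⁻ x, f x) ^ s * (∫⁻ x, g x) ^ t ≤ ∫⁻ x, h x := by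
  induction n with
  | zero =>
    intro f g h hf hg hh H
    have := H 0 0
    rw [volume_pi, Measure.pi_of_empty _ 0, lintegral_dirac, lintegral_dirac, lintegral_dirac]
    simpa using this
  | succ n ih =>
    intro f g h hf hg hh H
    have e := (volume_preserving_piFinSuccAbove (fun _ : Fin (n+1) => ℝ) 0).symm
    have conv : ∀ {F : (Fin (n+1) → ℝ) → ℝ≥0∞}, Measurable F →
        ∫⁻ x, F x = ∫⁻ a : ℝ, ∫⁻ y : Fin n → ℝ, F (Fin.cons a y) := by
      intro F hF
      rw [← e.lintegral_comp hF, Measure.volume_eq_prod, lintegral_prod]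
      · refine lintegral_congr fun a => lintegral_congr fun y => ?_
        congr 1
        exact Fin.insertNth_zero' a y
      · exact (hF.comp e.measurable).aemeasurable
    have mc : ∀ {F : (Fin (n+1) → ℝ) → ℝ≥0∞}, Measurable F →
      Measurable (fun p : ℝ × (Fin n → ℝ) => F (Fin.cons p.1 p.2)) := by
      intro F hF
      refine hF.comp ?_
      refine measurable_pi_iff.2 fun i => ?_
      refine Fin.cases ?_ (fun i => ?_) i
      · simpa using measurable_fst
      · simpa [Function.comp_def] using (measurable_pi_apply i).comp (measurable_snd (α := ℝ) (β := Fin n → ℝ))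
    rw [conv hf, conv hg, conv hh]
    apply pl1 hs ht hst (mc hf).lintegral_prod_right (mc hg).lintegral_prod_right
      (mc hh).lintegral_prod_right
    intro a b
    apply ih ((mc hf).comp (by fun_prop : Measurable fun y : Fin n → ℝ => (a, y)))
     ((mc hg).comp (by fun_prop : Measurable fun y : Fin n → ℝ => (b, y)))
     ((mc hh).comp (by fun_prop : Measurable fun y : Fin n → ℝ => (s * a + t * b, y)))
    intro x y
    refine (H _ _).trans (le_of_eq ?_)
    congr 1
    ext i
    refine Fin.cases ?_ (fun i => ?_) i <;> simp

/-- Prékopa–Leindler inequality. -/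
lemma prekopa_leindler {ι : Type*} [Fintype ι] {s t : ℝ} (hs : 0 < s) (ht : 0 < t)
    (hst : s + t = 1) {f g h : (ι → ℝ) → ℝ≥0∞}
    (hf : Measurable f) (hg : Measurable g) (hh : Measurable h)
    (H : ∀ x y, f x ^ s * g y ^ t ≤ h (s • x + t • y)) :
    (∫⁻ x, f x) ^ s * (∫⁻ x, g x) ^ t ≤ ∫⁻ x, h x := by
  have e := volume_measurePreserving_piCongrLeft (fun _ : ι => ℝ) (Fintype.equivFin ι).symm
  rw [← e.lintegral_comp hf, ← e.lintegral_comp hg, ← e.lintegral_comp hh]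
  apply pl_fin hs ht hst _ (hf.comp e.measurable) (hg.comp e.measurable) (hh.comp e.measurable)
  intro x y
  refine (H _ _).trans (le_of_eq ?_)
  congr 1
  ext i
  obtain ⟨j, rfl⟩ := (Fintype.equivFin ι).symm.surjective i
  simp [MeasurableEquiv.coe_piCongrLeft, Equiv.piCongrLeft_apply_apply]

/-- Tonelli for products. -/
lemma lintegral_fin_prod {E : Type*} [MeasureSpace E] [SigmaFinite (volume : Measure E)] (n : ℕ) :
    ∀ {f : Fin n → E → ℝ≥0∞} (_ : ∀ i, Measurable (f i)),
    ∫⁻ x : Fin n → E, ∏ i, f i (x i) = ∏ i, ∫⁻ y, f i y := by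
  induction n with
  | zero =>
    intro f hf
    rw [volume_pi, Measure.pi_of_empty _ Fin.elim0, lintegral_dirac' _ (by simp)]
    simp
  | succ n ih =>
    intro f hf
    have e := (volume_preserving_piFinSuccAbove (fun _ : Fin (n+1) => E) 0).symm
    have m : Measurable fun x : Fin (n+1) → E => ∏ i, f i (x i) :=
      Finset.measurable_prod _ fun i _ => (hf i).comp (measurable_pi_apply i)
    have m' : Measurable fun x : Fin n → E => ∏ i, f (Fin.succ i) (x i) :=
      Finset.measurable_prod _ fun i _ => (hf _).comp (measurable_pi_apply i)
    rw [← e.lintegral_comp m, Measure.volume_eq_prod, Fin.prod_univ_succ, ← ih fun i => hf i.succ,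
      ← lintegral_prod_mul (hf 0).aemeasurable m'.aemeasurable]
    congr with p
    rw [Fin.prod_univ_succ]
    rfl

lemma lintegral_pi_prod {E : Type*} [MeasureSpace E] [SigmaFinite (volume : Measure E)]
    {ι : Type*} [Fintype ι] {f : ι → E → ℝ≥0∞} (hf : ∀ i, Measurable (f i)) :
    ∫⁻ x : ι → E, ∏ i, f i (x i) = ∏ i, ∫⁻ y, f i y := by
  have e := volume_measurePreserving_piCongrLeft (fun _ : ι => E) (Fintype.equivFin ι).symm
  have m : Measurable fun x : ι → E => ∏ i, f i (x i) :=
      Finset.measurable_prod _ fun i _ => (hf i).comp (measurable_pi_apply i)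
  rw [← e.lintegral_comp m, ← (Fintype.equivFin ι).symm.prod_comp,
    ← lintegral_fin_prod _ fun i => hf _]
  congr with x
  rw [← (Fintype.equivFin ι).symm.prod_comp]
  simp [MeasurableEquiv.coe_piCongrLeft, Equiv.piCongrLeft_apply_apply]

lemma gauss_int2 {α : ℝ} (hα : 0 < α) : Integrable (fun t : ℝ => (1 + t^2) * exp (-α * t^2)) := by
  have h1 := integrable_exp_neg_mul_sq hα
  have h2 := integrable_rpow_mul_exp_neg_mul_sq hα (s := 2) (by norm_num)
  refine (h1.add h2).congr (ae_of_all _ fun t => ?_)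
  simp; ring

/-- weights with Gaussian decay -/
def GW (p : ℝ → ℝ) : Prop := Continuous p ∧ (∀ t, 0 < p t) ∧ ∃ K α : ℝ, 0 < α ∧ ∀ t, p t ≤ K * exp (-α * t^2)

lemma GW.int {p : ℝ → ℝ} (hp : GW p) {f : ℝ → ℝ} (hf : Continuous f) {M : ℝ}
    (hM : ∀ t, |f t| ≤ M * (1 + t^2)) : Integrable (fun t => f t * p t) := by
  obtain ⟨hc, h0, K, α, hα, hK⟩ := hp
  refine ((gauss_int2 hα).const_mul (M * K)).mono' (hf.mul hc).aestronglyMeasurable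
    (ae_of_all _ fun t => ?_)
  rw [norm_mul, norm_eq_abs, norm_eq_abs, abs_of_pos (h0 t)]
  calc _ ≤ (M * (1 + t^2)) * (K * exp (-α * t^2)) :=
        mul_le_mul (hM t) (hK t) (h0 t).le ((abs_nonneg _).trans (hM t))
    _ = _ := by ring

lemma GW.pos {p : ℝ → ℝ} (hp : GW p) : 0 < ∫ t, p t := by
  have hi : Integrable p := by
    simpa using hp.int (f := fun _ => 1) (M := 1) continuous_const (fun t => by
      simp; positivity)
  rw [integral_pos_iff_support_of_nonneg (fun t => (hp.2.1 t).le) hi]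
  have : Function.support p = Set.univ := by
    ext x; simp [(hp.2.1 x).ne']
  simp [this]

/-- covariance lower bound from pointwise bound on increments -/
lemma cov_lb {p f h : ℝ → ℝ} (hp : GW p) (hf : Continuous f) (hh : Continuous h) {M : ℝ}
    (hfM : ∀ t, |f t| ≤ M * (1 + |t|)) (hhM : ∀ t, |h t| ≤ M * (1 + |t|)) {α κ : ℝ}
    (H : ∀ s t, α * (t - s)^2 - κ ≤ (f t - f s) * (h t - h s)) :
    α * ((∫ t, p t) * (∫ t, t^2 * p t) - (∫ t, t * p t)^2) - κ / 2 * (∫ t, p t)^2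
     ≤ (∫ t, p t) * (∫ t, f t * h t * p t) - (∫ t, f t * p t) * (∫ t, h t * p t) := by
  have M0 : 0 ≤ M := by have := (abs_nonneg _).trans (hfM 0); simpa using this
  have b1 : ∀ t : ℝ, |t| ≤ 1 + t^2 := fun t => by
    nlinarith [sq_abs t, sq_nonneg (|t| - 1), abs_nonneg t]
  have b2 : ∀ t : ℝ, M * (1 + |t|) ≤ (2 * M) * (1 + t^2) := fun t => by
    nlinarith [b1 t, sq_nonneg t, mul_le_mul_of_nonneg_left (b1 t) M0, mul_nonneg M0 (sq_nonneg t)]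
  have i0 : Integrable p := by
    simpa using hp.int (f := fun _ => 1) (M := 1) continuous_const (fun t => by simp; positivity)
  have i1 : Integrable (fun t => t * p t) := hp.int continuous_id (M := 1) (by simpa using b1)
  have i2 : Integrable (fun t => t^2 * p t) := hp.int (by fun_prop) (M := 1) (fun t => by
    rw [abs_of_nonneg (sq_nonneg t)]; linarith)
  have jf : Integrable (fun t => f t * p t) := hp.int hf (fun t => (hfM t).trans (b2 t))
  have jh : Integrable (fun t => h t * p t) := hp.int hh (fun t => (hhM t).trans (b2 t))
  have jfh : Integrable (fun t => f t * h t * p t) := hp.int (hf.mul hh) (M := 2 * M^2) (fun t => by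
    rw [abs_mul]
    calc _ ≤ (M * (1 + |t|)) * (M * (1 + |t|)) :=
          mul_le_mul (hfM t) (hhM t) (abs_nonneg _) ((abs_nonneg _).trans (hfM t))
      _ = M^2 * (1 + |t|)^2 := by ring
      _ ≤ M^2 * (2 * (1 + t^2)) := by
          gcongr; nlinarith [sq_abs t, sq_nonneg (|t| - 1)]
      _ = _ := by ring)
  set D := ∫ t, p t
  set M1 := ∫ t, t * p t
  set M2 := ∫ t, t^2 * p t
  set F := ∫ t, f t * p t
  set Hh := ∫ t, h t * p t
  set FH := ∫ t, f t * h t * p t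
  have step : ∀ s, 0 ≤ FH - f s * Hh - h s * F + f s * h s * D
      - α * (M2 - 2 * s * M1 + s^2 * D) + κ * D := by
    intro s
    have e : ∫ t, ((f t - f s) * (h t - h s) - α * (t - s)^2 + κ) * p t
      = FH - f s * Hh - h s * F + f s * h s * D
      - α * (M2 - 2 * s * M1 + s^2 * D) + κ * D := by
      have : ∀ t, ((f t - f s) * (h t - h s) - α * (t - s)^2 + κ) * p t
        = f t * h t * p t - f s * (h t * p t) - h s * (f t * p t) + (f s * h s - α * s^2 + κ) * p t
          - α * (t^2 * p t) + (2 * α * s) * (t * p t) := fun t => by ring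
      simp_rw [this]
      rw [integral_add, integral_sub, integral_add, integral_sub, integral_sub]
      · simp only [integral_const_mul]
        ring
      all_goals first | fun_prop | skip
    rw [← e]
    apply integral_nonneg
    intro t
    exact mul_nonneg (by linarith [H s t]) (hp.2.1 t).le
  have e2 : ∫ s, (FH - f s * Hh - h s * F + f s * h s * D
      - α * (M2 - 2 * s * M1 + s^2 * D) + κ * D) * p s =
      2 * (D * FH - F * Hh) - 2 * α * (D * M2 - M1^2) + κ * D^2 := by
    have : ∀ s, (FH - f s * Hh - h s * F + f s * h s * D
      - α * (M2 - 2 * s * M1 + s^2 * D) + κ * D) * p s =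
      (FH - α * M2 + κ * D) * p s - Hh * (f s * p s) - F * (h s * p s) + D * (f s * h s * p s)
        + (2 * α * M1) * (s * p s) - (α * D) * (s^2 * p s) := fun s => by ring
    simp_rw [this]
    rw [integral_sub, integral_add, integral_add, integral_sub, integral_sub]
    · simp only [integral_const_mul]
      ring
    all_goals first | fun_prop | skip
  have e3 : 0 ≤ 2 * (D * FH - F * Hh) - 2 * α * (D * M2 - M1^2) + κ * D^2 := by
    rw [← e2]
    exact integral_nonneg fun s => mul_nonneg (step s) (hp.2.1 s).le
  linarith

structure Pot (U U1 U2 : ℝ → ℝ) (A B C : ℝ) : Prop where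
  A_pos : 0 < A
  lb : ∀ x, A * x^2 - B ≤ U x
  d1 : ∀ x, HasDerivAt U (U1 x) x
  d2 : ∀ x, HasDerivAt U1 (U2 x) x
  c2 : Continuous U2
  b1 : ∀ x, |U1 x| ≤ C * (1 + |x|)
  b2 : ∀ x, |U2 x| ≤ C

section
variable {ι : Type*} [Fintype ι]

def Pw (β : ℝ) (U : ℝ → ℝ) (a v : ι → ℝ) (s t : ℝ) : ℝ := exp (-(β * ∑ j, U (t - (a j + s * v j))))

variable {U U1 U2 : ℝ → ℝ} {A B C β : ℝ}

lemma Pot.cU (h : Pot U U1 U2 A B C) : Continuous U :=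
  continuous_iff_continuousAt.2 fun x => (h.d1 x).continuousAt
lemma Pot.cU1 (h : Pot U U1 U2 A B C) : Continuous U1 :=
  continuous_iff_continuousAt.2 fun x => (h.d2 x).continuousAt
lemma Pot.C0 (h : Pot U U1 U2 A B C) : 0 ≤ C := (abs_nonneg _).trans (h.b2 0)

lemma Pw_bound (h : Pot U U1 U2 A B C) (hβ : 0 < β) [Nonempty ι] (a v : ι → ℝ) (s0 : ℝ) :
    ∃ K α : ℝ, 0 < α ∧ ∀ s, |s - s0| < 1 → ∀ t, Pw β U a v s t ≤ K * exp (-α * t^2) := by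
  set R : ℝ := ∑ j, (|a j| + (|s0| + 1) * |v j|) with hR
  set n : ℝ := (Fintype.card ι : ℝ) with hn
  have n0 : 0 < n := by simp [hn, Fintype.card_pos]
  refine ⟨exp (β * n * (A * R^2 + B)), β * n * A / 2, by have := h.A_pos; positivity, ?_⟩
  intro s hs t
  rw [Pw, ← exp_add]
  apply exp_le_exp.2
  have hs' : |s| ≤ |s0| + 1 := by
    have := abs_add_le (s - s0) s0
    simp at this; linarith
  have hc : ∀ j, |a j + s * v j| ≤ R := fun j => by
    calc _ ≤ |a j| + |s| * |v j| := by rw [← abs_mul]; exact abs_add_le _ _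
      _ ≤ |a j| + (|s0| + 1) * |v j| := by gcongr
      _ ≤ R := Finset.single_le_sum (f := fun j => (|a j| + (|s0| + 1) * |v j|))
            (fun i _ => by positivity) (Finset.mem_univ j)
  have : ∑ j : ι, (A * (t^2/2 - R^2) - B) ≤ ∑ j, U (t - (a j + s * v j)) := by
    apply Finset.sum_le_sum
    intro j _
    refine le_trans ?_ (h.lb _)
    have h1 : (a j + s * v j)^2 ≤ R^2 := sq_le_sq' (by linarith [neg_abs_le (a j + s * v j), hc j])
      (by linarith [le_abs_self (a j + s * v j), hc j])
    have : t^2/2 - R^2 ≤ (t - (a j + s * v j))^2 := by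
      nlinarith [sq_nonneg (t - 2 * (a j + s * v j))]
    linarith [mul_le_mul_of_nonneg_left this h.A_pos.le]
  rw [Finset.sum_const, Finset.card_univ, nsmul_eq_mul, ← hn] at this
  have := mul_le_mul_of_nonneg_left this hβ.le
  linarith

lemma Pw_GW (h : Pot U U1 U2 A B C) (hβ : 0 < β) [Nonempty ι] (a v : ι → ℝ) (s : ℝ) :
    GW (Pw β U a v s) := by
  obtain ⟨K, α, hα, hK⟩ := Pw_bound h hβ a v s
  refine ⟨?_, fun t => exp_pos _, K, α, hα, hK s (by simp)⟩
  have := h.cU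
  unfold Pw; fun_prop

lemma U1_bound (h : Pot U U1 U2 A B C) (a v : ι → ℝ) (s0 : ℝ) :
    ∃ M : ℝ, 0 ≤ M ∧ ∀ s, |s - s0| < 1 → ∀ j t, |U1 (t - (a j + s * v j))| ≤ M * (1 + |t|) := by
  set R : ℝ := ∑ j, (|a j| + (|s0| + 1) * |v j|) with hR
  have R0 : 0 ≤ R := Finset.sum_nonneg fun i _ => by positivity
  have C0 := h.C0
  refine ⟨C * (1 + R), by positivity, fun s hs j t => (h.b1 _).trans ?_⟩
  have hs' : |s| ≤ |s0| + 1 := by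
    have := abs_add_le (s - s0) s0
    simp at this; linarith
  have hc : |a j + s * v j| ≤ R := by
    calc _ ≤ |a j| + |s| * |v j| := by rw [← abs_mul]; exact abs_add_le _ _
      _ ≤ |a j| + (|s0| + 1) * |v j| := by gcongr
      _ ≤ R := Finset.single_le_sum (f := fun j => (|a j| + (|s0| + 1) * |v j|))
            (fun i _ => by positivity) (Finset.mem_univ j)
  have h2 : |t - (a j + s * v j)| ≤ |t| + R := (abs_sub _ _).trans (by linarith)
  rw [mul_assoc]
  gcongr
  nlinarith [abs_nonneg t]

def P1w (β : ℝ) (U1 : ℝ → ℝ) (a v : ι → ℝ) (s t : ℝ) : ℝ := β * ∑ j, v j * U1 (t - (a j + s * v j))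
def P2w (β : ℝ) (U2 : ℝ → ℝ) (a v : ι → ℝ) (s t : ℝ) : ℝ :=
  β * ∑ j, v j ^ 2 * U2 (t - (a j + s * v j))

lemma P1w_bound (h : Pot U U1 U2 A B C) (hβ : 0 < β) (a v : ι → ℝ) (s0 : ℝ) :
    ∃ M : ℝ, 0 ≤ M ∧ ∀ s, |s - s0| < 1 → ∀ t, |P1w β U1 a v s t| ≤ M * (1 + |t|) := by
  obtain ⟨M, hM, H⟩ := U1_bound h a v s0
  refine ⟨β * (∑ j, |v j|) * M, by positivity, fun s hs t => ?_⟩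
  rw [P1w, abs_mul, abs_of_pos hβ, mul_assoc, mul_assoc]
  gcongr
  refine (Finset.abs_sum_le_sum_abs _ _).trans ?_
  rw [Finset.sum_mul]
  gcongr with j
  rw [abs_mul]
  gcongr
  exact H s hs j t

lemma P2w_bound (h : Pot U U1 U2 A B C) (hβ : 0 < β) (a v : ι → ℝ) :
    ∃ M : ℝ, 0 ≤ M ∧ ∀ s t, |P2w β U2 a v s t| ≤ M := by
  refine ⟨β * ((∑ j, v j^2) * C), by have := h.C0; positivity, fun s t => ?_⟩
  rw [P2w, abs_mul, abs_of_pos hβ]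
  gcongr
  refine (Finset.abs_sum_le_sum_abs _ _).trans ?_
  rw [Finset.sum_mul]
  gcongr with j
  rw [abs_mul, abs_of_nonneg (sq_nonneg _)]
  gcongr
  exact h.b2 _

lemma hd_Pw (h : Pot U U1 U2 A B C) (a v : ι → ℝ) (s t : ℝ) :
    HasDerivAt (fun s => Pw β U a v s t) (P1w β U1 a v s t * Pw β U a v s t) s := by
  unfold Pw P1w
  have h1 : ∀ j ∈ Finset.univ, HasDerivAt (fun s => U (t - (a j + s * v j))) (U1 (t - (a j + s * v j)) * (-v j)) s := by
    intro j _
    have h2 : HasDerivAt (fun s => t - (a j + s * v j)) (-v j) s := by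
      simpa using ((((hasDerivAt_id s).mul_const (v j)).const_add (a j)).const_sub t)
    exact (h.d1 _).comp s h2
  have := ((HasDerivAt.fun_sum h1).const_mul β).neg.exp
  refine this.congr_deriv ?_
  rw [mul_comm]
  congr 1
  simp only [mul_neg, Finset.sum_neg_distrib, neg_neg]
  congr 1
  exact Finset.sum_congr rfl fun j _ => mul_comm _ _

lemma hd_P1w (h : Pot U U1 U2 A B C) (a v : ι → ℝ) (s t : ℝ) :
    HasDerivAt (fun s => P1w β U1 a v s t) (- P2w β U2 a v s t) s := by
  unfold P1w P2w
  have h1 : ∀ j ∈ Finset.univ, HasDerivAt (fun s => v j * U1 (t - (a j + s * v j))) (v j * (U2 (t - (a j + s * v j)) * (-v j))) s := by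
    intro j _
    have h2 : HasDerivAt (fun s => t - (a j + s * v j)) (-v j) s := by
      simpa using ((((hasDerivAt_id s).mul_const (v j)).const_add (a j)).const_sub t)
    exact ((h.d2 _).comp s h2).const_mul _
  refine ((HasDerivAt.fun_sum h1).const_mul β).congr_deriv ?_
  rw [← mul_neg, ← Finset.sum_neg_distrib]
  congr 1
  exact Finset.sum_congr rfl fun j _ => by ring

lemma D_deriv1 (h : Pot U U1 U2 A B C) (hβ : 0 < β) [Nonempty ι] (a v : ι → ℝ) (s0 : ℝ) :
    HasDerivAt (fun s => ∫ t, Pw β U a v s t) (∫ t, P1w β U1 a v s0 t * Pw β U a v s0 t) s0 := by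
  obtain ⟨K, α, hα, hK⟩ := Pw_bound h hβ a v s0
  obtain ⟨M, hM0, hM⟩ := P1w_bound h hβ a v s0
  have cU := h.cU
  have cU1 := h.cU1
  refine (hasDerivAt_integral_of_dominated_loc_of_deriv_le (Metric.ball_mem_nhds s0 one_pos)
    (bound := fun t => (2 * M * K) * ((1 + t^2) * exp (-α * t^2)))
    (F' := fun s t => P1w β U1 a v s t * Pw β U a v s t) ?_ ?_ ?_ ?_ ?_ ?_).2
  · refine Eventually.of_forall fun s => Continuous.aestronglyMeasurable ?_
    unfold Pw; fun_prop
  · simpa using (Pw_GW h hβ a v s0).int (f := fun _ => 1) (M := 1) continuous_const (fun t => by simp; positivity)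
  · refine Continuous.aestronglyMeasurable ?_
    unfold Pw P1w; fun_prop
  · refine ae_of_all _ fun t s hs => ?_
    rw [Metric.mem_ball, dist_eq] at hs
    rw [norm_mul, norm_eq_abs, norm_eq_abs, abs_of_pos (show 0 < Pw β U a v s t from exp_pos _)]
    calc _ ≤ (M * (1 + |t|)) * (K * exp (-α * t^2)) :=
          mul_le_mul (hM s hs t) (hK s hs t) (exp_pos _).le (by positivity)
      _ = (M * K * exp (-α * t^2)) * (1 + |t|) := by ring
      _ ≤ (M * K * exp (-α * t^2)) * (2 * (1 + t^2)) := by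
        have : 0 ≤ K * exp (-α * t^2) := (exp_pos _).le.trans (hK s hs t)
        apply mul_le_mul_of_nonneg_left
        · nlinarith [sq_abs t, sq_nonneg (|t| - 1), abs_nonneg t]
        · rw [mul_assoc]; positivity
      _ = _ := by ring
  · exact (gauss_int2 hα).const_mul _
  · exact ae_of_all _ fun t s hs => hd_Pw h a v s t

lemma D_deriv2 (h : Pot U U1 U2 A B C) (hβ : 0 < β) [Nonempty ι] (a v : ι → ℝ) (s0 : ℝ) :
    HasDerivAt (fun s => ∫ t, P1w β U1 a v s t * Pw β U a v s t)
      (∫ t, (P1w β U1 a v s0 t ^ 2 - P2w β U2 a v s0 t) * Pw β U a v s0 t) s0 := by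
  obtain ⟨K, α, hα, hK⟩ := Pw_bound h hβ a v s0
  obtain ⟨M, hM0, hM⟩ := P1w_bound h hβ a v s0
  obtain ⟨M', hM0', hM'⟩ := P2w_bound h hβ a v
  have cU := h.cU
  have cU1 := h.cU1
  have cU2 := h.c2
  refine (hasDerivAt_integral_of_dominated_loc_of_deriv_le (Metric.ball_mem_nhds s0 one_pos)
    (bound := fun t => ((2 * M^2 + M') * K) * ((1 + t^2) * exp (-α * t^2)))
    (F' := fun s t => (P1w β U1 a v s t ^ 2 - P2w β U2 a v s t) * Pw β U a v s t) ?_ ?_ ?_ ?_ ?_ ?_).2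
  · refine Eventually.of_forall fun s => Continuous.aestronglyMeasurable ?_
    unfold Pw P1w; fun_prop
  · refine (Pw_GW h hβ a v s0).int (M := 2 * M) (by unfold P1w; fun_prop) (fun t => (hM s0 (by simp) t).trans ?_)
    have : 1 + |t| ≤ 2 * (1 + t^2) := by nlinarith [sq_abs t, sq_nonneg (|t| - 1), abs_nonneg t]
    nlinarith [mul_le_mul_of_nonneg_left this hM0]
  · refine Continuous.aestronglyMeasurable ?_
    unfold Pw P1w P2w; fun_prop
  · refine ae_of_all _ fun t s hs => ?_
    rw [Metric.mem_ball, dist_eq] at hs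
    rw [norm_mul, norm_eq_abs, norm_eq_abs, abs_of_pos (show 0 < Pw β U a v s t from exp_pos _)]
    have h0 : |P1w β U1 a v s t ^ 2 - P2w β U2 a v s t| ≤ (2 * M^2 + M') * (1 + t^2) := by
      have h1 := abs_sub (P1w β U1 a v s t ^ 2) (P2w β U2 a v s t)
      have h2 := hM' s t
      have h3 : |P1w β U1 a v s t ^ 2| ≤ (M * (1 + |t|))^2 := by
        rw [abs_pow]; exact pow_le_pow_left₀ (abs_nonneg _) (hM s hs t) 2
      have h4 : (1 + |t|)^2 ≤ 2 * (1 + t^2) := by nlinarith [sq_abs t, sq_nonneg (|t| - 1), abs_nonneg t]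
      have h5 := mul_le_mul_of_nonneg_left h4 (sq_nonneg M)
      have h6 := mul_nonneg hM0' (sq_nonneg t)
      nlinarith
    calc _ ≤ ((2 * M^2 + M') * (1 + t^2)) * (K * exp (-α * t^2)) :=
          mul_le_mul h0 (hK s hs t) (exp_pos _).le (by positivity)
      _ = _ := by ring
  · exact (gauss_int2 hα).const_mul _
  · refine ae_of_all _ fun t s hs => ?_
    refine ((hd_P1w h a v s t).mul (hd_Pw h a v s t)).congr_deriv ?_
    ring
end

section
variable {ι : Type*} [Fintype ι]
variable {U U1 U2 : ℝ → ℝ} {A B C β : ℝ}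

lemma ibp_Pw (h : Pot U U1 U2 A B C) (hβ : 0 < β) [Nonempty ι] (a v : ι → ℝ) (s : ℝ)
    {k k' : ℝ → ℝ} (hk : ∀ t, HasDerivAt k (k' t) t) (hk' : Continuous k') {M : ℝ}
    (hM : ∀ t, |k t| ≤ M * (1 + |t|)) (hM' : ∀ t, |k' t| ≤ M) :
    ∫ t, k' t * Pw β U a v s t
     = ∫ t, k t * (β * ∑ j, U1 (t - (a j + s * v j))) * Pw β U a v s t := by
  have G := Pw_GW h hβ a v s
  have M0 : 0 ≤ M := (abs_nonneg _).trans (hM' 0)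
  have cU1 := h.cU1
  have ck : Continuous k := continuous_iff_continuousAt.2 fun x => (hk x).continuousAt
  obtain ⟨L, L0, hL⟩ := U1_bound h a v s
  have i1 : Integrable (fun t => k' t * Pw β U a v s t) :=
    G.int hk' (M := M) (fun t => (hM' t).trans (by nlinarith [sq_nonneg t]))
  have i2 : Integrable (fun t => k t * (β * ∑ j, U1 (t - (a j + s * v j))) * Pw β U a v s t) := by
    refine G.int (by fun_prop) (M := M * (β * (Fintype.card ι * L)) * 2) (fun t => ?_)
    rw [abs_mul, abs_mul, abs_of_pos hβ]
    calc _ ≤ (M * (1 + |t|)) * (β * (Fintype.card ι * (L * (1 + |t|)))) := by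
          gcongr
          · exact hM t
          · refine (Finset.abs_sum_le_sum_abs _ _).trans ?_
            refine (Finset.sum_le_sum fun j _ => hL s (by simp) j t).trans ?_
            simp
      _ = (M * (β * (Fintype.card ι * L))) * (1 + |t|)^2 := by ring
      _ ≤ (M * (β * (Fintype.card ι * L))) * (2 * (1 + t^2)) := by
          gcongr
          nlinarith [sq_abs t, sq_nonneg (|t| - 1)]
      _ = _ := by ring
  have i0 : Integrable (fun t => k t * Pw β U a v s t) := by
    refine G.int ck (M := 2 * M) (fun t => (hM t).trans ?_)
    have : 1 + |t| ≤ 2 * (1 + t^2) := by nlinarith [sq_abs t, sq_nonneg (|t| - 1), abs_nonneg t]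
    nlinarith [mul_le_mul_of_nonneg_left this M0]
  have hd : ∀ t, HasDerivAt (fun t => k t * Pw β U a v s t) (k' t * Pw β U a v s t -
      k t * (β * ∑ j, U1 (t - (a j + s * v j))) * Pw β U a v s t) t := by
    intro t
    have h1 : ∀ j ∈ Finset.univ, HasDerivAt (fun t => U (t - (a j + s * v j))) (U1 (t - (a j + s * v j))) t := by
      intro j _
      have h2 : HasDerivAt (fun t => t - (a j + s * v j)) 1 t := by
        simpa using ((hasDerivAt_id t).sub_const (a j + s * v j))
      exact ((h.d1 _).comp t h2).congr_deriv (by simp)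
    have h3 := ((HasDerivAt.fun_sum h1).const_mul β).neg.exp
    refine ((hk t).mul h3).congr_deriv ?_
    simp only [Pw, Pi.neg_apply]
    ring
  have := integral_eq_zero_of_hasDerivAt_of_integrable hd (i1.sub i2) i0
  rw [integral_sub i1 i2] at this
  linarith

lemma prod_lb {m ρ K r x y : ℝ} (hm : 0 < m) (hρ : 0 ≤ ρ) (hr : 0 ≤ r) (hK : 0 ≤ K)
    (hx : m * (r - ρ) ≤ x) (hx' : x ≤ K * r) (hy : m * (r - ρ) ≤ y) (hy' : y ≤ K * r) :
    m^2/2 * r^2 - m^2 * (ρ^2 + K * ρ^2 / (4 * m)) ≤ x * y := by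
  have e : m^2 * (ρ^2 + K * ρ^2 / (4 * m)) = m^2 * ρ^2 + m * K * ρ^2 / 4 := by
    field_simp
  rw [e]
  have hKρ : 0 ≤ m * K * ρ^2 := by positivity
  rcases le_total ρ r with hr' | hr'
  · have h0 : 0 ≤ m * (r - ρ) := mul_nonneg hm.le (by linarith)
    have h1 : (m * (r - ρ)) * (m * (r - ρ)) ≤ x * y := mul_le_mul hx hy h0 (h0.trans hx)
    have h2 : 0 ≤ m^2 * (r - 2 * ρ)^2 := by positivity
    nlinarith
  · have h1 : - (m * K * ρ^2 / 4) ≤ x * y := by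
      have hp : m * (ρ - r) * (K * r) ≤ m * K * ρ^2 / 4 := by
        have : 0 ≤ m * K * (ρ - 2 * r)^2 := by positivity
        nlinarith
      have hz : 0 ≤ m * (ρ - r) := mul_nonneg hm.le (by linarith)
      have hKr : 0 ≤ K * r := by positivity
      rcases le_total 0 x with x0 | x0 <;> rcases le_total 0 y with y0 | y0
      · nlinarith [mul_nonneg x0 y0]
      · have : x * (-y) ≤ (K * r) * (m * (ρ - r)) :=
          mul_le_mul hx' (by linarith) (by linarith) hKr
        nlinarith
      · have : (-x) * y ≤ (m * (ρ - r)) * (K * r) :=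
          mul_le_mul (by linarith) hy' y0 hz
        nlinarith
      · nlinarith [mul_nonneg_of_nonpos_of_nonpos x0 y0]
    have h2 : m^2 * r^2 ≤ m^2 * ρ^2 := by gcongr
    nlinarith [sq_nonneg (m * ρ)]

lemma cov_pos (h : Pot U U1 U2 A B C) (hβ : 0 < β) [Nonempty ι] {m ρ K : ℝ} (hm : 0 < m)
    (hρ : 0 ≤ ρ) (hK : 0 < K)
    (hlo : ∀ x r, 0 ≤ r → m * (r - ρ) ≤ U1 (x + r) - U1 x)
    (hhi : ∀ x r, 0 ≤ r → U1 (x + r) - U1 x ≤ K * r)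
    (a v : ι → ℝ) (s : ℝ) (j k : ι) :
    m^2/2 * (1 / (β * Fintype.card ι * K) - (ρ^2 + K * ρ^2 / (4 * m))) * (∫ t, Pw β U a v s t)^2 ≤
     (∫ t, Pw β U a v s t) * (∫ t, U1 (t - (a j + s * v j)) * U1 (t - (a k + s * v k)) * Pw β U a v s t)
      - (∫ t, U1 (t - (a j + s * v j)) * Pw β U a v s t)
        * (∫ t, U1 (t - (a k + s * v k)) * Pw β U a v s t) := by
  have G := Pw_GW h hβ a v s
  have cU1 := h.cU1
  obtain ⟨L, L0, hL⟩ := U1_bound h a v s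
  set n : ℝ := (Fintype.card ι : ℝ) with hn
  have n0 : 0 < n := by simp [hn, Fintype.card_pos]
  have c1 := cov_lb G (f := fun t => U1 (t - (a j + s * v j))) (h := fun t => U1 (t - (a k + s * v k)))
    (by fun_prop) (by fun_prop) (fun t => hL s (by simp) j t) (fun t => hL s (by simp) k t)
    (α := m^2/2) (κ := m^2 * (ρ^2 + K * ρ^2 / (4 * m))) (by
      have key : ∀ s' t, s' ≤ t → m^2/2 * (t - s')^2 - m^2 * (ρ^2 + K * ρ^2 / (4 * m)) ≤
        (U1 (t - (a j + s * v j)) - U1 (s' - (a j + s * v j))) *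
        (U1 (t - (a k + s * v k)) - U1 (s' - (a k + s * v k))) := by
        intro s' t hst
        have r0 : 0 ≤ t - s' := by linarith
        have e : ∀ c, s' - c + (t - s') = t - c := fun c => by ring
        apply prod_lb hm hρ r0 hK.le
        · simpa [e] using hlo (s' - (a j + s * v j)) _ r0
        · simpa [e] using hhi (s' - (a j + s * v j)) _ r0
        · simpa [e] using hlo (s' - (a k + s * v k)) _ r0
        · simpa [e] using hhi (s' - (a k + s * v k)) _ r0
      intro s' t
      rcases le_total s' t with hst | hst
      · exact key s' t hst
      · have := key t s' hst
        nlinarith)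
  have c2 := cov_lb G (f := fun t => t) (h := fun t => - (β * ∑ j, U1 (t - (a j + s * v j))))
    (M := 1 + β * (n * L)) (by fun_prop) (by fun_prop) (fun t => by
      have : 0 ≤ β * (n * L) * (1 + |t|) := by positivity
      nlinarith [abs_nonneg t]) (fun t => by
      rw [abs_neg, abs_mul, abs_of_pos hβ]
      have : |∑ j, U1 (t - (a j + s * v j))| ≤ n * (L * (1 + |t|)) := by
        refine (Finset.abs_sum_le_sum_abs _ _).trans ?_
        refine (Finset.sum_le_sum fun j _ => hL s (by simp) j t).trans ?_
        simp [hn]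
      have := mul_le_mul_of_nonneg_left this hβ.le
      nlinarith [abs_nonneg t])
    (α := - (β * n * K)) (κ := 0) (by
      have key : ∀ s' t, s' ≤ t → -(β * n * K) * (t - s')^2 - 0 ≤
        (t - s') * (- (β * ∑ j, U1 (t - (a j + s * v j))) - - (β * ∑ j, U1 (s' - (a j + s * v j)))) := by
        intro s' t hst
        have r0 : 0 ≤ t - s' := by linarith
        have e : ∀ c, s' - c + (t - s') = t - c := fun c => by ring
        have h1 : ∑ j, U1 (t - (a j + s * v j)) - ∑ j, U1 (s' - (a j + s * v j)) ≤ n * (K * (t - s')) := by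
          rw [← Finset.sum_sub_distrib]
          refine (Finset.sum_le_sum fun j _ => (by simpa [e] using hhi (s' - (a j + s * v j)) _ r0 :
            U1 (t - (a j + s * v j)) - U1 (s' - (a j + s * v j)) ≤ K * (t - s'))).trans ?_
          simp [hn]
        have := mul_le_mul_of_nonneg_left h1 (mul_nonneg hβ.le r0)
        nlinarith
      intro s' t
      rcases le_total s' t with hst | hst
      · exact key s' t hst
      · have := key t s' hst
        nlinarith)
  have f1 := ibp_Pw h hβ a v s (k := fun _ => 1) (k' := fun _ => 0) (fun t => hasDerivAt_const _ _)
    continuous_const (M := 1) (fun t => by simp) (fun t => by simp)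
  have f2 := ibp_Pw h hβ a v s (k := fun t => t) (k' := fun _ => 1) (fun t => hasDerivAt_id _)
    continuous_const (M := 1) (fun t => by simp) (fun t => by simp)
  simp only [one_mul, zero_mul, integral_zero] at f1 f2
  simp only [mul_neg, neg_mul, integral_neg] at c2
  rw [← f1, ← f2] at c2
  set D := ∫ t, Pw β U a v s t
  set Q := D * (∫ t, t^2 * Pw β U a v s t) - (∫ t, t * Pw β U a v s t)^2
  have hQ : 1 / (β * n * K) * D^2 ≤ Q := by
    rw [one_div, inv_mul_le_iff₀ (by positivity)]
    nlinarith
  nlinarith [mul_le_mul_of_nonneg_left hQ (by positivity : 0 ≤ m^2/2)]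
end

section
variable {ι : Type*} [Fintype ι]
variable {U U1 U2 : ℝ → ℝ} {A B C β : ℝ}

lemma D_second (h : Pot U U1 U2 A B C) (hβ : 0 < β) [Nonempty ι] (a v : ι → ℝ) (s : ℝ) {c0 : ℝ}
    (hc : ∀ j k, c0 * (∫ t, Pw β U a v s t)^2 ≤
     (∫ t, Pw β U a v s t) * (∫ t, U1 (t - (a j + s * v j)) * U1 (t - (a k + s * v k)) * Pw β U a v s t)
      - (∫ t, U1 (t - (a j + s * v j)) * Pw β U a v s t)
        * (∫ t, U1 (t - (a k + s * v k)) * Pw β U a v s t)) :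
    β^2/2 * c0 * (∑ j, ∑ k, (v j - v k)^2) * (∫ t, Pw β U a v s t)^2 ≤
    (∫ t, P1w β U1 a v s t * Pw β U a v s t)^2 - (∫ t, Pw β U a v s t) *
     (∫ t, (P1w β U1 a v s t ^ 2 - P2w β U2 a v s t) * Pw β U a v s t) := by
  have G := Pw_GW h hβ a v s
  have cU1 := h.cU1
  have cU2 := h.c2
  obtain ⟨L, L0, hL'⟩ := U1_bound h a v s
  have hL := hL' s (by simp)
  set p := Pw β U a v s with hp
  set f : ι → ℝ → ℝ := fun j t => U1 (t - (a j + s * v j)) with hf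
  set D := ∫ t, p t with hD
  set I : ι → ℝ := fun j => ∫ t, f j t * p t with hI
  set J : ι → ι → ℝ := fun j k => ∫ t, f j t * f k t * p t with hJ
  have cf : ∀ j, Continuous (f j) := fun j => by simp only [hf]; fun_prop
  have ii : ∀ j, Integrable (fun t => f j t * p t) := fun j =>
    G.int (cf j) (M := 2 * L) (fun t => (hL j t).trans (by
      have : 1 + |t| ≤ 2 * (1 + t^2) := by nlinarith [sq_abs t, sq_nonneg (|t| - 1), abs_nonneg t]
      nlinarith [mul_le_mul_of_nonneg_left this L0]))
  have ij : ∀ j k, Integrable (fun t => f j t * f k t * p t) := fun j k =>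
    G.int ((cf j).mul (cf k)) (M := 2 * L^2) (fun t => by
      rw [abs_mul]
      calc _ ≤ (L * (1 + |t|)) * (L * (1 + |t|)) :=
            mul_le_mul (hL j t) (hL k t) (abs_nonneg _) (by positivity)
        _ = L^2 * (1 + |t|)^2 := by ring
        _ ≤ L^2 * (2 * (1 + t^2)) := by
            gcongr; nlinarith [sq_abs t, sq_nonneg (|t| - 1)]
        _ = _ := by ring)
  have i2 : ∀ j, Integrable (fun t => U2 (t - (a j + s * v j)) * p t) := fun j =>
    G.int (by fun_prop) (M := C) (fun t => (h.b2 _).trans (by nlinarith [h.C0, mul_nonneg h.C0 (sq_nonneg t)]))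
  have e1 : ∫ t, P1w β U1 a v s t * p t = β * ∑ j, v j * I j := by
    have : ∀ t, P1w β U1 a v s t * p t = ∑ j, (β * v j) * (f j t * p t) := fun t => by
      simp only [P1w, hf, Finset.mul_sum, Finset.sum_mul]
      exact Finset.sum_congr rfl fun j _ => by ring
    simp_rw [this]
    rw [integral_finsetSum _ fun j _ => (ii j).const_mul _]
    simp only [integral_const_mul, Finset.mul_sum, hI, mul_assoc]
  have e2 : ∀ j, ∫ t, U2 (t - (a j + s * v j)) * p t = β * ∑ k, J j k := by
    intro j
    have := ibp_Pw h hβ a v s (k := f j) (k' := fun t => U2 (t - (a j + s * v j))) (fun t => by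
        have h2 : HasDerivAt (fun t => t - (a j + s * v j)) 1 t := by
          simpa using ((hasDerivAt_id t).sub_const (a j + s * v j))
        exact ((h.d2 _).comp t h2).congr_deriv (by simp)) (by fun_prop) (M := L + C)
        (fun t => (hL j t).trans (by nlinarith [h.C0, mul_nonneg h.C0 (abs_nonneg t)]))
        (fun t => (h.b2 _).trans (by linarith))
    rw [this]
    have : ∀ t, f j t * (β * ∑ j, U1 (t - (a j + s * v j))) * Pw β U a v s t
       = ∑ k, β * (f j t * f k t * p t) := fun t => by
      simp only [hf, Finset.mul_sum, Finset.sum_mul]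
      exact Finset.sum_congr rfl fun j _ => by ring
    simp_rw [this]
    rw [integral_finsetSum _ fun k _ => (ij j k).const_mul _]
    simp only [integral_const_mul, Finset.mul_sum, hJ]
  have e0 : ∑ k, I k = 0 := by
    have := ibp_Pw h hβ a v s (k := fun _ => 1) (k' := fun _ => 0) (fun t => hasDerivAt_const _ _)
      continuous_const (M := 1) (fun t => by simp) (fun t => by simp)
    simp only [zero_mul, integral_zero, one_mul] at this
    have e : ∀ t, (β * ∑ j, U1 (t - (a j + s * v j))) * Pw β U a v s t
       = ∑ k, β * (f k t * p t) := fun t => by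
      simp only [hf, Finset.mul_sum, Finset.sum_mul]
      exact Finset.sum_congr rfl fun j _ => by ring
    simp_rw [e] at this
    rw [integral_finsetSum _ fun k _ => (ii k).const_mul _] at this
    simp only [integral_const_mul] at this
    rw [← Finset.mul_sum] at this
    rcases mul_eq_zero.1 this.symm with h0 | h0
    · exact absurd h0 hβ.ne'
    · exact h0
  have e3 : ∫ t, (P1w β U1 a v s t ^ 2 - P2w β U2 a v s t) * p t
      = β^2 * ∑ j, ∑ k, v j * v k * J j k - β^2 * ∑ j, ∑ k, v j^2 * J j k := by
    have : ∀ t, (P1w β U1 a v s t ^ 2 - P2w β U2 a v s t) * p t =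
       ∑ j, ∑ k, (β^2 * (v j * v k)) * (f j t * f k t * p t)
        - ∑ j, (β * v j^2) * (U2 (t - (a j + s * v j)) * p t) := fun t => by
      simp only [P1w, P2w]
      rw [sub_mul, mul_pow, sq (∑ j, v j * _), Finset.sum_mul_sum]
      simp only [hf, Finset.mul_sum, Finset.sum_mul]
      congr 1
      · exact Finset.sum_congr rfl fun j _ => Finset.sum_congr rfl fun k _ => by ring
      · exact Finset.sum_congr rfl fun j _ => by ring
    simp_rw [this]
    rw [integral_sub (integrable_finsetSum _ fun j _ => integrable_finsetSum _ fun k _ => (ij j k).const_mul _)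
      (integrable_finsetSum _ fun j _ => (i2 j).const_mul _),
      integral_finsetSum _ fun j _ => integrable_finsetSum _ fun k _ => (ij j k).const_mul _,
      integral_finsetSum _ fun j _ => (i2 j).const_mul _]
    simp_rw [integral_finsetSum _ fun k _ => (ij _ k).const_mul _, integral_const_mul, e2]
    simp only [Finset.mul_sum]
    congr 1
    · exact Finset.sum_congr rfl fun j _ => Finset.sum_congr rfl fun k _ => by simp only [hJ]; ring
    · exact Finset.sum_congr rfl fun j _ => Finset.sum_congr rfl fun k _ => by ring
  have sJ : ∀ j k, J j k = J k j := fun j k => by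
    simp only [hJ]; congr with t; ring
  have f1 : ∀ X : ι → ι → ℝ, (∀ j k, X j k = X k j) → ∑ j, ∑ k, (v j - v k)^2 * X j k
      = 2 * ∑ j, ∑ k, v j^2 * X j k - 2 * ∑ j, ∑ k, v j * v k * X j k := by
    intro X hX
    have : ∑ j, ∑ k, v k^2 * X j k = ∑ j, ∑ k, v j^2 * X j k := by
      rw [Finset.sum_comm]
      exact Finset.sum_congr rfl fun j _ => Finset.sum_congr rfl fun k _ => by rw [hX]
    have e : ∑ j, ∑ k, (v j - v k)^2 * X j k = ∑ j, ∑ k, v j^2 * X j k + ∑ j, ∑ k, v k^2 * X j k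
       - 2 * ∑ j, ∑ k, v j * v k * X j k := by
      simp only [Finset.mul_sum, ← Finset.sum_add_distrib, ← Finset.sum_sub_distrib]
      exact Finset.sum_congr rfl fun j _ => Finset.sum_congr rfl fun k _ => by ring
    rw [e, this]; ring
  have f2 : ∑ j, ∑ k, v j^2 * (I j * I k) = 0 := by
    simp only [← mul_assoc, ← Finset.mul_sum, e0, mul_zero, Finset.sum_const_zero]
  have f3 : (∑ j, v j * I j)^2 = ∑ j, ∑ k, v j * v k * (I j * I k) := by
    rw [sq, Finset.sum_mul_sum]
    exact Finset.sum_congr rfl fun j _ => Finset.sum_congr rfl fun k _ => by ring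
  have g1 := f1 J sJ
  have g2 := f1 (fun j k => I j * I k) (fun j k => mul_comm _ _)
  rw [f2] at g2
  rw [e1, e3, mul_pow, f3]
  have key : c0 * (∑ j, ∑ k, (v j - v k)^2) * D^2 ≤ ∑ j, ∑ k, (v j - v k)^2 * (D * J j k - I j * I k) := by
    rw [mul_right_comm, Finset.mul_sum]
    refine Finset.sum_le_sum fun j _ => ?_
    rw [Finset.mul_sum]
    refine Finset.sum_le_sum fun k _ => ?_
    rw [mul_comm]
    exact mul_le_mul_of_nonneg_left (hc j k) (sq_nonneg _)
  have e4 : ∑ j, ∑ k, (v j - v k)^2 * (D * J j k - I j * I k) =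
     D * ∑ j, ∑ k, (v j - v k)^2 * J j k - ∑ j, ∑ k, (v j - v k)^2 * (I j * I k) := by
    simp only [Finset.mul_sum, ← Finset.sum_sub_distrib]
    exact Finset.sum_congr rfl fun j _ => Finset.sum_congr rfl fun k _ => by ring
  rw [e4, g1, g2] at key
  nlinarith [mul_le_mul_of_nonneg_left key (by positivity : 0 ≤ β^2/2)]

/-- one-site partition function -/
def Zs (β : ℝ) (U : ℝ → ℝ) (a : ι → ℝ) : ℝ := ∫ t, exp (-(β * ∑ j, U (t - a j)))

lemma Zs_eq (a b : ι → ℝ) (s : ℝ) : ∫ t, Pw β U a (b - a) s t = Zs β U ((1 - s) • a + s • b) := by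
  simp only [Pw, Zs]
  congr with t
  congr 4
  ext j
  congr 1
  simp; ring

lemma Zs_conv (h : Pot U U1 U2 A B C) (hβ : 0 < β) [Nonempty ι] {m ρ K : ℝ} (hm : 0 < m)
    (hρ : 0 ≤ ρ) (hK : 0 < K)
    (hlo : ∀ x r, 0 ≤ r → m * (r - ρ) ≤ U1 (x + r) - U1 x)
    (hhi : ∀ x r, 0 ≤ r → U1 (x + r) - U1 x ≤ K * r)
    (hs : β * Fintype.card ι * K * (ρ^2 + K * ρ^2 / (4 * m)) < 1) :
    ∃ c : ℝ, 0 < c ∧ ∀ (a b : ι → ℝ) (s : ℝ), 0 ≤ s → s ≤ 1 →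
      (1 - s) * log (Zs β U a) + s * log (Zs β U b) + c * (s * (1 - s)) *
        ∑ j, ∑ k, ((b - a) j - (b - a) k)^2 ≤ log (Zs β U ((1 - s) • a + s • b)) := by
  set n : ℝ := (Fintype.card ι : ℝ) with hn
  have n0 : 0 < n := by simp [hn, Fintype.card_pos]
  set c0 := m^2/2 * (1 / (β * n * K) - (ρ^2 + K * ρ^2 / (4 * m))) with hc0
  have c0p : 0 < c0 := by
    have : ρ^2 + K * ρ^2 / (4 * m) < 1 / (β * n * K) := by
      rw [lt_div_iff₀ (by positivity)]; linarith
    have : 0 < 1 / (β * n * K) - (ρ^2 + K * ρ^2 / (4 * m)) := by linarith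
    positivity
  refine ⟨β^2/4 * c0, by positivity, fun a b s hs0 hs1 => ?_⟩
  set v := b - a
  set S := ∑ j, ∑ k, (v j - v k)^2
  set D : ℝ → ℝ := fun s => ∫ t, Pw β U a v s t with hD
  have Dp : ∀ s, 0 < D s := fun s => (Pw_GW h hβ a v s).pos
  set D1 : ℝ → ℝ := fun s => ∫ t, P1w β U1 a v s t * Pw β U a v s t with hD1
  set D2 : ℝ → ℝ := fun s => ∫ t, (P1w β U1 a v s t ^ 2 - P2w β U2 a v s t) * Pw β U a v s t with hD2
  set κ := β^2/4 * c0 * S with hκ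
  have h1 : ∀ s, HasDerivAt (fun s => - log (D s) - κ * s^2) (-(D1 s / D s) - κ * (2 * s)) s := by
    intro s
    have := (D_deriv1 h hβ a v s).log (Dp s).ne'
    refine (this.neg.sub ((hasDerivAt_pow 2 s).const_mul κ)).congr_deriv ?_
    simp [hD1, hD]
  have h2 : ∀ s, HasDerivAt (fun s => -(D1 s / D s) - κ * (2 * s))
      (-((D2 s * D s - D1 s * D1 s) / D s ^ 2) - κ * 2) s := by
    intro s
    have := ((D_deriv2 h hβ a v s).div (D_deriv1 h hβ a v s) (Dp s).ne').neg
    refine (this.sub (((hasDerivAt_id s).const_mul 2).const_mul κ)).congr_deriv ?_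
    simp [hD1, hD, hD2]
  have h3 : ∀ s, 0 ≤ -((D2 s * D s - D1 s * D1 s) / D s ^ 2) - κ * 2 := by
    intro s
    have := D_second h hβ a v s (c0 := c0) (fun j k => cov_pos h hβ hm hρ hK hlo hhi a v s j k)
    have h4 : κ * 2 ≤ (D1 s * D1 s - D2 s * D s) / D s ^ 2 := by
      rw [le_div_iff₀ (by have := Dp s; positivity)]
      simp only [hκ]
      linarith
    have h5 : -((D2 s * D s - D1 s * D1 s) / D s ^ 2) = (D1 s * D1 s - D2 s * D s) / D s ^ 2 := by ring
    linarith
  have d1 : deriv (fun s => - log (D s) - κ * s^2) = fun s => (-(D1 s / D s) - κ * (2 * s)) :=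
    funext fun s => (h1 s).deriv
  have conv : ConvexOn ℝ Set.univ (fun s => - log (D s) - κ * s^2) := by
    apply convexOn_univ_of_deriv2_nonneg
    · exact fun s => (h1 s).differentiableAt
    · rw [d1]; exact fun s => (h2 s).differentiableAt
    · intro s
      simp only [Function.iterate_succ, Function.iterate_zero, Function.comp, id]
      rw [d1, (h2 s).deriv]; exact h3 s
  have := conv.2 (Set.mem_univ 0) (Set.mem_univ 1) (by linarith : 0 ≤ 1 - s) hs0 (by ring)
  simp only [smul_eq_mul, mul_zero, mul_one, zero_add, hD] at this
  rw [Zs_eq, Zs_eq, Zs_eq] at this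
  simp only [sub_zero, one_smul, zero_smul, add_zero, sub_self, zero_add] at this
  nlinarith

lemma Zs_pos (h : Pot U U1 U2 A B C) (hβ : 0 < β) [Nonempty ι] (a : ι → ℝ) : 0 < Zs β U a := by
  have := (Pw_GW h hβ a 0 0).pos
  simpa [Pw, Zs] using this
end

lemma pot_of {A B C₀ C₁ C₂ : ℝ} {U V g : ℝ → ℝ}
    (hA : 0 < A) (hA0 : ∀ η : ℝ, A * η ^ 2 - B ≤ U η)
    (hsum : ∀ s, U s = V s + g s)
    (hV : ContDiff ℝ 2 V) (hg : ContDiff ℝ 2 g)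
    (hC₁ : 0 < C₁) (hC₁₂ : C₁ < C₂) (hC₂₀ : C₂ < C₀)
    (hV'' : ∀ s, C₁ ≤ deriv (deriv V) s ∧ deriv (deriv V) s ≤ C₂)
    (hg'' : ∀ s, -C₀ ≤ deriv (deriv g) s ∧ deriv (deriv g) s ≤ 0) :
    ∃ C, Pot U (fun x => deriv V x + deriv g x) (fun x => deriv (deriv V) x + deriv (deriv g) x) A B C := by
  have dV : Differentiable ℝ V := hV.differentiable (by norm_num)
  have dg : Differentiable ℝ g := hg.differentiable (by norm_num)
  have hV1 : ContDiff ℝ 1 (deriv V) := (contDiff_succ_iff_deriv (n := 1)).1 hV |>.2.2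
  have hg1 : ContDiff ℝ 1 (deriv g) := (contDiff_succ_iff_deriv (n := 1)).1 hg |>.2.2
  have dV1 : Differentiable ℝ (deriv V) := hV1.differentiable (by norm_num)
  have dg1 : Differentiable ℝ (deriv g) := hg1.differentiable (by norm_num)
  have cV2 : Continuous (deriv (deriv V)) := hV1.continuous_deriv (by norm_num)
  have cg2 : Continuous (deriv (deriv g)) := hg1.continuous_deriv (by norm_num)
  have eU : U = fun s => V s + g s := funext hsum
  set U1 : ℝ → ℝ := fun x => deriv V x + deriv g x with hU1
  have d2 : ∀ x, HasDerivAt U1 (deriv (deriv V) x + deriv (deriv g) x) x := fun x =>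
    (dV1 x).hasDerivAt.add (dg1 x).hasDerivAt
  have b2 : ∀ x, |deriv (deriv V) x + deriv (deriv g) x| ≤ C₀ + C₂ := fun x => by
    have := hV'' x; have := hg'' x
    rw [abs_le]; constructor <;> linarith
  refine ⟨C₀ + C₂ + |U1 0|, hA, hA0, fun x => ?_, d2, cV2.add cg2, fun x => ?_, fun x => ?_⟩
  · rw [eU]
    exact (dV x).hasDerivAt.add (dg x).hasDerivAt
  · have := Convex.norm_image_sub_le_of_norm_hasDerivWithin_le (s := Set.univ) (f := U1) (x := 0) (y := x)
      (fun x _ => (d2 x).hasDerivWithinAt) (fun x _ => b2 x) convex_univ (Set.mem_univ _) (Set.mem_univ _)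
    simp only [norm_eq_abs, sub_zero] at this
    have h2 := abs_add_le (U1 x - U1 0) (U1 0)
    simp only [sub_add_cancel] at h2
    nlinarith [abs_nonneg x, mul_nonneg (abs_nonneg (U1 0)) (abs_nonneg x)]
  · exact (b2 x).trans (by linarith [abs_nonneg (U1 0)])

lemma incr_hi {C₀ C₁ C₂ : ℝ} {V g : ℝ → ℝ}
    (hV : ContDiff ℝ 2 V) (hg : ContDiff ℝ 2 g)
    (hV'' : ∀ s, C₁ ≤ deriv (deriv V) s ∧ deriv (deriv V) s ≤ C₂)
    (hg'' : ∀ s, -C₀ ≤ deriv (deriv g) s ∧ deriv (deriv g) s ≤ 0) (x r : ℝ) (hr : 0 ≤ r) :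
    (deriv V (x + r) + deriv g (x + r)) - (deriv V x + deriv g x) ≤ C₂ * r := by
  have hV1 : ContDiff ℝ 1 (deriv V) := (contDiff_succ_iff_deriv (n := 1)).1 hV |>.2.2
  have hg1 : ContDiff ℝ 1 (deriv g) := (contDiff_succ_iff_deriv (n := 1)).1 hg |>.2.2
  have dV1 : Differentiable ℝ (deriv V) := hV1.differentiable (by norm_num)
  have dg1 : Differentiable ℝ (deriv g) := hg1.differentiable (by norm_num)
  have h1 := image_sub_le_mul_sub_of_deriv_le dV1 (fun x => (hV'' x).2) (by linarith : x ≤ x + r)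
  have h2 := image_sub_le_mul_sub_of_deriv_le dg1 (fun x => (hg'' x).2) (by linarith : x ≤ x + r)
  simp only [add_sub_cancel_left, zero_mul] at h1 h2
  linarith

lemma incr_lo {C₀ C₁ C₂ q : ℝ} {V g : ℝ → ℝ}
    (hV : ContDiff ℝ 2 V) (hg : ContDiff ℝ 2 g) (hC₁ : 0 < C₁)
    (hV'' : ∀ s, C₁ ≤ deriv (deriv V) s ∧ deriv (deriv V) s ≤ C₂)
    (hg'' : ∀ s, -C₀ ≤ deriv (deriv g) s ∧ deriv (deriv g) s ≤ 0)
    (hq : 1 ≤ q)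
    (hgq : Integrable (fun t : ℝ => |deriv (deriv g) t| ^ q)) (x r : ℝ) (hr : 0 ≤ r) :
    C₁ / q * (r - (∫ t, |deriv (deriv g) t| ^ q) / C₁ ^ q) ≤
    (deriv V (x + r) + deriv g (x + r)) - (deriv V x + deriv g x) := by
  have hV1 : ContDiff ℝ 1 (deriv V) := (contDiff_succ_iff_deriv (n := 1)).1 hV |>.2.2
  have hg1 : ContDiff ℝ 1 (deriv g) := (contDiff_succ_iff_deriv (n := 1)).1 hg |>.2.2
  have dV1 : Differentiable ℝ (deriv V) := hV1.differentiable (by norm_num)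
  have dg1 : Differentiable ℝ (deriv g) := hg1.differentiable (by norm_num)
  have cg2 : Continuous (deriv (deriv g)) := hg1.continuous_deriv (by norm_num)
  have q0 : 0 < q := by linarith
  have h1 := mul_sub_le_image_sub_of_le_deriv dV1 (fun x => (hV'' x).1) (by linarith : x ≤ x + r)
  simp only [add_sub_cancel_left] at h1
  have h2 : ∫ t in x..(x + r), deriv (deriv g) t = deriv g (x + r) - deriv g x :=
    intervalIntegral.integral_eq_sub_of_hasDerivAt (fun t _ => (dg1 t).hasDerivAt)
      (cg2.intervalIntegrable _ _)
  have cq : Continuous (fun t : ℝ => |deriv (deriv g) t| ^ q) :=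
    cg2.abs.rpow_const (fun _ => Or.inr q0.le)
  have hpt : ∀ t, - (C₁ / q / C₁ ^ q * |deriv (deriv g) t| ^ q + C₁ * (1 - 1/q)) ≤ deriv (deriv g) t := by
    intro t
    set y := |deriv (deriv g) t| with hy
    have y0 : 0 ≤ y := abs_nonneg _
    have := one_add_mul_self_le_rpow_one_add (s := y / C₁ - 1) (by
      have : 0 ≤ y / C₁ := by positivity
      linarith) hq
    rw [add_sub_cancel, div_rpow y0 hC₁.le] at this
    have h3 : y ≤ C₁ / q / C₁ ^ q * y ^ q + C₁ * (1 - 1/q) := by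
      have h4 := mul_le_mul_of_nonneg_left this (by positivity : 0 ≤ C₁ / q)
      have e1 : C₁ / q * (1 + q * (y / C₁ - 1)) = y - C₁ * (1 - 1 / q) := by field_simp; ring
      have e2 : C₁ / q * (y ^ q / C₁ ^ q) = C₁ / q / C₁ ^ q * y ^ q := by ring
      rw [e1, e2] at h4
      linarith
    have h5 := neg_abs_le (deriv (deriv g) t)
    linarith
  have h3 : ∫ t in x..(x + r), -(C₁ / q / C₁ ^ q * |deriv (deriv g) t| ^ q + C₁ * (1 - 1/q)) ≤
      ∫ t in x..(x + r), deriv (deriv g) t :=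
    intervalIntegral.integral_mono_on (by linarith)
      (Continuous.intervalIntegrable (by fun_prop) _ _) (cg2.intervalIntegrable _ _) (fun t _ => hpt t)
  rw [h2, intervalIntegral.integral_neg, intervalIntegral.integral_add
    (Continuous.intervalIntegrable (by fun_prop) _ _) (by simp),
    intervalIntegral.integral_const_mul, intervalIntegral.integral_const] at h3
  have h4 : ∫ t in x..(x + r), |deriv (deriv g) t| ^ q ≤ ∫ t, |deriv (deriv g) t| ^ q := by
    rw [intervalIntegral.integral_of_le (by linarith)]
    exact setIntegral_le_integral hgq (ae_of_all _ fun t => by positivity)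
  have h5 := mul_le_mul_of_nonneg_left h4 (by positivity : 0 ≤ C₁ / q / C₁ ^ q)
  simp only [add_sub_cancel_left, smul_eq_mul] at h3
  have e : C₁ / q * (r - (∫ t, |deriv (deriv g) t| ^ q) / C₁ ^ q) =
    C₁ * r - (C₁ / q / C₁ ^ q * (∫ t, |deriv (deriv g) t| ^ q)) - r * (C₁ * (1 - 1/q)) := by
    field_simp; ring
  rw [e]
  linarith

lemma small_of_A2 {β C₁ C₂ q n Γ : ℝ} (hβ : 0 < β) (hC₁ : 0 < C₁) (hC₁₂ : C₁ < C₂) (hq : 1 ≤ q) (hn : 0 < n)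
    (hΓ : 0 ≤ Γ)
    (hA2 : β ^ (1/(2*q)) * Γ ^ (1/q)
      < C₁ ^ ((3:ℝ)/2) / (2 * C₂ ^ ((q+1)/(2*q)) * n ^ (1/(2*q)))) :
    β * n * C₂ * ((Γ / C₁ ^ q)^2 + C₂ * (Γ / C₁ ^ q)^2 / (4 * (C₁ / q))) < 1 := by
  have q0 : 0 < q := by linarith
  have C₂0 : 0 < C₂ := by linarith
  have h1 := rpow_lt_rpow (by positivity) hA2 (by positivity : 0 < 2 * q)
  rw [mul_rpow (by positivity) (by positivity), div_rpow (by positivity) (by positivity),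
    mul_rpow (by positivity) (by positivity), mul_rpow (by positivity) (by positivity),
    ← rpow_mul hβ.le, ← rpow_mul hΓ, ← rpow_mul hC₁.le, ← rpow_mul C₂0.le, ← rpow_mul hn.le] at h1
  have e1 : 1 / (2 * q) * (2 * q) = 1 := by field_simp
  have e2 : 1 / q * (2 * q) = 2 := by field_simp
  have e3 : (3:ℝ)/2 * (2 * q) = q + q + q := by ring
  have e4 : (q + 1) / (2 * q) * (2 * q) = q + 1 := by field_simp
  rw [e1, e2, e3, e4, rpow_one, rpow_one, rpow_add hC₁, rpow_add hC₁, rpow_add C₂0, rpow_one, rpow_two,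
    rpow_mul (by norm_num), show (2:ℝ) ^ (2:ℝ) = 4 by norm_num, lt_div_iff₀ (by positivity)] at h1
  set X := C₁ ^ q with hX
  set Y := C₂ ^ q with hY
  set F := (4:ℝ) ^ q with hF
  have X0 : 0 < X := by positivity
  have Y0 : 0 < Y := by positivity
  have F0 : 0 < F := by positivity
  have hFq : 1 + q * 3 ≤ F := by
    have := one_add_mul_self_le_rpow_one_add (s := 3) (by norm_num) hq
    norm_num at this; exact this
  -- X / Y ≤ C₁ / C₂
  have hXY : X * C₂ ≤ Y * C₁ := by
    have : (C₁ / C₂) ^ q ≤ (C₁ / C₂) ^ (1:ℝ) :=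
      rpow_le_rpow_of_exponent_ge (by positivity) (by rw [div_le_one C₂0]; exact hC₁₂.le) hq
    rw [div_rpow hC₁.le C₂0.le, rpow_one, div_le_div_iff₀ Y0 C₂0] at this
    linarith
  have hXY1 : X ≤ Y := rpow_le_rpow hC₁.le hC₁₂.le q0.le
  set W := β * n * C₂ * Γ^2 / X^2 with hW
  have h2 : W * (F * Y) < X := by
    rw [hW, div_mul_eq_mul_div, div_lt_iff₀ (by positivity)]
    nlinarith
  have e : β * n * C₂ * ((Γ / X)^2 + C₂ * (Γ / X)^2 / (4 * (C₁ / q))) = W * (1 + C₂ * q / (4 * C₁)) := by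
    rw [hW]; field_simp
  rw [e]
  have W0 : 0 ≤ W := by positivity
  by_contra hcon
  push Not at hcon
  have h3 : F * Y ≤ W * (F * Y) * (1 + C₂ * q / (4 * C₁)) := by
    have := mul_le_mul_of_nonneg_left hcon (by positivity : 0 ≤ F * Y)
    linarith
  have h4 : W * (F * Y) * (1 + C₂ * q / (4 * C₁)) < X * (1 + C₂ * q / (4 * C₁)) :=
    mul_lt_mul_of_pos_right h2 (by positivity)
  have h5 : X * (C₂ * q / (4 * C₁)) ≤ Y * q / 4 := by
    rw [mul_div_assoc', div_le_div_iff₀ (by positivity) (by norm_num)]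
    nlinarith
  have h6 : (1 + q * 3) * Y ≤ F * Y := by gcongr
  nlinarith

section
open scoped ENNReal
set_option linter.all false

/-- indicator weight -/
def wt (x : ℝ) : ℝ≥0∞ := Set.indicator (Set.Ico (0:ℝ) 1) 1 x

lemma wt_meas : Measurable wt := measurable_one.indicator measurableSet_Ico

lemma wt_int : ∫⁻ x, wt x = 1 := by
  unfold wt
  rw [lintegral_indicator_one measurableSet_Ico]; simp

lemma wt_of_mem {x : ℝ} (h : x ∈ Set.Ico (0:ℝ) 1) : wt x = 1 := by simp [wt, h]
lemma wt_of_not {x : ℝ} (h : x ∉ Set.Ico (0:ℝ) 1) : wt x = 0 := by simp [wt, h]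

lemma wt_conv {s t : ℝ} (hs : 0 < s) (ht : 0 < t) (hst : s + t = 1) (x y : ℝ) :
    wt x ^ s * wt y ^ t ≤ wt (s * x + t * y) := by
  by_cases hx : x ∈ Set.Ico (0:ℝ) 1
  · by_cases hy : y ∈ Set.Ico (0:ℝ) 1
    · have : s * x + t * y ∈ Set.Ico (0:ℝ) 1 := (convex_Ico (0:ℝ) 1) hx hy hs.le ht.le hst
      rw [wt_of_mem hx, wt_of_mem hy, wt_of_mem this]; simp
    · rw [wt_of_not hy]; simp [ht]
  · rw [wt_of_not hx]; simp [hs]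

section
variable {d N : ℕ} [NeZero N]

/-- shorthand for unit vector -/
def ev (d N : ℕ) (i : Fin d) : Fin d → ZMod N := Pi.single i 1

def par (h2 : 2 ∣ N) (x : Fin d → ZMod N) : ZMod 2 := ∑ i, ZMod.castHom h2 (ZMod 2) (x i)

lemma par_add (h2 : 2 ∣ N) (x y : Fin d → ZMod N) : par h2 (x + y) = par h2 x + par h2 y := by
  simp only [par, Pi.add_apply, map_add, Finset.sum_add_distrib]

lemma par_zero (h2 : 2 ∣ N) : par h2 (0 : Fin d → ZMod N) = 0 := by
  simp [par]

lemma par_ev (h2 : 2 ∣ N) (i : Fin d) : par h2 (ev d N i) = 1 := by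
  unfold par ev
  rw [Finset.sum_eq_single i]
  · rw [Pi.single_eq_same, map_one]
  · intro j _ hj; simp [Pi.single_eq_of_ne hj]
  · simp

lemma zmod2_cases (a : ZMod 2) : a = 0 ∨ a = 1 := by
  revert a; decide

lemma par_add_ev (h2 : 2 ∣ N) (x : Fin d → ZMod N) (i : Fin d) :
    par h2 (x + ev d N i) = 0 ↔ ¬ par h2 x = 0 := by
  rw [par_add, par_ev]
  rcases zmod2_cases (par h2 x) with h | h <;> rw [h] <;> decide

lemma par_sub_ev (h2 : 2 ∣ N) (x : Fin d → ZMod N) (i : Fin d) :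
    par h2 (x - ev d N i) = 0 ↔ ¬ par h2 x = 0 := by
  have := par_add_ev h2 (x - ev d N i) i
  rw [sub_add_cancel] at this
  tauto

/-- neighbours with tilt -/
def nb (φ : (Fin d → ZMod N) → ℝ) (u : Fin d → ℝ) (x : Fin d → ZMod N) : Fin d × Bool → ℝ :=
  fun p => if p.2 then φ (x + ev d N p.1) + u p.1 else φ (x - ev d N p.1) - u p.1

lemma torusH_split (h2 : 2 ∣ N) {U : ℝ → ℝ} (hsym : ∀ s, U (-s) = U s) (φ : (Fin d → ZMod N) → ℝ)
    (u : Fin d → ℝ) :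
    torusH d N U φ u = ∑ x : {x : Fin d → ZMod N // ¬ par h2 x = 0}, ∑ p, U (φ x - nb φ u x p) := by
  have e1 : torusH d N U φ u = ∑ i, ∑ x : Fin d → ZMod N, U (φ (x + ev d N i) - φ x + u i) := by
    unfold torusH; rw [Finset.sum_comm]; rfl
  have e2 : ∀ i, ∑ x : Fin d → ZMod N, U (φ (x + ev d N i) - φ x + u i) =
      ∑ x : {x : Fin d → ZMod N // ¬ par h2 x = 0}, (U (φ x - (φ (x + ev d N i) + u i)) +
        U (φ x - (φ (x - ev d N i) - u i))) := by
    intro i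
    rw [Finset.sum_add_distrib, ← Fintype.sum_subtype_add_sum_subtype (fun x => ¬ par h2 x = 0)]
    congr 1
    · refine Finset.sum_congr rfl fun x _ => ?_
      rw [← hsym]; congr 1; ring
    · let e : {x : Fin d → ZMod N // ¬ ¬ par h2 x = 0} ≃ {x : Fin d → ZMod N // ¬ par h2 x = 0} :=
        (Equiv.addRight (ev d N i)).subtypeEquiv (fun x => by
          have := par_add_ev h2 x i
          simp only [Equiv.coe_addRight]
          tauto)
      refine Fintype.sum_equiv e _ _ fun x => ?_
      have : ((e x : {x : Fin d → ZMod N // ¬ par h2 x = 0}) : Fin d → ZMod N) = x + ev d N i := rfl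
      rw [this]
      congr 1
      simp; ring
  rw [e1]; simp_rw [e2]
  rw [Finset.sum_comm]
  refine Finset.sum_congr rfl fun x _ => ?_
  rw [Fintype.sum_prod_type]
  refine Finset.sum_congr rfl fun i _ => ?_
  simp [nb]

def ZsL {ι : Type*} [Fintype ι] (β : ℝ) (U : ℝ → ℝ) (a : ι → ℝ) : ℝ≥0∞ :=
  ∫⁻ t, ENNReal.ofReal (exp (-(β * ∑ j, U (t - a j))))

lemma ZsL_eq {ι : Type*} [Fintype ι] [Nonempty ι] {U U1 U2 : ℝ → ℝ} {A B C β : ℝ}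
    (h : Pot U U1 U2 A B C) (hβ : 0 < β) (a : ι → ℝ) : ZsL β U a = ENNReal.ofReal (Zs β U a) := by
  unfold Zs ZsL
  rw [ofReal_integral_eq_lintegral_ofReal]
  · have := (Pw_GW h hβ a 0 0).int (f := fun _ => 1) (M := 1) continuous_const (fun t => by simp; positivity)
    simpa [Pw] using this
  · exact ae_of_all _ fun t => (exp_pos _).le

lemma ZsL_meas {ι : Type*} [Fintype ι] {U : ℝ → ℝ} (hU : Continuous U) (β : ℝ) :
    Measurable (fun a : ι → ℝ => ZsL β U a) := by
  unfold ZsL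
  apply Measurable.lintegral_prod_right' (f := fun p : (ι → ℝ) × ℝ => ENNReal.ofReal (exp (-(β * ∑ j, U (p.2 - p.1 j)))))
  apply Measurable.ennreal_ofReal
  apply Continuous.measurable
  fun_prop

/-- extension of even configuration by zero -/
def extE (h2 : 2 ∣ N) (ψ : {x : Fin d → ZMod N // par h2 x = 0} → ℝ) : (Fin d → ZMod N) → ℝ :=
  fun x => if h : par h2 x = 0 then ψ ⟨x, h⟩ else 0

lemma extE_meas (h2 : 2 ∣ N) (x : Fin d → ZMod N) : Measurable (fun ψ => extE h2 ψ x) := by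
  unfold extE
  by_cases h : par h2 x = 0
  · simp only [h, dite_true]; exact measurable_pi_apply _
  · simp only [h, dite_false]; exact measurable_const

lemma nb_meas (h2 : 2 ∣ N) (u : Fin d → ℝ) (x : Fin d → ZMod N) :
    Measurable (fun ψ => nb (extE h2 ψ) u x) := by
  refine measurable_pi_iff.2 fun p => ?_
  unfold nb
  split_ifs
  · exact (extE_meas h2 _).add_const _
  · exact (extE_meas h2 _).sub_const _

/-- tilted partition function -/
def Jt (β : ℝ) (U : ℝ → ℝ) (u : Fin d → ℝ) (z : Fin d → ZMod N) (τ : ℝ) : ℝ≥0∞ :=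
  ∫⁻ φ : (Fin d → ZMod N) → ℝ, wt (φ 0) *
    ENNReal.ofReal (exp (τ * (φ z - φ 0))) * ENNReal.ofReal (exp (-β * torusH d N U φ u))

def Jin (h2 : 2 ∣ N) (β : ℝ) (U : ℝ → ℝ) (u : Fin d → ℝ) (z : Fin d → ZMod N) (τ : ℝ)
  (ψ : {x : Fin d → ZMod N // par h2 x = 0} → ℝ) : ℝ≥0∞ := wt (extE h2 ψ 0) *
    ENNReal.ofReal (exp (τ * (extE h2 ψ z - extE h2 ψ 0))) *
      ∏ x : {x : Fin d → ZMod N // ¬ par h2 x = 0}, ZsL β U (nb (extE h2 ψ) u x)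

lemma Jin_meas (h2 : 2 ∣ N) (β : ℝ) {U : ℝ → ℝ} (hU : Continuous U) (u : Fin d → ℝ) (z : Fin d → ZMod N) (τ : ℝ) :
    Measurable (Jin h2 β U u z τ) := by
  unfold Jin
  have m1 := extE_meas h2 (0 : Fin d → ZMod N)
  have m2 := extE_meas h2 z
  refine ((wt_meas.comp m1).mul ?_).mul ?_
  · fun_prop
  · exact Finset.measurable_prod _ fun x _ => (ZsL_meas hU β).comp (nb_meas h2 u x)

lemma torusH_cont {U : ℝ → ℝ} (hU : Continuous U) (u : Fin d → ℝ) :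
    Continuous (fun φ : (Fin d → ZMod N) → ℝ => torusH d N U φ u) := by
  unfold torusH; fun_prop

lemma Jt_eq (h2 : 2 ∣ N) (β : ℝ) {U : ℝ → ℝ} (hU : Continuous U) (hsym : ∀ s, U (-s) = U s)
    (u : Fin d → ℝ) (z : Fin d → ZMod N) (hz : par h2 z = 0) (τ : ℝ) :
    Jt β U u z τ = ∫⁻ ψ, Jin h2 β U u z τ ψ := by
  have e := (volume_preserving_piEquivPiSubtypeProd (fun _ : Fin d → ZMod N => ℝ) (fun x => par h2 x = 0)).symm
  have hm : Measurable fun φ : (Fin d → ZMod N) → ℝ => wt (φ 0) *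
    ENNReal.ofReal (exp (τ * (φ z - φ 0))) * ENNReal.ofReal (exp (-β * torusH d N U φ u)) := by
    refine ((wt_meas.comp (measurable_pi_apply _)).mul ?_).mul ?_
    · fun_prop
    · have := (torusH_cont (N := N) hU u).measurable
      fun_prop
  unfold Jt
  rw [← e.lintegral_comp hm, Measure.volume_eq_prod, lintegral_prod]
  swap
  · exact (hm.comp e.measurable).aemeasurable
  refine lintegral_congr fun ψ => ?_
  set E : ({x : Fin d → ZMod N // ¬ par h2 x = 0} → ℝ) → (Fin d → ZMod N) → ℝ := fun ξ =>
    (MeasurableEquiv.piEquivPiSubtypeProd (fun _ : Fin d → ZMod N => ℝ) (fun x => par h2 x = 0)).symm (ψ, ξ) with hE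
  have E1 : ∀ ξ x, par h2 x = 0 → E ξ x = extE h2 ψ x := fun ξ x hx => by
    show (if h : par h2 x = 0 then ψ ⟨x, h⟩ else ξ ⟨x, h⟩) = _
    simp [extE, hx]
  have E2 : ∀ ξ (x : {x : Fin d → ZMod N // ¬ par h2 x = 0}), E ξ x = ξ x := fun ξ x => by
    show (if h : par h2 x.1 = 0 then ψ ⟨x.1, h⟩ else ξ ⟨x.1, h⟩) = _
    simp [x.2]
  have E3 : ∀ ξ (x : {x : Fin d → ZMod N // ¬ par h2 x = 0}), nb (E ξ) u x = nb (extE h2 ψ) u x := fun ξ x => by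
    ext p
    simp only [nb]
    rw [E1 _ _ ((par_add_ev h2 _ _).2 x.2), E1 _ _ ((par_sub_ev h2 _ _).2 x.2)]
  have key : ∀ ξ, wt (E ξ 0) * ENNReal.ofReal (exp (τ * (E ξ z - E ξ 0))) *
      ENNReal.ofReal (exp (-β * torusH d N U (E ξ) u)) =
      wt (extE h2 ψ 0) * ENNReal.ofReal (exp (τ * (extE h2 ψ z - extE h2 ψ 0))) *
      ∏ x : {x : Fin d → ZMod N // ¬ par h2 x = 0},
        ENNReal.ofReal (exp (-(β * ∑ p, U (ξ x - nb (extE h2 ψ) u x p)))) := by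
    intro ξ
    rw [E1 ξ 0 (par_zero h2), E1 ξ z hz, torusH_split h2 hsym]
    congr 1
    rw [← ENNReal.ofReal_prod_of_nonneg (fun _ _ => (exp_pos _).le), ← exp_sum]
    congr 2
    rw [Finset.mul_sum]
    refine Finset.sum_congr rfl fun x _ => ?_
    rw [E2, E3]; ring
  show ∫⁻ ξ, wt (E ξ 0) * ENNReal.ofReal (exp (τ * (E ξ z - E ξ 0))) *
      ENNReal.ofReal (exp (-β * torusH d N U (E ξ) u)) = _
  simp_rw [key]
  rw [lintegral_const_mul, lintegral_pi_prod (f := fun (x : {x : Fin d → ZMod N // ¬ par h2 x = 0}) t => ENNReal.ofReal (exp (-(β * ∑ p, U (t - nb (extE h2 ψ) u x p)))))]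
  · rfl
  · intro x; fun_prop
  · fun_prop
end

end

section
open scoped ENNReal
set_option linter.all false

section
variable {d N : ℕ} [NeZero N]

/-- strong log-concavity of the one-site partition function -/
def SLC (d : ℕ) (β : ℝ) (U : ℝ → ℝ) (c : ℝ) : Prop :=
  ∀ (a b : Fin d × Bool → ℝ) (s : ℝ), 0 ≤ s → s ≤ 1 →
      (1 - s) * log (Zs β U a) + s * log (Zs β U b) + c * (s * (1 - s)) *
        ∑ j, ∑ k, ((b - a) j - (b - a) k)^2 ≤ log (Zs β U ((1 - s) • a + s • b))

def Qf (h2 : 2 ∣ N) (δ : (Fin d → ZMod N) → ℝ) (u : Fin d → ℝ) : ℝ :=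
  ∑ x : {x : Fin d → ZMod N // ¬ par h2 x = 0}, ∑ j, ∑ k, (nb δ u x j - nb δ u x k)^2

lemma Jin_eq [NeZero d] {U U1 U2 : ℝ → ℝ} {A B C β : ℝ} (h : Pot U U1 U2 A B C) (hβ : 0 < β)
    (h2 : 2 ∣ N) (u : Fin d → ℝ) (z : Fin d → ZMod N) (τ : ℝ) (ψ) :
    Jin h2 β U u z τ ψ = wt (extE h2 ψ 0) * ENNReal.ofReal (exp (τ * (extE h2 ψ z - extE h2 ψ 0)
      + ∑ x : {x : Fin d → ZMod N // ¬ par h2 x = 0}, log (Zs β U (nb (extE h2 ψ) u x)))) := by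
  unfold Jin
  rw [exp_add, ENNReal.ofReal_mul (exp_pos _).le, exp_sum,
    ENNReal.ofReal_prod_of_nonneg (fun _ _ => (exp_pos _).le), mul_assoc]
  congr 2
  refine Finset.prod_congr rfl fun x _ => ?_
  rw [ZsL_eq h hβ, exp_log (Zs_pos h hβ _)]

lemma extE_lin (h2 : 2 ∣ N) (s t : ℝ) (x y) : extE (d := d) h2 (s • x + t • y) = s • extE h2 x + t • extE h2 y := by
  ext z
  simp only [extE, Pi.add_apply, Pi.smul_apply, smul_eq_mul]
  split_ifs <;> simp

lemma nb_lin (s t : ℝ) (φ φ' : (Fin d → ZMod N) → ℝ) (u u') (x) :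
    nb (s • φ + t • φ') (s • u + t • u') x = s • nb φ u x + t • nb φ' u' x := by
  ext p
  simp only [nb, Pi.add_apply, Pi.smul_apply, smul_eq_mul]
  split_ifs <;> ring

lemma nb_sub (φ φ' : (Fin d → ZMod N) → ℝ) (u u') (x) :
    nb φ' u' x - nb φ u x = nb (φ' - φ) (u' - u) x := by
  ext p
  simp only [nb, Pi.sub_apply]
  split_ifs <;> ring

lemma PLQ [NeZero d] {U U1 U2 : ℝ → ℝ} {A B C β c : ℝ} (h : Pot U U1 U2 A B C) (hβ : 0 < β)
    (hsym : ∀ s, U (-s) = U s) (hc : SLC d β U c)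
    (h2 : 2 ∣ N) (u0 u1 : Fin d → ℝ) (z : Fin d → ZMod N) (hz : par h2 z = 0) (τ0 τ1 : ℝ)
    {s t : ℝ} (hs : 0 < s) (ht : 0 < t) (hst : s + t = 1) (E : ℝ)
    (hE : ∀ δ, E ≤ c * Qf h2 δ (u1 - u0) - (τ1 - τ0) * (δ z - δ 0)) :
    Jt β U u0 z τ0 ^ s * Jt β U u1 z τ1 ^ t ≤
      ENNReal.ofReal (exp (-(s * t * E))) * Jt β U (s • u0 + t • u1) z (s * τ0 + t * τ1) := by
  have hU := h.cU
  rw [Jt_eq h2 β hU hsym _ z hz, Jt_eq h2 β hU hsym _ z hz, Jt_eq h2 β hU hsym _ z hz,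
    ← lintegral_const_mul _ (Jin_meas h2 β hU _ _ _)]
  apply prekopa_leindler hs ht hst (Jin_meas h2 β hU _ _ _) (Jin_meas h2 β hU _ _ _)
    ((Jin_meas h2 β hU _ _ _).const_mul _)
  intro x y
  rw [Jin_eq h hβ, Jin_eq h hβ, Jin_eq h hβ]
  rw [ENNReal.mul_rpow_of_nonneg _ _ hs.le, ENNReal.mul_rpow_of_nonneg _ _ ht.le,
    ENNReal.ofReal_rpow_of_pos (exp_pos _), ENNReal.ofReal_rpow_of_pos (exp_pos _),
    ← exp_mul, ← exp_mul, mul_mul_mul_comm, ← ENNReal.ofReal_mul (exp_pos _).le, ← exp_add,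
    mul_left_comm, ← ENNReal.ofReal_mul (exp_pos _).le, ← exp_add]
  have w1 := wt_conv hs ht hst (extE h2 x 0) (extE h2 y 0)
  rw [extE_lin]
  refine mul_le_mul' w1 (ENNReal.ofReal_le_ofReal (exp_le_exp.2 ?_))
  set X := extE h2 x
  set Y := extE h2 y
  have hsum : s * ∑ p : {x : Fin d → ZMod N // ¬ par h2 x = 0}, log (Zs β U (nb X u0 p))
     + t * ∑ p : {x : Fin d → ZMod N // ¬ par h2 x = 0}, log (Zs β U (nb Y u1 p)) +
      c * (t * s) * Qf h2 (Y - X) (u1 - u0) ≤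
     ∑ p : {x : Fin d → ZMod N // ¬ par h2 x = 0}, log (Zs β U (nb (s • X + t • Y) (s • u0 + t • u1) p)) := by
    rw [Qf, Finset.mul_sum, Finset.mul_sum, Finset.mul_sum, ← Finset.sum_add_distrib, ← Finset.sum_add_distrib]
    refine Finset.sum_le_sum fun p _ => ?_
    have := hc (nb X u0 p) (nb Y u1 p) t ht.le (by linarith)
    have e : 1 - t = s := by linarith
    rw [e, nb_sub] at this
    rw [nb_lin]
    exact this
  have hE' := mul_le_mul_of_nonneg_left (hE (Y - X)) (mul_pos hs ht).le
  simp only [Pi.sub_apply, Pi.add_apply, Pi.smul_apply, smul_eq_mul] at hE' ⊢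
  have id1 : s * (τ0 * (X z - X 0)) + t * (τ1 * (Y z - Y 0)) =
     (s * τ0 + t * τ1) * (s * X z + t * Y z - (s * X 0 + t * Y 0)) +
      s * t * ((τ1 - τ0) * (Y z - X z - (Y 0 - X 0))) := by
    have : s = 1 - t := by linarith
    subst this; ring
  nlinarith
end

end

section
open scoped ENNReal
set_option linter.all false

section
variable {d N : ℕ} [NeZero N]

lemma Qf_lb (h2 : 2 ∣ N) (δ : (Fin d → ZMod N) → ℝ) (u : Fin d → ℝ) :
    ∑ x : {x : Fin d → ZMod N // ¬ par h2 x = 0}, ∑ i, (δ (x + ev d N i) - δ (x - ev d N i) + 2 * u i)^2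
      ≤ Qf h2 δ u := by
  unfold Qf
  refine Finset.sum_le_sum fun x _ => ?_
  rw [Fintype.sum_prod_type]
  refine Finset.sum_le_sum fun i _ => ?_
  have h1 : ∀ b, 0 ≤ ∑ k, (nb δ u x (i, b) - nb δ u x k)^2 := fun b => Finset.sum_nonneg fun _ _ => sq_nonneg _
  rw [Fintype.sum_bool]
  have h3 : (nb δ u x (i, true) - nb δ u x (i, false))^2 ≤ ∑ k, (nb δ u x (i, true) - nb δ u x k)^2 :=
    Finset.single_le_sum (f := fun k => (nb δ u x (i, true) - nb δ u x k)^2) (fun _ _ => sq_nonneg _) (Finset.mem_univ (i, false))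
  have e : (nb δ u x (i, true) - nb δ u x (i, false)) = δ (x + ev d N i) - δ (x - ev d N i) + 2 * u i := by
    simp [nb]; ring
  rw [e] at h3
  linarith [h1 false]

lemma sum_odd_shift (h2 : 2 ∣ N) (f : (Fin d → ZMod N) → ℝ) (i : Fin d) :
    ∑ x : {x : Fin d → ZMod N // ¬ par h2 x = 0}, f (x + ev d N i) =
    ∑ x : {x : Fin d → ZMod N // par h2 x = 0}, f x := by
  let e : {x : Fin d → ZMod N // ¬ par h2 x = 0} ≃ {x : Fin d → ZMod N // par h2 x = 0} :=
        (Equiv.addRight (ev d N i)).subtypeEquiv (fun x => by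
          have := par_add_ev h2 x i
          simp only [Equiv.coe_addRight]
          tauto)
  exact Fintype.sum_equiv e _ _ fun x => rfl

lemma sum_odd_shift' (h2 : 2 ∣ N) (f : (Fin d → ZMod N) → ℝ) (i : Fin d) :
    ∑ x : {x : Fin d → ZMod N // ¬ par h2 x = 0}, f (x - ev d N i) =
    ∑ x : {x : Fin d → ZMod N // par h2 x = 0}, f x := by
  let e : {x : Fin d → ZMod N // ¬ par h2 x = 0} ≃ {x : Fin d → ZMod N // par h2 x = 0} :=
        (Equiv.subRight (ev d N i)).subtypeEquiv (fun x => by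
          have := par_sub_ev h2 x i
          simp only [Equiv.subRight_apply]
          tauto)
  exact Fintype.sum_equiv e _ _ fun x => rfl

lemma card_odd (h2 : 2 ∣ N) (i : Fin d) :
    2 * (Fintype.card {x : Fin d → ZMod N // ¬ par h2 x = 0} : ℝ) = (N:ℝ)^d := by
  have h1 := sum_odd_shift h2 (fun _ => (1:ℝ)) i
  have h3 := Fintype.sum_subtype_add_sum_subtype (fun x : Fin d → ZMod N => ¬ par h2 x = 0) (fun _ => (1:ℝ))
  have h4 : ∑ x : {x : Fin d → ZMod N // ¬ ¬ par h2 x = 0}, (1:ℝ) = ∑ x : {x : Fin d → ZMod N // par h2 x = 0}, (1:ℝ) :=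
    Fintype.sum_equiv (Equiv.subtypeEquivRight fun x => by simp) _ _ fun _ => rfl
  rw [h4, ← h1] at h3
  simp only [Finset.sum_const, Finset.card_univ, nsmul_eq_mul, mul_one] at h3
  rw [two_mul, h3]
  simp [ZMod.card]

lemma Qf_lb_a (h2 : 2 ∣ N) (δ : (Fin d → ZMod N) → ℝ) (u : Fin d → ℝ) :
    2 * (N:ℝ)^d * ∑ i, u i ^2 ≤ Qf h2 δ u := by
  refine le_trans ?_ (Qf_lb h2 δ u)
  rw [Finset.sum_comm, Finset.mul_sum]
  refine Finset.sum_le_sum fun i _ => ?_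
  have h1 : ∑ x : {x : Fin d → ZMod N // ¬ par h2 x = 0}, (4 * u i ^2 + 4 * u i * (δ (x + ev d N i) - δ (x - ev d N i)))
    ≤ ∑ x : {x : Fin d → ZMod N // ¬ par h2 x = 0}, (δ (x + ev d N i) - δ (x - ev d N i) + 2 * u i)^2 := by
    refine Finset.sum_le_sum fun x _ => ?_
    nlinarith [sq_nonneg (δ (x + ev d N i) - δ (x - ev d N i))]
  refine le_trans (le_of_eq ?_) h1
  have e : ∑ x : {x : Fin d → ZMod N // ¬ par h2 x = 0}, 4 * u i * (δ (x + ev d N i) - δ (x - ev d N i)) = 0 := by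
    rw [← Finset.mul_sum, Finset.sum_sub_distrib, sum_odd_shift h2 δ, sum_odd_shift' h2 δ, sub_self, mul_zero]
  rw [Finset.sum_add_distrib, e, add_zero, Finset.sum_const, Finset.card_univ, nsmul_eq_mul]
  have := card_odd h2 i
  rw [← this]; ring

lemma par_nsmul_odd (h2 : 2 ∣ N) (i : Fin d) (m : ℕ) : ¬ par h2 ((2 * m + 1) • ev d N i) = 0 := by
  have : par h2 ((2 * m + 1) • ev d N i) = ((2 * m + 1 : ℕ) : ZMod 2) := by
    have : ∀ k : ℕ, par h2 (k • ev d N i) = (k : ZMod 2) := by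
      intro k
      induction k with
      | zero => simp [par_zero]
      | succ k ih => rw [succ_nsmul, par_add, ih, par_ev]; push_cast; rfl
    exact this _
  rw [this]
  push_cast
  have : (2 : ZMod 2) = 0 := rfl
  rw [this]; simp

lemma par_nsmul_even (h2 : 2 ∣ N) (i : Fin d) (m : ℕ) : par h2 ((2 * m) • ev d N i) = 0 := by
  have := par_nsmul_odd h2 i m
  rw [succ_nsmul] at this
  have h3 := par_add_ev h2 ((2 * m) • ev d N i) i
  tauto

lemma Qf_lb_b (h2 : 2 ∣ N) (δ : (Fin d → ZMod N) → ℝ) (i : Fin d) (k : ℕ) (hk : 2 * k ≤ N) :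
    (δ ((2 * k) • ev d N i) - δ 0)^2 ≤ N * Qf h2 δ 0 := by
  set D : ℕ → ℝ := fun m => δ ((2 * (m+1)) • ev d N i) - δ ((2 * m) • ev d N i) with hD
  have e : δ ((2 * k) • ev d N i) - δ 0 = ∑ m ∈ Finset.range k, D m := by
    rw [Finset.sum_range_sub (fun m => δ ((2 * m) • ev d N i))]; simp
  have h1 : (∑ m ∈ Finset.range k, D m)^2 ≤ k * ∑ m ∈ Finset.range k, D m ^2 := by
    have := sq_sum_le_card_mul_sum_sq (s := Finset.range k) (f := D)
    simpa using this
  have h3 : ∑ m ∈ Finset.range k, D m ^2 ≤ Qf h2 δ 0 := by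
    refine le_trans ?_ (Qf_lb h2 δ 0)
    set F : {x : Fin d → ZMod N // ¬ par h2 x = 0} → ℝ := fun x =>
      ∑ i, (δ (x + ev d N i) - δ (x - ev d N i) + 2 * (0 : Fin d → ℝ) i)^2 with hF
    set g : ℕ → {x : Fin d → ZMod N // ¬ par h2 x = 0} := fun m => ⟨(2 * m + 1) • ev d N i, par_nsmul_odd h2 i m⟩
    have ginj : Set.InjOn g (Finset.range k) := by
      intro a ha b hb hab
      have h4 : (2 * a + 1) • ev d N i = (2 * b + 1) • ev d N i := congrArg Subtype.val hab
      have h5 := congrFun h4 i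
      simp only [ev, Pi.smul_apply, Pi.single_eq_same, nsmul_eq_mul, mul_one] at h5
      simp only [Finset.coe_range, Set.mem_Iio] at ha hb
      rw [ZMod.natCast_eq_natCast_iff', Nat.mod_eq_of_lt (by omega), Nat.mod_eq_of_lt (by omega)] at h5
      omega
    calc ∑ m ∈ Finset.range k, D m ^2 ≤ ∑ m ∈ Finset.range k, F (g m) := by
          refine Finset.sum_le_sum fun m _ => ?_
          simp only [hF]
          refine le_trans (le_of_eq ?_) (Finset.single_le_sum (f := fun i => (δ (g m + ev d N i) - δ (g m - ev d N i) + 2 * (0 : Fin d → ℝ) i)^2) (fun _ _ => sq_nonneg _) (Finset.mem_univ i))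
          simp only [hD, g]
          congr 1
          rw [show 2 * (m + 1) = (2 * m + 1) + 1 by ring, succ_nsmul _ (2 * m + 1), succ_nsmul _ (2 * m)]
          simp
      _ = ∑ x ∈ (Finset.range k).image g, F x := (Finset.sum_image ginj).symm
      _ ≤ ∑ x, F x := Finset.sum_le_univ_sum_of_nonneg fun x => Finset.sum_nonneg fun _ _ => sq_nonneg _
  have h0 : 0 ≤ ∑ m ∈ Finset.range k, D m ^2 := Finset.sum_nonneg fun _ _ => sq_nonneg _
  rw [e]
  refine h1.trans ?_
  have : (k:ℝ) ≤ N := by exact_mod_cast (by omega : k ≤ N)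
  gcongr

/-- unpinned partition function -/
def Zl (d N : ℕ) [NeZero N] (β : ℝ) (U : ℝ → ℝ) (u : Fin d → ℝ) : ℝ≥0∞ :=
  ∫⁻ φ : (Fin d → ZMod N) → ℝ, wt (φ 0) * ENNReal.ofReal (exp (-β * torusH d N U φ u))

lemma Jt_zero (β : ℝ) (U : ℝ → ℝ) (u : Fin d → ℝ) (z : Fin d → ZMod N) : Jt β U u z 0 = Zl d N β U u := by
  simp [Jt, Zl]

lemma Zl_conv [NeZero d] {U U1 U2 : ℝ → ℝ} {A B C β c : ℝ} (h : Pot U U1 U2 A B C) (hβ : 0 < β)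
    (hsym : ∀ s, U (-s) = U s) (hc0 : 0 < c) (hc : SLC d β U c)
    (h2 : 2 ∣ N) (u0 u1 : Fin d → ℝ) {s t : ℝ} (hs : 0 < s) (ht : 0 < t) (hst : s + t = 1) :
    Zl d N β U u0 ^ s * Zl d N β U u1 ^ t ≤
      ENNReal.ofReal (exp (-(s * t * (c * (2 * (N:ℝ)^d * ∑ i, (u1 i - u0 i)^2)))))
        * Zl d N β U (s • u0 + t • u1) := by
  have := PLQ h hβ hsym hc h2 u0 u1 0 (par_zero h2) 0 0 hs ht hst (c * (2 * (N:ℝ)^d * ∑ i, (u1 i - u0 i)^2))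
    (fun δ => by
      have := Qf_lb_a h2 δ (u1 - u0)
      simp only [Pi.sub_apply] at this
      simp only [sub_self, zero_mul, sub_zero]
      gcongr)
  simpa [Jt_zero] using this

lemma Jt_var [NeZero d] {U U1 U2 : ℝ → ℝ} {A B C β c : ℝ} (h : Pot U U1 U2 A B C) (hβ : 0 < β)
    (hsym : ∀ s, U (-s) = U s) (hc0 : 0 < c) (hc : SLC d β U c)
    (h2 : 2 ∣ N) (u : Fin d → ℝ) (i : Fin d) (k : ℕ) (hk : 2 * k ≤ N) (τ : ℝ) :
    Jt β U u ((2 * k) • ev d N i) τ ^ (1/2 : ℝ) * Jt β U u ((2 * k) • ev d N i) (-τ) ^ (1/2:ℝ) ≤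
      ENNReal.ofReal (exp (τ^2 * N / (4 * c))) * Zl d N β U u := by
  have := PLQ h hβ hsym hc h2 u u ((2 * k) • ev d N i) (par_nsmul_even h2 i k) τ (-τ)
     (s := 1/2) (t := 1/2) (by norm_num) (by norm_num) (by norm_num) (-(τ^2 * N / c))
    (fun δ => by
      have h3 := Qf_lb_b h2 δ i k hk
      rw [sub_self]
      set ℓ := δ ((2 * k) • ev d N i) - δ 0
      set Q := Qf h2 δ 0
      have N0 : 0 < (N:ℝ) := by exact_mod_cast Nat.pos_of_ne_zero (NeZero.ne N)
      have h4 : ℓ^2 / N ≤ Q := by rw [div_le_iff₀ N0]; linarith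
      have h5 := mul_le_mul_of_nonneg_left h4 hc0.le
      have h6 : 0 ≤ (c / N) * (ℓ + τ * N / c)^2 := by positivity
      have h7 : (c / N) * (ℓ + τ * N / c)^2 = c * (ℓ^2 / N) + 2 * τ * ℓ + τ^2 * N / c := by
        field_simp
        try ring
      linarith)
  have e1 : (1/2 : ℝ) • u + (1/2:ℝ) • u = u := by rw [← add_smul]; norm_num
  have e2 : (1/2 : ℝ) * τ + (1/2:ℝ) * (-τ) = 0 := by ring
  rw [e1, e2, Jt_zero] at this
  convert this using 4
  ring
end

end

section
open scoped ENNReal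
set_option linter.all false

section
variable {d N : ℕ} [NeZero N]

def Gf (β : ℝ) (U : ℝ → ℝ) (u : Fin d → ℝ) (φ : (Fin d → ZMod N) → ℝ) : ℝ≥0∞ :=
  ENNReal.ofReal (exp (-β * torusH d N U φ u))

lemma Gf_meas (β : ℝ) {U : ℝ → ℝ} (hU : Continuous U) (u : Fin d → ℝ) :
    Measurable (Gf (N := N) β U u) := by
  unfold Gf
  have := (torusH_cont (N := N) hU u).measurable
  fun_prop

lemma Gf_shift (β : ℝ) (U : ℝ → ℝ) (u : Fin d → ℝ) (φ : (Fin d → ZMod N) → ℝ) (c : ℝ) :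
    Gf β U u (fun x => φ x + c) = Gf β U u φ := by
  unfold Gf torusH
  simp

lemma torusH_trans (U : ℝ → ℝ) (u : Fin d → ℝ) (φ : (Fin d → ZMod N) → ℝ) (z : Fin d → ZMod N) :
    torusH d N U (fun x => φ (x + z)) u = torusH d N U φ u := by
  unfold torusH
  refine Fintype.sum_equiv (Equiv.addRight z) _ _ fun x => ?_
  simp only [Equiv.coe_addRight]
  refine Finset.sum_congr rfl fun i _ => ?_
  rw [add_right_comm]

lemma Gf_trans (β : ℝ) (U : ℝ → ℝ) (u : Fin d → ℝ) (φ : (Fin d → ZMod N) → ℝ) (z : Fin d → ZMod N) :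
    Gf β U u (fun x => φ (x + z)) = Gf β U u φ := by
  unfold Gf
  rw [torusH_trans]

/-- unnormalised expectation -/
def Ex (β : ℝ) (U : ℝ → ℝ) (u : Fin d → ℝ) (F : ((Fin d → ZMod N) → ℝ) → ℝ≥0∞) : ℝ≥0∞ :=
  ∫⁻ φ : (Fin d → ZMod N) → ℝ, wt (φ 0) * (F φ * Gf β U u φ)

lemma Ex_one (β : ℝ) (U : ℝ → ℝ) (u : Fin d → ℝ) : Ex (N := N) β U u (fun _ => 1) = Zl d N β U u := by
  simp [Ex, Zl, Gf]

lemma wt_pt_meas {T : Type*} [Fintype T] (x : T) : Measurable (fun φ : T → ℝ => wt (φ x)) :=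
  wt_meas.comp (measurable_pi_apply x)

lemma shiftW {T : Type*} [Fintype T] {F : (T → ℝ) → ℝ≥0∞} (hF : Measurable F)
    (hinv : ∀ φ (c : ℝ), F (fun x => φ x + c) = F φ) (x y : T) :
    ∫⁻ φ, wt (φ x) * F φ = ∫⁻ φ, wt (φ y) * F φ := by
  have hw : ∀ a : ℝ, ∫⁻ c, wt (a + c) = 1 := fun a => by
    rw [lintegral_add_left_eq_self (μ := volume) wt a]; exact wt_int
  have hw' : ∀ a : ℝ, ∫⁻ c, wt (a - c) = 1 := fun a => by
    rw [lintegral_sub_left_eq_self (μ := volume) wt a]; exact wt_int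
  have m1 : Measurable (fun p : (T → ℝ) × ℝ => wt (p.1 x) * F p.1 * wt (p.1 y + p.2)) := by
    have := wt_meas; fun_prop
  have m2 : Measurable (fun p : ℝ × (T → ℝ) => wt (p.2 x - p.1) * F p.2 * wt (p.2 y)) := by
    have := wt_meas; fun_prop
  calc ∫⁻ φ, wt (φ x) * F φ = ∫⁻ φ, ∫⁻ c, wt (φ x) * F φ * wt (φ y + c) := by
        refine lintegral_congr fun φ => ?_
        rw [lintegral_const_mul _ (by have := wt_meas; fun_prop), hw, mul_one]
    _ = ∫⁻ c, ∫⁻ φ, wt (φ x) * F φ * wt (φ y + c) := by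
        rw [lintegral_lintegral_swap]; exact m1.aemeasurable
    _ = ∫⁻ c, ∫⁻ φ, wt (φ x - c) * F φ * wt (φ y) := by
        refine lintegral_congr fun c => ?_
        rw [← lintegral_add_right_eq_self (μ := volume) (fun φ : T → ℝ => wt (φ x - c) * F φ * wt (φ y)) (fun _ => c)]
        refine lintegral_congr fun φ => ?_
        have : F (φ + fun _ => c) = F φ := hinv φ c
        rw [this]; simp
    _ = ∫⁻ φ, ∫⁻ c, wt (φ x - c) * F φ * wt (φ y) := by
        rw [lintegral_lintegral_swap]; exact m2.aemeasurable
    _ = ∫⁻ φ, wt (φ y) * F φ := by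
        refine lintegral_congr fun φ => ?_
        simp_rw [mul_assoc]
        rw [lintegral_mul_const _ (by have := wt_meas; fun_prop), hw', one_mul, mul_comm]

lemma Ex_trans (β : ℝ) {U : ℝ → ℝ} (hU : Continuous U) (u : Fin d → ℝ)
    {F : ((Fin d → ZMod N) → ℝ) → ℝ≥0∞} (hF : Measurable F)
    (hinv : ∀ φ (c : ℝ), F (fun x => φ x + c) = F φ) (z : Fin d → ZMod N) :
    Ex β U u (fun φ => F (fun x => φ (x + z))) = Ex β U u F := by
  unfold Ex
  have hm := hF.mul (Gf_meas (N := N) β hU u)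
  have h0 := shiftW (x := 0) (y := -z) hm (fun φ c => by simp only [Pi.mul_apply]; rw [hinv, Gf_shift])
  simp only [Pi.mul_apply] at h0
  have e' := (volume_measurePreserving_piCongrLeft (fun _ : Fin d → ZMod N => ℝ) (Equiv.addRight z)).symm
  have hm2 : Measurable fun φ : (Fin d → ZMod N) → ℝ => wt (φ (-z)) * (F φ * Gf β U u φ) := (wt_pt_meas _).mul hm
  rw [h0, ← e'.lintegral_comp hm2]
  refine lintegral_congr fun φ => ?_
  have : (MeasurableEquiv.piCongrLeft (fun _ : Fin d → ZMod N => ℝ) (Equiv.addRight z)).symm φ = fun x => φ (x + z) := by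
    ext x
    rfl
  rw [this]
  simp only [Pi.mul_apply]
  rw [Gf_trans]
  simp

lemma pinned {F : ((Fin d → ZMod N) → ℝ) → ℝ≥0∞} (hF : Measurable F)
    (hinv : ∀ φ (c : ℝ), F (fun x => φ x + c) = F φ) :
    ∫⁻ φ, wt (φ 0) * F φ = ∫⁻ ψ, F (torusExt d N ψ) := by
  have e := (volume_preserving_piEquivPiSubtypeProd (fun _ : Fin d → ZMod N => ℝ) (fun x => x ≠ 0)).symm
  have hm : Measurable fun φ : (Fin d → ZMod N) → ℝ => wt (φ 0) * F φ := (wt_pt_meas (0 : Fin d → ZMod N)).mul hF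
  rw [← e.lintegral_comp hm, Measure.volume_eq_prod, lintegral_prod_symm]
  swap
  · exact (hm.comp e.measurable).aemeasurable
  have hu : ∀ x : {x : Fin d → ZMod N // ¬ x ≠ 0}, x = ⟨0, by simp⟩ := fun x => Subtype.ext (not_not.1 x.2)
  haveI : Unique {x : Fin d → ZMod N // ¬ x ≠ 0} := ⟨⟨⟨0, by simp⟩⟩, hu⟩
  have key : ∀ ξ : {x : Fin d → ZMod N // ¬ x ≠ 0} → ℝ, ∀ ψ : {x : Fin d → ZMod N // x ≠ 0} → ℝ,
     (MeasurableEquiv.piEquivPiSubtypeProd (fun _ : Fin d → ZMod N => ℝ) (fun x => x ≠ 0)).symm (ψ, ξ)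
     = fun x => torusExt d N (fun y => ψ y - ξ ⟨0, by simp⟩) x + ξ ⟨0, by simp⟩ := by
    intro ξ ψ
    ext x
    show (if h : x ≠ 0 then ψ ⟨x, h⟩ else ξ ⟨x, h⟩) = _
    by_cases hx : x = 0
    · subst hx; simp [torusExt]
    · simp [torusExt, hx]
  have key2 : ∀ ξ : {x : Fin d → ZMod N // ¬ x ≠ 0} → ℝ, ∫⁻ ψ : {x : Fin d → ZMod N // x ≠ 0} → ℝ,
     wt ((MeasurableEquiv.piEquivPiSubtypeProd (fun _ : Fin d → ZMod N => ℝ) (fun x => x ≠ 0)).symm (ψ, ξ) 0) *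
      F ((MeasurableEquiv.piEquivPiSubtypeProd (fun _ : Fin d → ZMod N => ℝ) (fun x => x ≠ 0)).symm (ψ, ξ)) =
      wt (ξ ⟨0, by simp⟩) * ∫⁻ ψ, F (torusExt d N ψ) := by
    intro ξ
    simp_rw [key, hinv]
    simp only [torusExt, dite_true, zero_add]
    have mm : Measurable fun ψ : {x : Fin d → ZMod N // x ≠ 0} → ℝ => F (torusExt d N ψ) := by
      refine hF.comp (measurable_pi_iff.2 fun x => ?_)
      unfold torusExt
      split_ifs
      · exact measurable_const
      · exact measurable_pi_apply _
    have := lintegral_sub_right_eq_self (μ := volume) (fun ψ : {x : Fin d → ZMod N // x ≠ 0} → ℝ => F (torusExt d N ψ)) (fun _ => ξ ⟨0, by simp⟩)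
    rw [lintegral_const_mul, ← this]
    · rfl
    · exact mm.comp (measurable_pi_iff.2 fun x => by fun_prop)
  refine (lintegral_congr key2).trans ?_
  rw [lintegral_mul_const _ (wt_pt_meas _)]
  have := lintegral_pi_prod (ι := {x : Fin d → ZMod N // ¬ x ≠ 0}) (f := fun _ => wt) (fun _ => wt_meas)
  have h3 : ∫⁻ ξ : {x : Fin d → ZMod N // ¬ x ≠ 0} → ℝ, wt (ξ ⟨0, by simp⟩) = 1 := by
    simp only [wt_int, Finset.prod_const_one] at this
    rw [← this]
    refine lintegral_congr fun ξ => ?_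
    rw [Fintype.prod_subsingleton _ ⟨0, by simp⟩]
  rw [h3, one_mul]

lemma torusZ_eq (β : ℝ) {U : ℝ → ℝ} (hU : Continuous U) (u : Fin d → ℝ) :
    torusZ β d N U u = (Zl d N β U u).toReal := by
  have h1 : Zl d N β U u = ∫⁻ ψ, Gf β U u (torusExt d N ψ) :=
    pinned (Gf_meas β hU u) (Gf_shift β U u)
  rw [h1]
  unfold torusZ
  rw [integral_eq_lintegral_of_nonneg_ae]
  · rfl
  · exact ae_of_all _ fun _ => (exp_pos _).le
  · apply Measurable.aestronglyMeasurable
    have h2 := (torusH_cont (N := N) hU u).measurable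
    have h3 : Measurable fun ψ => torusExt d N ψ := by
      refine (measurable_pi_iff.2 fun x => ?_)
      unfold torusExt
      split_ifs
      · exact measurable_const
      · exact measurable_pi_apply _
    have := h2.comp h3
    simp only [Function.comp_def] at this
    fun_prop
end

end

section
open scoped ENNReal
set_option linter.all false

lemma Pot.ub {U U1 U2 : ℝ → ℝ} {A B C : ℝ} (h : Pot U U1 U2 A B C) : ∃ K, 0 < K ∧ ∀ x, U x ≤ K * (1 + x^2) := by
  have hC := h.C0
  refine ⟨|U 0| + 2 * C + 1, by positivity, fun x => ?_⟩
  have h1 := (convex_Icc (-|x|) |x|).norm_image_sub_le_of_norm_hasDerivWithin_le (f := U) (f' := U1) (C := C * (1 + |x|))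
    (fun y _ => (h.d1 y).hasDerivWithinAt) (fun y hy => by
      rw [Real.norm_eq_abs]
      refine (h.b1 y).trans ?_
      have : |y| ≤ |x| := abs_le.2 hy
      gcongr) (x := 0) (y := x) (by simp) (by simp [neg_abs_le, le_abs_self])
  rw [Real.norm_eq_abs, Real.norm_eq_abs, sub_zero] at h1
  have h2 := le_abs_self (U x - U 0)
  have h3 := le_abs_self (U 0)
  have h4 := sq_abs x
  have h5 := abs_nonneg (U 0)
  have h6 : C * (1 + |x|) * |x| ≤ 2 * C * (1 + x^2) := by
    rw [← h4]
    nlinarith [mul_nonneg hC (sq_nonneg (|x| - 1)), mul_nonneg hC (sq_nonneg (|x|))]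
  nlinarith [mul_nonneg h5 (sq_nonneg x), sq_nonneg x]

lemma tree_bound {ι : Type*} [Fintype ι] [DecidableEq ι] (h : ι → ℕ) (F : ι → (ι → ℝ) → ℝ≥0∞)
    (hm : ∀ x, Measurable (F x)) (M : ℝ≥0∞)
    (h1 : ∀ a x, h x ≤ h a → x ≠ a → ∀ φ t, F x (Function.update φ a t) = F x φ)
    (h2 : ∀ a φ, ∫⁻ t, F a (Function.update φ a t) ≤ M) :
    ∫⁻ φ, ∏ x, F x φ ≤ M ^ (Fintype.card ι) := by
  have key : ∀ s : Finset ι, ∀ ξ, (∫⋯∫⁻_s, (fun φ => ∏ x ∈ s, F x φ) ∂(fun _ => volume)) ξ ≤ M ^ s.card := by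
    intro s
    induction s using Finset.induction_on_max_value h with
    | empty => intro ξ; simp
    | insert a s ha hmax ih =>
      intro ξ
      have mm : Measurable fun φ => ∏ x ∈ insert a s, F x φ := Finset.measurable_prod _ fun x _ => hm x
      have mm' : Measurable fun φ => ∏ x ∈ s, F x φ := Finset.measurable_prod _ fun x _ => hm x
      rw [lmarginal_insert' _ mm ha, Finset.card_insert_of_notMem ha, pow_succ']
      have : (fun φ : ι → ℝ => ∫⁻ t, ∏ x ∈ insert a s, F x (Function.update φ a t)) ≤
          fun φ => M * ∏ x ∈ s, F x φ := by
        intro φ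
        have e : ∀ t, ∏ x ∈ insert a s, F x (Function.update φ a t) = F a (Function.update φ a t) * ∏ x ∈ s, F x φ := by
          intro t
          rw [Finset.prod_insert ha]
          congr 1
          refine Finset.prod_congr rfl fun x hx => h1 a x (hmax x hx) (fun hh => ha (hh ▸ hx)) φ t
        simp_rw [e]
        rw [lintegral_mul_const _ (show Measurable fun t => F a (Function.update φ a t) from (hm a).comp (measurable_update φ))]
        gcongr
        exact h2 a φ
      refine (lmarginal_mono this ξ).trans ?_
      have e2 : (∫⋯∫⁻_s, (fun φ => M * ∏ x ∈ s, F x φ) ∂(fun _ : ι => (volume : Measure ℝ))) ξ = M * (∫⋯∫⁻_s, (fun φ => ∏ x ∈ s, F x φ) ∂(fun _ => volume)) ξ := by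
        unfold lmarginal
        rw [lintegral_const_mul]
        exact mm'.comp (by fun_prop)
      rw [e2]
      gcongr
      exact ih ξ
  have := key Finset.univ 0
  rw [lmarginal_univ] at this
  exact this

section
variable {d N : ℕ} [NeZero N]

/-- some coordinate that is non-zero -/
lemma exists_coord {x : Fin d → ZMod N} (hx : x ≠ 0) : ∃ i, x i ≠ 0 := Function.ne_iff.1 hx

def tdir {x : Fin d → ZMod N} (hx : x ≠ 0) : Fin d := (exists_coord hx).choose
lemma tdir_spec {x : Fin d → ZMod N} (hx : x ≠ 0) : x (tdir hx) ≠ 0 := (exists_coord hx).choose_spec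

def thgt (x : Fin d → ZMod N) : ℕ := ∑ i, (x i).val

lemma thgt_lt {x : Fin d → ZMod N} (hx : x ≠ 0) : thgt (x - ev d N (tdir hx)) < thgt x := by
  unfold thgt
  set i := tdir hx
  have hi := tdir_spec hx
  have hv : (x i - 1).val < (x i).val := by
    by_cases hN : N = 1
    · subst hN
      exact absurd (Subsingleton.elim _ _) hi
    have h1 : (1 : ZMod N).val = 1 := by
      have : Fact (1 < N) := ⟨by have := NeZero.ne N; omega⟩
      exact ZMod.val_one N
    have h3 : 0 < (x i).val := Nat.pos_of_ne_zero (by rwa [Ne, ZMod.val_eq_zero])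
    rw [ZMod.val_sub (by rw [h1]; omega), h1]; omega
  apply Finset.sum_lt_sum
  · intro j _
    by_cases hj : j = i
    · subst hj; simp [ev]; exact hv.le
    · simp [ev, Pi.single_eq_of_ne hj]
  · exact ⟨i, Finset.mem_univ _, by simpa [ev] using hv⟩

lemma H_tree {U : ℝ → ℝ} {A B : ℝ} (hA : 0 < A) (hB : 0 ≤ B) (hlb : ∀ x, A * x^2 - B ≤ U x)
   (φ : (Fin d → ZMod N) → ℝ) (u : Fin d → ℝ) :
   ∑ x : {x : Fin d → ZMod N // x ≠ 0}, A * (φ x - φ (x - ev d N (tdir x.2)) + u (tdir x.2))^2 ≤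
     torusH d N U φ u + B * d * (N:ℝ)^d := by
  have e1 : torusH d N U φ u + B * d * (N:ℝ)^d = ∑ p : (Fin d → ZMod N) × Fin d, (U (φ (p.1 + ev d N p.2) - φ p.1 + u p.2) + B) := by
    rw [Finset.sum_add_distrib, Fintype.sum_prod_type]
    congr 1
    simp [ZMod.card]; ring
  rw [e1]
  let g : {x : Fin d → ZMod N // x ≠ 0} → (Fin d → ZMod N) × Fin d := fun x => (x - ev d N (tdir x.2), tdir x.2)
  have ginj : Function.Injective g := by
    intro x y hxy
    have h1 := (Prod.mk.inj hxy).1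
    have h2 := (Prod.mk.inj hxy).2
    rw [h2] at h1
    exact Subtype.ext (sub_left_injective h1)
  calc _ ≤ ∑ x : {x : Fin d → ZMod N // x ≠ 0}, (U (φ ((g x).1 + ev d N (g x).2) - φ (g x).1 + u (g x).2) + B) := by
        refine Finset.sum_le_sum fun x _ => ?_
        simp only [g, sub_add_cancel]
        linarith [hlb (φ x - φ (x - ev d N (tdir x.2)) + u (tdir x.2))]
    _ = ∑ p ∈ Finset.univ.image g, (U (φ (p.1 + ev d N p.2) - φ p.1 + u p.2) + B) :=
        (Finset.sum_image (f := fun p : (Fin d → ZMod N) × Fin d => (U (φ (p.1 + ev d N p.2) - φ p.1 + u p.2) + B)) (ginj.injOn)).symm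
    _ ≤ _ := Finset.sum_le_univ_sum_of_nonneg fun p => by
        nlinarith [hlb (φ (p.1 + ev d N p.2) - φ p.1 + u p.2), mul_nonneg hA.le (sq_nonneg (φ (p.1 + ev d N p.2) - φ p.1 + u p.2))]

lemma Zl_ub {U U1 U2 : ℝ → ℝ} {A B C β : ℝ} (h : Pot U U1 U2 A B C) (hβ : 0 < β) (d : ℕ) :
    ∃ K : ℝ, 0 ≤ K ∧ ∀ (N : ℕ) [NeZero N] (u : Fin d → ℝ), Zl d N β U u ≤ ENNReal.ofReal (exp (K * (N:ℝ)^d)) := by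
  set B' := max B 0
  set I := ∫⁻ t : ℝ, ENNReal.ofReal (exp (-(β * A) * t^2)) with hI
  have hIf : I ≠ ∞ := by
    have := integrable_exp_neg_mul_sq (mul_pos hβ h.A_pos)
    have h2 := this.lintegral_lt_top
    exact h2.ne
  set M := max 1 I.toReal with hM
  have hM1 : 1 ≤ M := le_max_left _ _
  have hIM : I ≤ ENNReal.ofReal M := by
    rw [← ENNReal.ofReal_toReal hIf]
    exact ENNReal.ofReal_le_ofReal (le_max_right _ _)
  refine ⟨β * B' * d + log M, by have := log_nonneg hM1; have : 0 ≤ B' := le_max_right _ _; positivity, ?_⟩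
  intro N _ u
  set F : (Fin d → ZMod N) → ((Fin d → ZMod N) → ℝ) → ℝ≥0∞ := fun x φ =>
    if hx : x = 0 then wt (φ 0) else
      ENNReal.ofReal (exp (-(β * A) * (φ x - φ (x - ev d N (tdir hx)) + u (tdir hx))^2)) with hF
  have hFm : ∀ x, Measurable (F x) := by
    intro x
    by_cases hx : x = 0
    · simp only [hF, hx, dite_true]; exact wt_pt_meas _
    · simp only [hF, hx, dite_false]; fun_prop
  have T := tree_bound thgt F hFm (ENNReal.ofReal M) ?_ ?_
  · have hle : ∀ φ : (Fin d → ZMod N) → ℝ, wt (φ 0) * ENNReal.ofReal (exp (-β * torusH d N U φ u)) ≤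
        ENNReal.ofReal (exp (β * B' * d * (N:ℝ)^d)) * ∏ x, F x φ := by
      intro φ
      have h3 := H_tree h.A_pos (le_max_right B 0) (fun x => by linarith [h.lb x, le_max_left B 0]) φ u (U := U)
      have e : ∏ x, F x φ = wt (φ 0) * ∏ x : {x : Fin d → ZMod N // x ≠ 0},
          ENNReal.ofReal (exp (-(β * A) * (φ x - φ (x - ev d N (tdir x.2)) + u (tdir x.2))^2)) := by
        rw [Fintype.prod_eq_mul_prod_subtype_ne _ (0 : Fin d → ZMod N)]
        congr 1
        · simp [hF]
        · refine Finset.prod_congr rfl fun x _ => ?_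
          simp only [hF]
          rw [dif_neg x.2]
      rw [e, mul_left_comm, ← ENNReal.ofReal_prod_of_nonneg (fun _ _ => (exp_pos _).le), ← exp_sum,
        ← ENNReal.ofReal_mul (exp_pos _).le, ← exp_add]
      gcongr
      have h4 := mul_le_mul_of_nonneg_left h3 hβ.le
      rw [Finset.mul_sum] at h4
      have e3 : ∑ x : {x : Fin d → ZMod N // x ≠ 0}, -(β * A) * (φ x - φ (x - ev d N (tdir x.2)) + u (tdir x.2))^2
        = - ∑ x : {x : Fin d → ZMod N // x ≠ 0}, β * (A * (φ x - φ (x - ev d N (tdir x.2)) + u (tdir x.2))^2) := by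
        rw [← Finset.sum_neg_distrib]
        refine Finset.sum_congr rfl fun x _ => by ring
      rw [e3]
      linarith
    refine (lintegral_mono hle).trans ?_
    rw [lintegral_const_mul _ (Finset.measurable_prod _ fun x _ => hFm x)]
    refine (mul_le_mul_right T _).trans (le_of_eq ?_)
    rw [← ENNReal.ofReal_pow (by linarith), ← ENNReal.ofReal_mul (exp_pos _).le, add_mul, exp_add]
    congr 2
    have : (Fintype.card (Fin d → ZMod N)) = N^d := by simp [ZMod.card]
    rw [this, mul_comm (log M), ← rpow_natCast, rpow_def_of_pos (by linarith)]
    push_cast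
    rw [mul_comm]
  · intro a x hxa hne φ t
    by_cases hx : x = 0
    · subst hx
      simp only [hF, dite_true]
      rw [Function.update_of_ne hne]
    · simp only [hF, hx, dite_false]
      rw [Function.update_of_ne hne, Function.update_of_ne]
      intro hh
      have := thgt_lt hx
      rw [hh] at this
      omega
  · intro a φ
    by_cases ha : a = 0
    · subst ha
      simp only [hF, dite_true, Function.update_self]
      rw [wt_int]; exact ENNReal.one_le_ofReal.2 hM1
    · simp only [hF, ha, dite_false, Function.update_self]
      have hne : a - ev d N (tdir ha) ≠ a := fun hh => by
        have := thgt_lt ha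
        rw [hh] at this; omega
      simp_rw [Function.update_of_ne hne]
      refine le_trans (le_of_eq ?_) hIM
      rw [hI, ← lintegral_add_right_eq_self (μ := volume) (fun t : ℝ => ENNReal.ofReal (exp (-(β * A) * t^2))) (- φ (a - ev d N (tdir ha)) + u (tdir ha))]
      refine lintegral_congr fun t => ?_
      congr 4
      ring

lemma Zl_lb {U U1 U2 : ℝ → ℝ} {A B C β : ℝ} (h : Pot U U1 U2 A B C) (hβ : 0 < β) (u : Fin d → ℝ) :
    ∃ K : ℝ, 0 ≤ K ∧ ∀ (N : ℕ) [NeZero N], ENNReal.ofReal (exp (-(K * (N:ℝ)^d))) ≤ Zl d N β U u := by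
  obtain ⟨K, hK, hub⟩ := h.ub
  set Q := ∑ i, (u i)^2
  have Q0 : 0 ≤ Q := Finset.sum_nonneg fun _ _ => sq_nonneg _
  refine ⟨β * (d * (K * (1 + (2 * 1 + 2 * Q)))), by positivity, ?_⟩
  intro N _
  have hle : ∀ φ : (Fin d → ZMod N) → ℝ, (∏ x, wt (φ x)) * ENNReal.ofReal (exp (-(β * (d * (K * (1 + (2 * 1 + 2 * Q)))) * (N:ℝ)^d))) ≤
     wt (φ 0) * ENNReal.ofReal (exp (-β * torusH d N U φ u)) := by
    intro φ
    by_cases hφ : ∀ x, φ x ∈ Set.Ico (0:ℝ) 1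
    · rw [wt_of_mem (hφ 0), Finset.prod_congr rfl (fun x _ => wt_of_mem (hφ x))]
      simp only [Finset.prod_const_one, one_mul]
      gcongr
      rw [neg_mul]
      apply neg_le_neg
      rw [mul_assoc]
      gcongr
      calc torusH d N U φ u ≤ ∑ x : Fin d → ZMod N, ∑ i : Fin d, (K * (1 + (2 * 1 + 2 * Q))) := by
            unfold torusH
            refine Finset.sum_le_sum fun x _ => Finset.sum_le_sum fun i _ => (hub _).trans ?_
            have h1 := hφ (x + Pi.single i 1)
            have h2 := hφ x
            have h3 : (u i)^2 ≤ Q := Finset.single_le_sum (f := fun i => (u i)^2) (fun _ _ => sq_nonneg _) (Finset.mem_univ i)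
            have h4 : (φ (x + Pi.single i 1) - φ x)^2 ≤ 1 := by
              rw [sq_le_one_iff_abs_le_one, abs_le]; constructor <;> linarith [h1.1, h1.2, h2.1, h2.2]
            gcongr
            nlinarith [sq_nonneg (φ (x + Pi.single i 1) - φ x - u i)]
        _ = _ := by simp [ZMod.card]; ring
    · push Not at hφ
      obtain ⟨x, hx⟩ := hφ
      rw [Finset.prod_eq_zero (Finset.mem_univ x) (wt_of_not hx)]
      simp
  refine le_trans (le_of_eq ?_) (lintegral_mono hle)
  rw [lintegral_mul_const, lintegral_pi_prod (f := fun _ : Fin d → ZMod N => wt) (fun _ => wt_meas)]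
  · simp [wt_int]
  · exact Finset.measurable_prod _ fun x _ => wt_pt_meas x
end

end

section
open scoped ENNReal
set_option linter.all false

section
variable {d N : ℕ} [NeZero N]

lemma Ex_mono (β : ℝ) (U : ℝ → ℝ) (u : Fin d → ℝ) {F F' : ((Fin d → ZMod N) → ℝ) → ℝ≥0∞} (h : ∀ φ, F φ ≤ F' φ) :
    Ex β U u F ≤ Ex β U u F' := by
  unfold Ex
  refine lintegral_mono fun φ => ?_
  dsimp only
  gcongr
  exact h φ

lemma Ex_add (β : ℝ) {U : ℝ → ℝ} (hU : Continuous U) (u : Fin d → ℝ) {F F' : ((Fin d → ZMod N) → ℝ) → ℝ≥0∞} (hF : Measurable F) :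
    Ex β U u (fun φ => F φ + F' φ) = Ex β U u F + Ex β U u F' := by
  unfold Ex
  rw [← lintegral_add_left]
  · refine lintegral_congr fun φ => by ring
  · exact (wt_pt_meas _).mul (hF.mul (Gf_meas β hU u))

lemma Ex_const_mul (β : ℝ) {U : ℝ → ℝ} (hU : Continuous U) (u : Fin d → ℝ) {F : ((Fin d → ZMod N) → ℝ) → ℝ≥0∞} (hF : Measurable F) (c : ℝ≥0∞) :
    Ex β U u (fun φ => c * F φ) = c * Ex β U u F := by
  unfold Ex
  have hm : Measurable fun φ : (Fin d → ZMod N) → ℝ => wt (φ 0) * (F φ * Gf β U u φ) := (wt_pt_meas _).mul (hF.mul (Gf_meas β hU u))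
  rw [← lintegral_const_mul _ hm]
  · refine lintegral_congr fun φ => by ring

lemma Ex_const (β : ℝ) {U : ℝ → ℝ} (hU : Continuous U) (u : Fin d → ℝ) (c : ℝ≥0∞) :
    Ex (N := N) β U u (fun _ => c) = c * Zl d N β U u := by
  have := Ex_const_mul (N := N) β hU u (F := fun _ => 1) measurable_const c
  simpa [Ex_one] using this

lemma Ex_sum (β : ℝ) {U : ℝ → ℝ} (hU : Continuous U) (u : Fin d → ℝ) {J : Type*} (s : Finset J) {F : J → ((Fin d → ZMod N) → ℝ) → ℝ≥0∞} (hF : ∀ j, Measurable (F j)) :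
    Ex β U u (fun φ => ∑ j ∈ s, F j φ) = ∑ j ∈ s, Ex β U u (F j) := by
  induction s using Finset.induction_on with
  | empty => simp [Ex]
  | insert a s ha ih =>
    simp_rw [Finset.sum_insert ha]
    rw [Ex_add β hU u (hF a), ih]

lemma scale_lb {T : Type*} [Fintype T] {s : ℝ} (hs : 0 < s) {f : (T → ℝ) → ℝ≥0∞} (hf : Measurable f) :
    ∫⁻ φ, f (s • φ) = ENNReal.ofReal (s ^ (Fintype.card T))⁻¹ * ∫⁻ φ, f φ := by
  have := Measure.map_addHaar_smul (volume : Measure (T → ℝ)) hs.ne'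
  rw [← lintegral_map (f := f) hf (measurable_const_smul s), this, lintegral_smul_measure,
    Module.finrank_fintype_fun_eq_card, abs_of_pos (by positivity)]
  rfl

/-- gradient energy -/
def gE (φ : (Fin d → ZMod N) → ℝ) : ℝ := ∑ x, ∑ i, (φ (x + ev d N i) - φ x)^2

lemma gE_cont : Continuous (gE (d := d) (N := N)) := by
  unfold gE; fun_prop

lemma energy {U U1 U2 : ℝ → ℝ} {A B C β : ℝ} (h : Pot U U1 U2 A B C) (hβ : 0 < β) (u : Fin d → ℝ) :
    ∃ C' : ℝ, 0 ≤ C' ∧ ∀ (N : ℕ) [NeZero N], Ex (N := N) β U u (fun φ => ENNReal.ofReal (gE φ)) ≤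
      ENNReal.ofReal (C' * (N:ℝ)^d) * Zl d N β U u := by
  obtain ⟨K, hK, hub⟩ := h.ub
  have hA := h.A_pos
  set Q := ∑ i, (u i)^2
  have Q0 : 0 ≤ Q := Finset.sum_nonneg fun _ _ => sq_nonneg _
  obtain ⟨s, hs0, hs1, hsK⟩ : ∃ s : ℝ, 0 < s ∧ s ≤ 1 ∧ 2 * K * s^2 ≤ A / 4 := by
    refine ⟨min 1 (A / (8 * K)), by positivity, min_le_left _ _, ?_⟩
    set s := min 1 (A / (8 * K))
    have h1 : s ≤ A / (8 * K) := min_le_right _ _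
    have h2 : s ≤ 1 := min_le_left _ _
    have h3 : 0 < s := by positivity
    rw [le_div_iff₀ (by positivity)] at h1
    nlinarith
  set B' := |B|
  set D := A * Q + B' + K * (1 + 2 * Q) with hD
  have D0 : 0 ≤ D := by positivity
  set a := β * (A / 4) with ha
  have a0 : 0 < a := by positivity
  have ls : 0 ≤ log s⁻¹ := log_nonneg ((one_le_inv₀ hs0).2 hs1)
  set D2 := β * (d * D) + log s⁻¹ with hD2
  have D20 : 0 ≤ D2 := by positivity
  clear_value D2
  refine ⟨(1 + D2) / a, by positivity, ?_⟩
  intro N _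
  -- pointwise bound
  have hpt : ∀ φ : (Fin d → ZMod N) → ℝ, a * gE φ - β * (d * D) * (N:ℝ)^d ≤ β * torusH d N U φ u - β * torusH d N U (s • φ) u := by
    intro φ
    have h1 : (A / 4) * gE φ - d * D * (N:ℝ)^d ≤ torusH d N U φ u - torusH d N U (s • φ) u := by
      have e : (d * D * (N:ℝ)^d) = ∑ x : Fin d → ZMod N, ∑ i : Fin d, D := by simp [ZMod.card]; ring
      rw [e]
      unfold gE torusH
      rw [Finset.mul_sum, ← Finset.sum_sub_distrib, ← Finset.sum_sub_distrib]
      refine Finset.sum_le_sum fun x _ => ?_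
      rw [Finset.mul_sum, ← Finset.sum_sub_distrib, ← Finset.sum_sub_distrib]
      refine Finset.sum_le_sum fun i _ => ?_
      have e2 : (s • φ) (x + Pi.single i 1) - (s • φ) x + u i = s * (φ (x + ev d N i) - φ x) + u i := by
        simp [ev]; ring
      rw [e2]
      have h3 : (u i)^2 ≤ Q := Finset.single_le_sum (f := fun i => (u i)^2) (fun _ _ => sq_nonneg _) (Finset.mem_univ i)
      change _ ≤ U (φ (x + ev d N i) - φ x + u i) - _
      set η := φ (x + ev d N i) - φ x
      have h4 := h.lb (η + u i)
      have h5 := hub (s * η + u i)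
      have h6 : (s * η + u i)^2 ≤ 2 * s^2 * η^2 + 2 * (u i)^2 := by nlinarith [sq_nonneg (s * η - u i)]
      have h7 : (A / 2) * η^2 - A * (u i)^2 ≤ A * (η + u i)^2 := by nlinarith [mul_nonneg hA.le (sq_nonneg (η + 2 * u i))]
      have h8 : K * (1 + (s * η + u i)^2) ≤ K * (1 + (2 * s^2 * η^2 + 2 * Q)) := by
        gcongr; linarith
      have h9 : 2 * K * s^2 * η^2 ≤ A / 4 * η^2 := by gcongr
      have h10 := le_abs_self B
      have h11 : A * (u i)^2 ≤ A * Q := by gcongr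
      rw [hD]
      linarith
    have := mul_le_mul_of_nonneg_left h1 hβ.le
    rw [ha]; linarith
  have hG : ∀ φ : (Fin d → ZMod N) → ℝ, ENNReal.ofReal (exp (a * gE φ - β * (d * D) * (N:ℝ)^d)) * Gf β U u φ ≤ Gf β U u (s • φ) := by
    intro φ
    unfold Gf
    rw [← ENNReal.ofReal_mul (exp_pos _).le, ← exp_add]
    gcongr
    linarith [hpt φ]
  have hw : ∀ x : ℝ, wt x ≤ wt (s * x) := by
    intro x
    by_cases hx : x ∈ Set.Ico (0:ℝ) 1
    · rw [wt_of_mem hx, wt_of_mem ⟨mul_nonneg hs0.le hx.1, by nlinarith [hx.1, hx.2]⟩]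
    · rw [wt_of_not hx]; simp
  have hm : Measurable fun φ : (Fin d → ZMod N) → ℝ => wt (φ 0) * Gf β U u φ := (wt_pt_meas _).mul (Gf_meas β h.cU u)
  have hsc := scale_lb hs0 hm
  have hcard : (Fintype.card (Fin d → ZMod N)) = N^d := by simp [ZMod.card]
  have h1 : Ex (N := N) β U u (fun φ => ENNReal.ofReal (exp (a * gE φ - β * (d * D) * (N:ℝ)^d))) ≤
      ENNReal.ofReal (exp (log s⁻¹ * (N:ℝ)^d)) * Zl d N β U u := by
    have e : exp (log s⁻¹ * (N:ℝ)^d) = (s ^ (Fintype.card (Fin d → ZMod N)))⁻¹ := by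
      rw [hcard, ← inv_pow, mul_comm, show (N:ℝ)^d = ((N^d : ℕ) : ℝ) by push_cast; rfl, exp_nat_mul, exp_log (by positivity)]
    rw [e]
    refine le_trans ?_ (le_of_eq hsc)
    unfold Ex
    refine lintegral_mono fun φ => ?_
    dsimp only
    exact mul_le_mul' (hw _) (hG φ)
  have gm : Measurable fun φ : (Fin d → ZMod N) → ℝ => gE φ := gE_cont.measurable
  have h2 : Ex (N := N) β U u (fun φ => ENNReal.ofReal (exp (a * gE φ - D2 * (N:ℝ)^d))) ≤ Zl d N β U u := by
    have e : ∀ φ : (Fin d → ZMod N) → ℝ, ENNReal.ofReal (exp (a * gE φ - D2 * (N:ℝ)^d)) =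
       ENNReal.ofReal (exp (-(log s⁻¹ * (N:ℝ)^d))) * ENNReal.ofReal (exp (a * gE φ - β * (d * D) * (N:ℝ)^d)) := by
      intro φ
      rw [← ENNReal.ofReal_mul (exp_pos _).le, ← exp_add]
      congr 2
      rw [hD2]; ring
    simp_rw [e]
    rw [Ex_const_mul β h.cU u (by fun_prop)]
    calc _ ≤ ENNReal.ofReal (exp (-(log s⁻¹ * (N:ℝ)^d))) * (ENNReal.ofReal (exp (log s⁻¹ * (N:ℝ)^d)) * Zl d N β U u) := by gcongr
      _ = _ := by
        rw [← mul_assoc, ← ENNReal.ofReal_mul (exp_pos _).le, ← exp_add]; simp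
  have Nd : 1 ≤ (N:ℝ)^d := one_le_pow₀ (by exact_mod_cast Nat.one_le_iff_ne_zero.2 (NeZero.ne N))
  have h3 : ∀ φ : (Fin d → ZMod N) → ℝ, ENNReal.ofReal (gE φ) ≤ ENNReal.ofReal (1 / a) * (ENNReal.ofReal (exp (a * gE φ - D2 * (N:ℝ)^d)) + ENNReal.ofReal (D2 * (N:ℝ)^d)) := by
    intro φ
    rw [← ENNReal.ofReal_add (exp_pos _).le (by positivity), ← ENNReal.ofReal_mul (by positivity)]
    apply ENNReal.ofReal_le_ofReal
    rw [one_div, inv_mul_eq_div, le_div_iff₀ a0]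
    have := add_one_le_exp (a * gE φ - D2 * (N:ℝ)^d)
    linarith
  refine (Ex_mono β U u h3).trans ?_
  rw [Ex_const_mul β h.cU u (by fun_prop), Ex_add β h.cU u (by fun_prop), Ex_const β h.cU]
  calc _ ≤ ENNReal.ofReal (1 / a) * (Zl d N β U u + ENNReal.ofReal (D2 * (N:ℝ)^d) * Zl d N β U u) := by gcongr
    _ = ENNReal.ofReal (1 / a * (1 + D2 * (N:ℝ)^d)) * Zl d N β U u := by
      rw [ENNReal.ofReal_mul (p := 1 / a) (by positivity), ENNReal.ofReal_add (by norm_num) (by positivity)]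
      simp only [ENNReal.ofReal_one]
      ring
    _ ≤ _ := by
      refine mul_le_mul_left (ENNReal.ofReal_le_ofReal ?_) _
      rw [one_div, inv_mul_eq_div, div_mul_eq_mul_div]
      refine div_le_div_of_nonneg_right ?_ a0.le
      nlinarith

lemma bondE {U U1 U2 : ℝ → ℝ} {A B C β : ℝ} (h : Pot U U1 U2 A B C) (hβ : 0 < β) (u : Fin d → ℝ) :
    ∃ C' : ℝ, 0 ≤ C' ∧ ∀ (N : ℕ) [NeZero N] (x : Fin d → ZMod N) (i : Fin d),
      Ex (N := N) β U u (fun φ => ENNReal.ofReal ((φ (x + ev d N i) - φ x)^2)) ≤ ENNReal.ofReal C' * Zl d N β U u := by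
  obtain ⟨C', hC', H⟩ := energy h hβ u
  refine ⟨C', hC', fun N _ x i => ?_⟩
  have htr : ∀ y, Ex (N := N) β U u (fun φ => ENNReal.ofReal ((φ (y + ev d N i) - φ y)^2)) = Ex (N := N) β U u (fun φ => ENNReal.ofReal ((φ (0 + ev d N i) - φ 0)^2)) := by
    intro y
    have := Ex_trans (N := N) β h.cU u (F := fun φ => ENNReal.ofReal ((φ (0 + ev d N i) - φ 0)^2)) (by fun_prop) (fun φ c => by simp) y
    rw [← this]
    simp [add_comm]
  rw [htr x]
  have h1 : (N^d : ℕ) * Ex (N := N) β U u (fun φ => ENNReal.ofReal ((φ (0 + ev d N i) - φ 0)^2)) ≤ ENNReal.ofReal (C' * (N:ℝ)^d) * Zl d N β U u := by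
    refine le_trans ?_ (H N)
    calc ((N^d : ℕ) : ℝ≥0∞) * Ex (N := N) β U u (fun φ => ENNReal.ofReal ((φ (0 + ev d N i) - φ 0)^2))
        = ∑ y : Fin d → ZMod N, Ex (N := N) β U u (fun φ => ENNReal.ofReal ((φ (y + ev d N i) - φ y)^2)) := by
          simp_rw [htr]; simp [ZMod.card]
      _ = Ex (N := N) β U u (fun φ => ∑ y : Fin d → ZMod N, ENNReal.ofReal ((φ (y + ev d N i) - φ y)^2)) := by
          rw [Ex_sum β h.cU u]; intro y; fun_prop
      _ ≤ _ := by
          refine Ex_mono β U u fun φ => ?_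
          rw [← ENNReal.ofReal_sum_of_nonneg (fun _ _ => sq_nonneg _)]
          apply ENNReal.ofReal_le_ofReal
          unfold gE
          refine Finset.sum_le_sum fun y _ => ?_
          exact Finset.single_le_sum (f := fun i => (φ (y + ev d N i) - φ y)^2) (fun _ _ => sq_nonneg _) (Finset.mem_univ i)
  have hn : ((N^d : ℕ) : ℝ≥0∞) ≠ 0 := by exact_mod_cast pow_ne_zero _ (NeZero.ne N)
  have e : ENNReal.ofReal (C' * (N:ℝ)^d) = ((N^d : ℕ) : ℝ≥0∞) * ENNReal.ofReal C' := by
    rw [mul_comm C', ENNReal.ofReal_mul (by positivity)]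
    congr 1
    rw [← ENNReal.ofReal_natCast]; push_cast; rfl
  rw [e, mul_assoc] at h1
  exact (ENNReal.mul_le_mul_iff_right hn (ENNReal.natCast_ne_top _)).1 h1
end

end

section
open scoped ENNReal
set_option linter.all false

section
variable {d N : ℕ} [NeZero N]

lemma Jt_Ex (β : ℝ) (U : ℝ → ℝ) (u : Fin d → ℝ) (z : Fin d → ZMod N) (τ : ℝ) :
    Jt β U u z τ = Ex β U u (fun φ => ENNReal.ofReal (exp (τ * (φ z - φ 0)))) := by
  unfold Jt Ex
  simp_rw [mul_assoc]; rfl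

lemma Jt_ge (β : ℝ) {U : ℝ → ℝ} (hU : Continuous U) (u : Fin d → ℝ) (z : Fin d → ZMod N) (τ : ℝ) :
    Zl d N β U u ≤ Jt β U u z τ := by
  have htr : ∀ y, Ex (N := N) β U u (fun φ => ENNReal.ofReal (exp (τ * (φ (z + y) - φ y)))) = Jt β U u z τ := by
    intro y
    rw [Jt_Ex]
    have := Ex_trans (N := N) β hU u (F := fun φ => ENNReal.ofReal (exp (τ * (φ z - φ 0)))) (by fun_prop) (fun φ c => by simp) y
    rw [← this]
    simp
  have hn : ((N^d : ℕ) : ℝ≥0∞) ≠ 0 := by exact_mod_cast pow_ne_zero _ (NeZero.ne N)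
  rw [← ENNReal.mul_le_mul_iff_right hn (ENNReal.natCast_ne_top _), ← Ex_const β hU]
  calc _ ≤ Ex (N := N) β U u (fun φ => ∑ y : Fin d → ZMod N, ENNReal.ofReal (exp (τ * (φ (z + y) - φ y)))) := by
          refine Ex_mono β U u fun φ => ?_
          rw [← ENNReal.ofReal_sum_of_nonneg (fun _ _ => (exp_pos _).le), ← ENNReal.ofReal_natCast]
          apply ENNReal.ofReal_le_ofReal
          calc ((N^d : ℕ) : ℝ) = ∑ y : Fin d → ZMod N, (τ * (φ (z + y) - φ y) + 1) := by
                rw [Finset.sum_add_distrib, ← Finset.mul_sum, Finset.sum_sub_distrib]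
                have : ∑ y : Fin d → ZMod N, φ (z + y) = ∑ y, φ y := Fintype.sum_equiv (Equiv.addLeft z) _ _ fun _ => rfl
                rw [this]; simp [ZMod.card]
            _ ≤ _ := Finset.sum_le_sum fun y _ => add_one_le_exp _
    _ = ∑ y : Fin d → ZMod N, Ex (N := N) β U u (fun φ => ENNReal.ofReal (exp (τ * (φ (z + y) - φ y)))) := by
          rw [Ex_sum β hU u]; intro y; fun_prop
    _ = _ := by simp_rw [htr]; simp [ZMod.card]

lemma var_even [NeZero d] {U U1 U2 : ℝ → ℝ} {A B C β c : ℝ} (h : Pot U U1 U2 A B C) (hβ : 0 < β)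
    (hsym : ∀ s, U (-s) = U s) (hc0 : 0 < c) (hc : SLC d β U c)
    (h2 : 2 ∣ N) (u : Fin d → ℝ) (i : Fin d) (k : ℕ) (hk : 2 * k ≤ N) :
    Ex (N := N) β U u (fun φ => ENNReal.ofReal ((φ ((2 * k) • ev d N i) - φ 0)^2)) ≤
      ENNReal.ofReal (2 * exp (1 / (2 * c)) * N) * Zl d N β U u := by
  set z := (2 * k) • ev d N i
  have N0 : 0 < (N:ℝ) := by exact_mod_cast Nat.pos_of_ne_zero (NeZero.ne N)
  obtain ⟨Ku, hKu, HKu⟩ := Zl_ub h hβ d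
  obtain ⟨Kl, hKl, HKl⟩ := Zl_lb h hβ u
  have Zf : Zl d N β U u ≠ ∞ := ne_top_of_le_ne_top ENNReal.ofReal_ne_top (HKu N u)
  have Zp : Zl d N β U u ≠ 0 := fun h0 => by
    have := HKl N
    rw [h0] at this
    simp only [nonpos_iff_eq_zero, ENNReal.ofReal_eq_zero, not_le.2 (exp_pos _)] at this
  have key : ∀ τ : ℝ, Jt β U u z τ ≤ ENNReal.ofReal (exp (τ^2 * N / (2 * c))) * Zl d N β U u := by
    intro τ
    have h3 := Jt_var h hβ hsym hc0 hc h2 u i k hk τ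
    have h4 := Jt_ge β h.cU u z (-τ)
    have h5 : Jt β U u z τ ^ (1/2:ℝ) * Zl d N β U u ^ (1/2:ℝ) ≤ (ENNReal.ofReal (exp (τ^2 * N / (2 * c))) * Zl d N β U u) ^ (1/2:ℝ) * Zl d N β U u ^ (1/2:ℝ) := by
      refine le_trans (le_trans ?_ h3) (le_of_eq ?_)
      · gcongr
      · rw [ENNReal.mul_rpow_of_nonneg _ _ (by norm_num), mul_assoc, ← ENNReal.rpow_add _ _ Zp Zf,
          ENNReal.ofReal_rpow_of_pos (exp_pos _), ← exp_mul]
        norm_num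
        congr 3
        field_simp
        norm_num
    have h6 : Zl d N β U u ^ (1/2:ℝ) ≠ 0 := by simp [ENNReal.rpow_eq_zero_iff, Zp, Zf]
    have h7 : Zl d N β U u ^ (1/2:ℝ) ≠ ∞ := by simp [Zp, Zf]
    rw [mul_comm, mul_comm _ (Zl d N β U u ^ (1/2:ℝ)), ENNReal.mul_le_mul_iff_right h6 h7] at h5
    rwa [ENNReal.rpow_le_rpow_iff (by norm_num)] at h5
  set τ := (√N)⁻¹ with hτ
  have hτ2 : τ^2 = (N:ℝ)⁻¹ := by rw [hτ, inv_pow, sq_sqrt N0.le]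
  have hpt : ∀ φ : (Fin d → ZMod N) → ℝ, ENNReal.ofReal ((φ z - φ 0)^2) ≤
     ENNReal.ofReal N * (ENNReal.ofReal (exp (τ * (φ z - φ 0))) + ENNReal.ofReal (exp (-τ * (φ z - φ 0)))) := by
    intro φ
    rw [← ENNReal.ofReal_add (exp_pos _).le (exp_pos _).le, ← ENNReal.ofReal_mul N0.le]
    apply ENNReal.ofReal_le_ofReal
    have h8 : (τ * (φ z - φ 0))^2 ≤ exp (τ * (φ z - φ 0)) + exp (-τ * (φ z - φ 0)) := by
      rw [neg_mul]
      set y := τ * (φ z - φ 0)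
      have hy : ∀ y : ℝ, 0 ≤ y → y^2 ≤ exp y + exp (-y) := by
        intro y hy
        have h1 := quadratic_le_exp_of_nonneg (by linarith : 0 ≤ y / 2)
        have h5 : exp y = exp (y/2) * exp (y/2) := by rw [← exp_add]; congr 1; ring
        have h6 : y ≤ exp (y/2) := by nlinarith [sq_nonneg (y - 2)]
        have h7 := exp_pos (-y)
        nlinarith
      rcases le_total 0 y with h0 | h0
      · exact hy y h0
      · have := hy (-y) (by linarith)
        rw [neg_neg, neg_sq] at this; linarith
    rw [mul_pow, hτ2] at h8
    rw [inv_mul_le_iff₀ N0] at h8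
    exact h8
  refine (Ex_mono β U u hpt).trans ?_
  rw [Ex_const_mul β h.cU u (by fun_prop), Ex_add β h.cU u (by fun_prop), ← Jt_Ex, ← Jt_Ex]
  have k1 := key τ
  have k2 := key (-τ)
  rw [neg_sq, hτ2] at k2
  rw [hτ2] at k1
  have e : (N:ℝ)⁻¹ * N / (2 * c) = 1 / (2 * c) := by rw [inv_mul_cancel₀ N0.ne']
  rw [e] at k1 k2
  calc _ ≤ ENNReal.ofReal N * (ENNReal.ofReal (exp (1 / (2 * c))) * Zl d N β U u + ENNReal.ofReal (exp (1 / (2 * c))) * Zl d N β U u) := by gcongr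
    _ = _ := by
      rw [ENNReal.ofReal_mul (by positivity), ENNReal.ofReal_mul (by norm_num)]
      norm_num
      ring

/-- mean square displacement -/
def Vz (β : ℝ) (U : ℝ → ℝ) (u : Fin d → ℝ) (z : Fin d → ZMod N) : ℝ≥0∞ :=
  Ex (N := N) β U u (fun φ => ENNReal.ofReal ((φ z - φ 0)^2))

lemma Vz_add (β : ℝ) {U : ℝ → ℝ} (hU : Continuous U) (u : Fin d → ℝ) (z w : Fin d → ZMod N) :
    Vz β U u (z + w) ≤ 2 * Vz β U u z + 2 * Vz β U u w := by
  have := Ex_trans (N := N) β hU u (F := fun φ => ENNReal.ofReal ((φ z - φ 0)^2)) (by fun_prop) (fun φ c => by simp) w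
  simp only [zero_add] at this
  unfold Vz
  rw [← this, ← Ex_const_mul β hU u (by fun_prop), ← Ex_const_mul β hU u (by fun_prop), ← Ex_add β hU u (by fun_prop)]
  refine Ex_mono β U u fun φ => ?_
  have e2 : (2:ℝ≥0∞) = ENNReal.ofReal 2 := by norm_num
  rw [e2, ← ENNReal.ofReal_mul (by norm_num), ← ENNReal.ofReal_mul (by norm_num), ← ENNReal.ofReal_add (by positivity) (by positivity)]
  apply ENNReal.ofReal_le_ofReal
  nlinarith [sq_nonneg ((φ (z + w) - φ w) - (φ w - φ 0))]

lemma Vz_sum (β : ℝ) {U : ℝ → ℝ} (hU : Continuous U) (u : Fin d → ℝ) {J : Type*} (s : Finset J) (z : J → Fin d → ZMod N)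
    (K : ℝ≥0∞) (hz : ∀ j, Vz β U u (z j) ≤ K) : Vz β U u (∑ j ∈ s, z j) ≤ 4 ^ s.card * K := by
  induction s using Finset.induction_on with
  | empty => simp [Vz, Ex]
  | insert a s ha ih =>
    rw [Finset.sum_insert ha, Finset.card_insert_of_notMem ha]
    refine (Vz_add β hU u _ _).trans ?_
    calc _ ≤ 2 * K + 2 * (4 ^ s.card * K) := by gcongr; exact hz a
      _ ≤ 2 * (4 ^ s.card * K) + 2 * (4 ^ s.card * K) := by
        gcongr
        exact le_mul_of_one_le_left (by simp) (one_le_pow₀ (by norm_num))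
      _ = _ := by rw [pow_succ]; ring

lemma varE [NeZero d] {U U1 U2 : ℝ → ℝ} {A B C β c : ℝ} (h : Pot U U1 U2 A B C) (hβ : 0 < β)
    (hsym : ∀ s, U (-s) = U s) (hc0 : 0 < c) (hc : SLC d β U c) (u : Fin d → ℝ) :
    ∃ C' : ℝ, 0 ≤ C' ∧ ∀ (N : ℕ) [NeZero N] (h2 : 2 ∣ N) (x : Fin d → ZMod N),
      Ex (N := N) β U u (fun φ => ENNReal.ofReal ((φ x)^2)) ≤ ENNReal.ofReal (C' * N) * Zl d N β U u := by
  obtain ⟨C1, hC1, H1⟩ := bondE h hβ u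
  set C2 := 2 * exp (1 / (2 * c)) with hC2
  have C20 : 0 < C2 := by positivity
  have hvE : ∀ (N : ℕ) [NeZero N] (h2 : 2 ∣ N) i (k : ℕ), 2 * k ≤ N → Vz β U u ((2 * k) • ev d N i) ≤ ENNReal.ofReal (C2 * N) * Zl d N β U u := fun N _ h2 i k hk =>
    var_even h hβ hsym hc0 hc h2 u i k hk
  clear_value C2
  refine ⟨2 * (4 ^ d * (2 * C2 + 2 * C1)) + 2, by positivity, ?_⟩
  intro N _ h2 x
  have N1 : 1 ≤ (N:ℝ) := by exact_mod_cast Nat.one_le_iff_ne_zero.2 (NeZero.ne N)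
  set Z := Zl d N β U u
  have hev : ∀ i (k : ℕ), 2 * k ≤ N → Vz β U u ((2 * k) • ev d N i) ≤ ENNReal.ofReal (C2 * N) * Z := fun i k hk =>
    hvE N h2 i k hk
  have hone : ∀ i, Vz β U u (ev d N i) ≤ ENNReal.ofReal C1 * Z := fun i => by
    have := H1 N 0 i
    simpa [Vz] using this
  have hz : ∀ i, Vz β U u ((x i).val • ev d N i) ≤ ENNReal.ofReal ((2 * C2 + 2 * C1) * N) * Z := by
    intro i
    set m := (x i).val
    have hm : m < N := ZMod.val_lt _
    have hle : ENNReal.ofReal ((2 * C2 + 2 * C1) * N) = 2 * ENNReal.ofReal (C2 * N) + 2 * ENNReal.ofReal (C1 * N) := by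
      have e2 : (2:ℝ≥0∞) = ENNReal.ofReal 2 := by norm_num
      rw [e2, ← ENNReal.ofReal_mul (by norm_num), ← ENNReal.ofReal_mul (by norm_num), ← ENNReal.ofReal_add (by positivity) (by positivity)]
      congr 1; ring
    rcases Nat.even_or_odd' m with ⟨k, hk | hk⟩
    · rw [hk]
      refine (hev i k (by omega)).trans ?_
      gcongr
      nlinarith [mul_nonneg C20.le (by linarith : (0:ℝ) ≤ N), mul_nonneg hC1 (by linarith : (0:ℝ) ≤ N)]
    · rw [hk, succ_nsmul]
      refine (Vz_add β h.cU u _ _).trans ?_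
      rw [hle, add_mul, mul_assoc, mul_assoc]
      refine add_le_add (mul_le_mul_right ?_ _) (mul_le_mul_right ?_ _)
      · exact hev i k (by omega)
      · refine (hone i).trans ?_
        gcongr
        nlinarith
  have hx : x = ∑ i, (x i).val • ev d N i := by
    ext j
    rw [Finset.sum_apply, Finset.sum_eq_single j]
    · simp [ev]
    · intro b _ hb; simp [ev, Pi.single_eq_of_ne hb.symm]
    · simp
  have hV := Vz_sum β h.cU u Finset.univ (fun i => (x i).val • ev d N i) _ hz
  rw [← hx] at hV
  simp only [Finset.card_univ, Fintype.card_fin] at hV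
  have h3 : Ex (N := N) β U u (fun φ => ENNReal.ofReal ((φ x)^2)) ≤ 2 * Vz β U u x + 2 * Z := by
    unfold Vz
    rw [← Ex_const_mul β h.cU u (by fun_prop), ← Ex_const β h.cU u 2, ← Ex_add β h.cU u (by fun_prop)]
    unfold Ex
    refine lintegral_mono fun φ => ?_
    dsimp only
    by_cases h0 : φ 0 ∈ Set.Ico (0:ℝ) 1
    · gcongr
      have e2 : (2:ℝ≥0∞) = ENNReal.ofReal 2 := by norm_num
      rw [e2, ← ENNReal.ofReal_mul (by norm_num), ← ENNReal.ofReal_add (by positivity) (by positivity)]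
      apply ENNReal.ofReal_le_ofReal
      have : (φ 0)^2 ≤ 1 := by nlinarith [h0.1, h0.2]
      nlinarith [sq_nonneg (φ x - 2 * φ 0)]
    · rw [wt_of_not h0]; simp
  refine h3.trans ?_
  calc _ ≤ 2 * (4 ^ d * (ENNReal.ofReal ((2 * C2 + 2 * C1) * N) * Z)) + 2 * (ENNReal.ofReal N * Z) := by
        gcongr
        exact le_mul_of_one_le_left (by simp) (ENNReal.one_le_ofReal.2 N1)
    _ = _ := by
        have e2 : (2:ℝ≥0∞) = ENNReal.ofReal 2 := by norm_num
        have e4 : (4:ℝ≥0∞) = ENNReal.ofReal 4 := by norm_num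
        rw [e2, e4, ← ENNReal.ofReal_pow (by norm_num), ← mul_assoc, ← mul_assoc, ← mul_assoc (ENNReal.ofReal 2) (ENNReal.ofReal N), ← ENNReal.ofReal_mul (by norm_num), ← ENNReal.ofReal_mul (by positivity),
          ← ENNReal.ofReal_mul (by norm_num), ← add_mul, ← ENNReal.ofReal_add (by positivity) (by positivity)]
        congr 2; ring
end

end

section
open scoped ENNReal
set_option linter.all false

section
variable {K Y X : Type*} [Fintype K] [Fintype Y] [Fintype X]

lemma mp_uncurry : MeasurePreserving (fun (ψ : K → Y → ℝ) (p : K × Y) => ψ p.1 p.2) volume volume := by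
  have hm : Measurable (fun (ψ : K → Y → ℝ) (p : K × Y) => ψ p.1 p.2) := by fun_prop
  refine ⟨hm, ?_⟩
  symm
  refine Measure.pi_eq fun s hs => ?_
  rw [Measure.map_apply hm (MeasurableSet.univ_pi hs)]
  have : (fun (ψ : K → Y → ℝ) (p : K × Y) => ψ p.1 p.2) ⁻¹' (Set.univ.pi s) =
      Set.univ.pi fun k => Set.univ.pi fun y => s (k, y) := by
    ext ψ; simp
  rw [this, volume_pi_pi]
  simp_rw [volume_pi_pi]
  rw [Fintype.prod_prod_type]

/-- transfer of lower bounds -/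
lemma lower_transfer {j : K × Y → X} (hj : Function.Injective j) {f : (K → Y → ℝ) → X → ℝ}
    {H : (K → Y → ℝ) → ℝ≥0∞} {G : (X → ℝ) → ℝ≥0∞} (hG : Measurable G)
    (hHG : ∀ ψ θ, (∀ k y, θ (j (k, y)) = ψ k y) → (∀ x, x ∉ Set.range j → f ψ x ≤ θ x ∧ θ x < f ψ x + 1) →
      H ψ ≤ G θ) : ∫⁻ ψ, H ψ ≤ ∫⁻ θ, G θ := by
  let e : (K × Y) ⊕ {x // x ∉ Set.range j} ≃ X :=
    (Equiv.sumCongr (Equiv.ofInjective j hj) (Equiv.refl _)).trans (Equiv.sumCompl (fun x => x ∈ Set.range j))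
  have e1 := volume_measurePreserving_piCongrLeft (fun _ : X => ℝ) e
  have e2 := volume_measurePreserving_sumPiEquivProdPi_symm (fun _ : (K × Y) ⊕ {x // x ∉ Set.range j} => ℝ)
  have e3 := e1.comp e2
  rw [← e3.lintegral_comp hG]
  have hGm : Measurable fun a => G ((MeasurableEquiv.piCongrLeft (fun _ : X => ℝ) e ∘ (MeasurableEquiv.sumPiEquivProdPi fun _ : (K × Y) ⊕ {x // x ∉ Set.range j} => ℝ).symm) a) := hG.comp e3.measurable
  rw [Measure.volume_eq_prod, lintegral_prod _ hGm.aemeasurable]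
  have hGi : Measurable fun p : K × Y → ℝ => ∫⁻ z : {x // x ∉ Set.range j} → ℝ, G ((MeasurableEquiv.piCongrLeft (fun _ : X => ℝ) e ∘ (MeasurableEquiv.sumPiEquivProdPi fun _ : (K × Y) ⊕ {x // x ∉ Set.range j} => ℝ).symm) (p, z)) :=
    hGm.lintegral_prod_right'
  rw [← (mp_uncurry (K := K) (Y := Y)).lintegral_comp hGi]
  refine lintegral_mono fun ψ => ?_
  dsimp only
  have hone : ∫⁻ z : {x // x ∉ Set.range j} → ℝ, ∏ x, wt (z x - f ψ x) = 1 := by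
    rw [lintegral_pi_prod (f := fun (x : {x // x ∉ Set.range j}) (t : ℝ) => wt (t - f ψ x))
      (fun x => wt_meas.comp (measurable_id.sub_const _))]
    refine Finset.prod_eq_one fun x _ => ?_
    rw [lintegral_sub_right_eq_self wt, wt_int]
  have hms : Measurable fun z : {x // x ∉ Set.range j} → ℝ => ∏ x, wt (z x - f ψ x) :=
    Finset.measurable_prod _ fun x _ => wt_meas.comp ((measurable_pi_apply x).sub_const _)
  calc H ψ = H ψ * ∫⁻ z : {x // x ∉ Set.range j} → ℝ, ∏ x, wt (z x - f ψ x) := by rw [hone, mul_one]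
    _ = ∫⁻ z : {x // x ∉ Set.range j} → ℝ, H ψ * ∏ x, wt (z x - f ψ x) := (lintegral_const_mul _ hms).symm
    _ ≤ _ := by
      refine lintegral_mono fun z => ?_
      dsimp only
      by_cases hz : ∀ x, z x - f ψ x ∈ Set.Ico (0:ℝ) 1
      · rw [Finset.prod_congr rfl (fun x _ => wt_of_mem (hz x)), Finset.prod_const_one, mul_one]
        refine hHG ψ _ (fun k y => ?_) (fun x hx => ?_)
        · have : j (k, y) = e (Sum.inl (k, y)) := rfl
          rw [this]
          simp only [Function.comp, MeasurableEquiv.coe_piCongrLeft]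
          rw [Equiv.piCongrLeft_apply_apply]
          rfl
        · have h1 : x = e (Sum.inr ⟨x, hx⟩) := rfl
          have h2 : ((MeasurableEquiv.piCongrLeft (fun _ : X => ℝ) e ∘ (MeasurableEquiv.sumPiEquivProdPi fun _ : (K × Y) ⊕ {x // x ∉ Set.range j} => ℝ).symm) ((fun p : K × Y => ψ p.1 p.2), z)) x = z ⟨x, hx⟩ := by
            conv_lhs => rw [h1]
            simp only [Function.comp, MeasurableEquiv.coe_piCongrLeft]
            rw [Equiv.piCongrLeft_apply_apply]
            rfl
          rw [h2]
          have := hz ⟨x, hx⟩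
          simp only [Set.mem_Ico] at this
          constructor <;> linarith [this.1, this.2]
      · push Not at hz
        obtain ⟨x, hx⟩ := hz
        rw [Finset.prod_eq_zero (Finset.mem_univ x) (wt_of_not hx), mul_zero]
        exact zero_le
end

/-- Markov in place of Jensen -/
lemma markov_exp {Ω : Type*} [MeasurableSpace Ω] (μ : Measure Ω) {w : Ω → ℝ≥0∞} (hw : Measurable w) {S : Ω → ℝ}
    (hS : Measurable S) {m b : ℝ} (hm : 0 < m) (hb : 0 ≤ b) (hfin : ∫⁻ x, w x ∂μ ≠ ∞)
    (h : ∫⁻ x, ENNReal.ofReal (S x) * w x ∂μ ≤ ENNReal.ofReal m * ∫⁻ x, w x ∂μ) :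
    ENNReal.ofReal (exp (-(b * (2 * m))) / 2) * ∫⁻ x, w x ∂μ ≤ ∫⁻ x, ENNReal.ofReal (exp (-(b * S x))) * w x ∂μ := by
  set Z := ∫⁻ x, w x ∂μ with hZ
  have hp : ∀ x, w x ≤ ENNReal.ofReal (exp (b * (2 * m))) * (ENNReal.ofReal (exp (-(b * S x))) * w x) +
      ENNReal.ofReal (1 / (2 * m)) * (ENNReal.ofReal (S x) * w x) := by
    intro x
    rcases le_total (S x) (2 * m) with h1 | h1
    · refine le_trans ?_ le_self_add
      rw [← mul_assoc, ← ENNReal.ofReal_mul (exp_pos _).le, ← exp_add]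
      refine le_mul_of_one_le_left' ?_
      rw [ENNReal.one_le_ofReal]
      refine Real.one_le_exp ?_
      nlinarith
    · refine le_trans ?_ le_add_self
      rw [← mul_assoc, ← ENNReal.ofReal_mul (by positivity)]
      refine le_mul_of_one_le_left' ?_
      rw [ENNReal.one_le_ofReal, one_div_mul_eq_div, le_div_iff₀ (by positivity)]
      linarith
  have hm1 : Measurable fun x => ENNReal.ofReal (exp (-(b * S x))) * w x := by fun_prop
  have hm2 : Measurable fun x => ENNReal.ofReal (S x) * w x := by fun_prop
  set I := ∫⁻ x, ENNReal.ofReal (exp (-(b * S x))) * w x ∂μ with hI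
  have h2 : Z ≤ ENNReal.ofReal (exp (b * (2 * m))) * I + ENNReal.ofReal (1 / 2) * Z := by
    calc Z ≤ ∫⁻ x, (ENNReal.ofReal (exp (b * (2 * m))) * (ENNReal.ofReal (exp (-(b * S x))) * w x) +
      ENNReal.ofReal (1 / (2 * m)) * (ENNReal.ofReal (S x) * w x)) ∂μ := lintegral_mono hp
      _ = ENNReal.ofReal (exp (b * (2 * m))) * I + ENNReal.ofReal (1 / (2 * m)) * ∫⁻ x, ENNReal.ofReal (S x) * w x ∂μ := by
        rw [lintegral_add_left (hm1.const_mul _), lintegral_const_mul _ hm1, lintegral_const_mul _ hm2]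
      _ ≤ ENNReal.ofReal (exp (b * (2 * m))) * I + ENNReal.ofReal (1 / (2 * m)) * (ENNReal.ofReal m * Z) := by gcongr
      _ = _ := by
        rw [← mul_assoc (ENNReal.ofReal (1 / (2 * m))), ← ENNReal.ofReal_mul (by positivity)]
        congr 3
        field_simp
  clear_value Z I
  by_cases hIf : I = ∞
  · rw [hIf]; exact le_top
  lift Z to NNReal using hfin
  lift I to NNReal using hIf
  have h3 : (Z:ℝ) ≤ exp (b * (2 * m)) * I + 1 / 2 * Z := by
    have := ENNReal.toReal_mono (by finiteness) h2
    rw [ENNReal.toReal_add (by finiteness) (by finiteness), ENNReal.toReal_mul, ENNReal.toReal_mul,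
      ENNReal.toReal_ofReal (exp_pos _).le, ENNReal.toReal_ofReal (by norm_num)] at this
    simpa using this
  have h4 : exp (-(b * (2 * m))) / 2 * Z ≤ I := by
    have e1 : exp (-(b * (2 * m))) * exp (b * (2 * m)) = 1 := by rw [← exp_add]; simp
    have e2 := exp_pos (-(b * (2 * m)))
    have := mul_le_mul_of_nonneg_left h3 e2.le
    rw [mul_add, ← mul_assoc (exp (-(b * (2 * m)))) (exp (b * (2 * m))), e1] at this
    linarith
  rw [← ENNReal.ofReal_coe_nnreal (p := Z), ← ENNReal.ofReal_mul (by positivity), ← ENNReal.ofReal_coe_nnreal (p := I)]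
  exact ENNReal.ofReal_le_ofReal h4

end

section
open scoped ENNReal
set_option linter.all false

/-- one-dimensional block decomposition data -/
structure Blk (M N k : ℕ) (ε : ℝ) where
  b : ZMod M → Fin k
  r : ZMod M → ZMod N
  χ : ZMod M → ℝ
  j : Fin k → ZMod N → ZMod M
  χ0 : ∀ a, 0 ≤ χ a
  χ1 : ∀ a, χ a ≤ 1
  step : ∀ a, (χ a = 0 ∧ χ (a + 1) = 0) ∨ (b (a + 1) = b a ∧ |χ (a + 1) - χ a| ≤ ε ∧ (r (a + 1) = r a ∨ r (a + 1) = r a + 1))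
  zero : χ 0 = 0
  jb : ∀ c y, b (j c y) = c
  jr : ∀ c y, r (j c y) = y
  jχ : ∀ c y, χ (j c y) = 1
  jstep : ∀ c y, y ≠ -1 → j c (y + 1) = j c y + 1

def c0 (l L p : ℕ) : ℝ := min 1 (min ((p:ℝ) / l) (((L:ℝ) - 1 - p) / l))

lemma c0_le (l L p : ℕ) : c0 l L p ≤ 1 := min_le_left _ _
lemma c0_nonneg {l L p : ℕ} (h : p < L) : 0 ≤ c0 l L p := by
  have : (p:ℝ) + 1 ≤ L := by exact_mod_cast h
  refine le_min zero_le_one (le_min (by positivity) (div_nonneg (by linarith) (by positivity)))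
lemma c0_zero {l L : ℕ} (hL : 1 ≤ L) : c0 l L 0 = 0 := by
  have : (1:ℝ) ≤ L := by exact_mod_cast hL
  unfold c0
  have h2 : 0 ≤ ((L:ℝ) - 1) / l := div_nonneg (by linarith) (by positivity)
  simp [h2]
lemma c0_last {l L p : ℕ} (hL : p + 1 = L) : c0 l L p = 0 := by
  have : (p:ℝ) + 1 = L := by exact_mod_cast hL
  unfold c0
  rw [← this]
  have : 0 ≤ (p:ℝ) / l := by positivity
  simp [this]
lemma c0_one {l L p : ℕ} (hl : 1 ≤ l) (h1 : l ≤ p) (h2 : p + l + 1 ≤ L) : c0 l L p = 1 := by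
  have e0 : (1:ℝ) ≤ l := by exact_mod_cast hl
  have e1 : (l:ℝ) ≤ p := by exact_mod_cast h1
  have e2 : (p:ℝ) + l + 1 ≤ L := by exact_mod_cast h2
  unfold c0
  rw [min_eq_left]
  refine le_min ?_ ?_ <;> rw [le_div_iff₀ (by linarith)] <;> linarith
lemma c0_lip {l L p : ℕ} : |c0 l L (p + 1) - c0 l L p| ≤ 1 / l := by
  unfold c0
  refine (abs_min_sub_min_le_max _ _ _ _).trans (max_le (by simp) ?_)
  refine (abs_min_sub_min_le_max _ _ _ _).trans (max_le (le_of_eq ?_) (le_of_eq ?_))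
  · rw [← sub_div]; push_cast; rw [add_sub_cancel_left, abs_of_nonneg (by positivity)]
  · rw [← sub_div]; push_cast
    rw [show (L:ℝ) - 1 - (p + 1) - (L - 1 - p) = -1 by ring, neg_div, abs_neg, abs_of_nonneg (by positivity)]

lemma blk_exists (M N k l : ℕ) [NeZero M] [NeZero N] [NeZero k] (hl : 1 ≤ l) (hM : k * (N + 2 * l) ≤ M) :
    Nonempty (Blk M N k (1 / l)) := by
  set L := N + 2 * l with hL
  have hN : 1 ≤ N := NeZero.one_le
  have hk : 1 ≤ k := NeZero.one_le
  have hL1 : 0 < L := by omega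
  have hmod : ∀ v, v % L < L := fun v => Nat.mod_lt _ hL1
  have hdm : ∀ v, L * (v / L) + v % L = v := fun v => Nat.div_add_mod v L
  have hLk : L ≤ k * L := Nat.le_mul_of_pos_left _ hk
  -- values of j
  have jlt : ∀ (c : Fin k) (y : ZMod N), (c:ℕ) * L + l + y.val < k * L - l := by
    intro c y
    have h1 := ZMod.val_lt y
    have h2 : ((c:ℕ) + 1) * L ≤ k * L := Nat.mul_le_mul_right _ c.2
    rw [add_mul, one_mul] at h2
    omega
  have jval : ∀ (c : Fin k) (y : ZMod N), (((c:ℕ) * L + l + y.val : ℕ) : ZMod M).val = (c:ℕ) * L + l + y.val := by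
    intro c y
    exact ZMod.val_natCast_of_lt (by have := jlt c y; omega)
  have jmod : ∀ (c : Fin k) (y : ZMod N), ((c:ℕ) * L + l + y.val) % L = l + y.val := by
    intro c y
    rw [add_assoc, mul_comm, Nat.mul_add_mod]
    exact Nat.mod_eq_of_lt (by have := ZMod.val_lt y; omega)
  have jdiv : ∀ (c : Fin k) (y : ZMod N), ((c:ℕ) * L + l + y.val) / L = c := by
    intro c y
    rw [add_assoc, mul_comm, Nat.mul_add_div hL1, Nat.div_eq_of_lt (by have := ZMod.val_lt y; omega), add_zero]
  refine ⟨{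
    b := fun a => ⟨min (a.val / L) (k - 1), by omega⟩
    r := fun a => ((min (a.val % L - l) (N - 1) : ℕ) : ZMod N)
    χ := fun a => if a.val < k * L then c0 l L (a.val % L) else 0
    j := fun c y => (((c:ℕ) * L + l + y.val : ℕ) : ZMod M)
    χ0 := fun a => by
      split_ifs
      · exact c0_nonneg (hmod _)
      · exact le_rfl
    χ1 := fun a => by
      split_ifs
      · exact c0_le _ _ _
      · exact zero_le_one
    step := ?_
    zero := by
      simp [c0_zero hL1]
    jb := ?_
    jr := ?_
    jχ := ?_
    jstep := ?_ }⟩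
  · intro a
    have hv := ZMod.val_lt a
    have h1 := hdm a.val
    have h2 := hmod a.val
    have hlast : a.val + 1 = k * L → a.val % L + 1 = L := by
      intro h
      have : a.val = L * (k - 1) + (L - 1) := by
        zify [hk, hL1] at h ⊢
        push_cast [Nat.cast_sub hk, Nat.cast_sub (show 1 ≤ L from hL1)]
        linarith
      rw [this, Nat.mul_add_mod, Nat.mod_eq_of_lt (by omega)]; omega
    have key : a.val + 1 = k * L → c0 l L (a.val % L) = 0 := fun h => c0_last (hlast h)
    by_cases hw : a.val + 1 = M
    · left
      have e : a + 1 = 0 := by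
        have : ((a.val + 1 : ℕ) : ZMod M) = ((M : ℕ) : ZMod M) := by rw [hw]
        push_cast at this
        rw [ZMod.natCast_zmod_val, ZMod.natCast_self] at this
        exact this
      try dsimp only
      rw [e]
      refine ⟨?_, by simp [c0_zero hL1]⟩
      split_ifs with h
      · exact key (by omega)
      · rfl
    · have e : (a + 1).val = a.val + 1 := by
        have : a + 1 = ((a.val + 1 : ℕ) : ZMod M) := by push_cast; rw [ZMod.natCast_zmod_val]
        rw [this, ZMod.val_natCast_of_lt (by omega)]
      try dsimp only
      rw [Fin.mk.injEq, e]
      generalize a.val = v at *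
      by_cases hp : v % L + 1 = L
      · left
        have e2 : (v + 1) % L = 0 := by
          have : v + 1 = L * (v / L + 1) := by rw [mul_add, mul_one]; omega
          rw [this]; exact Nat.mul_mod_right _ _
        rw [e2, c0_zero hL1, c0_last hp]; simp
      · have e3 : v + 1 = L * (v / L) + (v % L + 1) := by omega
        have e4 : (v + 1) % L = v % L + 1 := by
          rw [e3, Nat.mul_add_mod, Nat.mod_eq_of_lt (by omega)]
        have e5 : (v + 1) / L = v / L := by
          conv_lhs => rw [e3]
          rw [Nat.mul_add_div hL1, Nat.div_eq_of_lt (show v % L + 1 < L by omega), add_zero]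
        rw [e4, e5]
        by_cases hlt : v < k * L
        · right
          have hlt' : v + 1 < k * L := by
            rcases Nat.lt_or_ge (v+1) (k*L) with h | h
            · exact h
            · exact absurd (hlast (by omega)) hp
          rw [if_pos hlt, if_pos hlt']
          refine ⟨rfl, c0_lip, ?_⟩
          by_cases hr : min (v % L + 1 - l) (N - 1) = min (v % L - l) (N - 1)
          · left; rw [hr]
          · right
            have : min (v % L + 1 - l) (N - 1) = min (v % L - l) (N - 1) + 1 := by omega
            rw [this]; push_cast; rfl
        · left
          rw [if_neg hlt, if_neg (by omega)]; exact ⟨rfl, rfl⟩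
  · intro c y
    ext
    try dsimp only
    rw [jval, jdiv]
    have := c.2
    omega
  · intro c y
    try dsimp only
    rw [jval, jmod]
    have := ZMod.val_lt y
    rw [show min (l + y.val - l) (N - 1) = y.val by omega, ZMod.natCast_zmod_val]
  · intro c y
    try dsimp only
    have := ZMod.val_lt y
    rw [jval, jmod, if_pos (by have := jlt c y; omega)]
    exact c0_one hl (by omega) (by omega)
  · intro c y hy
    try dsimp only
    have hv := ZMod.val_lt y
    have : (y + 1).val = y.val + 1 := by
      by_cases hw : y.val + 1 = N
      · exfalso; apply hy
        have : ((y.val + 1 : ℕ) : ZMod N) = ((N : ℕ) : ZMod N) := by rw [hw]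
        push_cast at this
        rw [ZMod.natCast_zmod_val, ZMod.natCast_self] at this
        exact eq_neg_of_add_eq_zero_left this
      · have : y + 1 = ((y.val + 1 : ℕ) : ZMod N) := by push_cast; rw [ZMod.natCast_zmod_val]
        rw [this, ZMod.val_natCast_of_lt (by omega)]
    rw [this]; push_cast; ring

end

section
open scoped ENNReal
set_option linter.all false

section
variable {d M N k : ℕ} [NeZero N] [NeZero M] {ε : ℝ}

def jj (D : Blk M N k ε) (p : (Fin d → Fin k) × (Fin d → ZMod N)) : Fin d → ZMod M := fun i => D.j (p.1 i) (p.2 i)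
def bb (D : Blk M N k ε) (x : Fin d → ZMod M) : Fin d → Fin k := fun i => D.b (x i)
def rr (D : Blk M N k ε) (x : Fin d → ZMod M) : Fin d → ZMod N := fun i => D.r (x i)
def xx (D : Blk M N k ε) (x : Fin d → ZMod M) : ℝ := ∏ i, D.χ (x i)
def ff (D : Blk M N k ε) (ψ : (Fin d → Fin k) → (Fin d → ZMod N) → ℝ) (x : Fin d → ZMod M) : ℝ :=
  ψ (bb D x) (rr D x) * xx D x

lemma bb_jj (D : Blk M N k ε) (p : (Fin d → Fin k) × (Fin d → ZMod N)) : bb D (jj D p) = p.1 := by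
  funext i; exact D.jb _ _
lemma rr_jj (D : Blk M N k ε) (p : (Fin d → Fin k) × (Fin d → ZMod N)) : rr D (jj D p) = p.2 := by
  funext i; exact D.jr _ _
lemma xx_jj (D : Blk M N k ε) (p : (Fin d → Fin k) × (Fin d → ZMod N)) : xx D (jj D p) = 1 :=
  Finset.prod_eq_one fun i _ => D.jχ _ _
lemma jj_inj (D : Blk M N k ε) : Function.Injective (jj (d := d) D) := by
  intro p q h
  refine Prod.ext ?_ ?_
  · rw [← bb_jj D p, h, bb_jj]
  · rw [← rr_jj D p, h, rr_jj]
lemma ff_jj (D : Blk M N k ε) (ψ : (Fin d → Fin k) → (Fin d → ZMod N) → ℝ) (c) (y) : ff D ψ (jj D (c, y)) = ψ c y := by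
  rw [ff, bb_jj, rr_jj, xx_jj, mul_one]
lemma xx_zero [NeZero d] (D : Blk M N k ε) : xx D (0 : Fin d → ZMod M) = 0 :=
  Finset.prod_eq_zero (Finset.mem_univ (0 : Fin d)) D.zero
lemma zero_not_range [NeZero d] (D : Blk M N k ε) : (0 : Fin d → ZMod M) ∉ Set.range (jj (d := d) D) := by
  rintro ⟨p, hp⟩
  have := xx_jj D p
  rw [hp, xx_zero] at this
  exact zero_ne_one this
lemma xx_nonneg (D : Blk M N k ε) (x : Fin d → ZMod M) : 0 ≤ xx D x := Finset.prod_nonneg fun i _ => D.χ0 _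
lemma xx_le (D : Blk M N k ε) (x : Fin d → ZMod M) : xx D x ≤ 1 := Finset.prod_le_one (fun i _ => D.χ0 _) fun i _ => D.χ1 _

lemma add_ev_same (x : Fin d → ZMod M) (i : Fin d) : (x + ev d M i) i = x i + 1 := by simp [ev]
lemma add_ev_ne (x : Fin d → ZMod M) {i l : Fin d} (h : l ≠ i) : (x + ev d M i) l = x l := by simp [ev, h]

lemma ff_grad (D : Blk M N k ε) (ψ : (Fin d → Fin k) → (Fin d → ZMod N) → ℝ) (x : Fin d → ZMod M) (i : Fin d) :
    (ff D ψ (x + ev d M i) - ff D ψ x)^2 ≤ 2 * (ψ (bb D x) (rr D x + ev d N i) - ψ (bb D x) (rr D x))^2 +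
      2 * (ε^2 * (ψ (bb D x) (rr D x))^2) := by
  have hc : ∀ y : Fin d → ZMod M, xx D y = D.χ (y i) * ∏ l ∈ Finset.univ.erase i, D.χ (y l) := fun y =>
    (Finset.mul_prod_erase _ _ (Finset.mem_univ i)).symm
  have hP : ∏ l ∈ Finset.univ.erase i, D.χ ((x + ev d M i) l) = ∏ l ∈ Finset.univ.erase i, D.χ (x l) := by
    refine Finset.prod_congr rfl fun l hl => ?_
    rw [add_ev_ne x (Finset.ne_of_mem_erase hl)]
  rcases D.step (x i) with ⟨h1, h2⟩ | ⟨h1, h2, h3⟩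
  · have e1 : xx D x = 0 := by rw [hc, h1, zero_mul]
    have e2 : xx D (x + ev d M i) = 0 := by rw [hc, add_ev_same, h2, zero_mul]
    unfold ff
    rw [e1, e2]
    refine le_trans (le_of_eq (b := 0) ?_) (by positivity)
    ring
  · have e1 : bb D (x + ev d M i) = bb D x := by
      funext l
      unfold bb
      by_cases hl : l = i
      · subst hl; rw [add_ev_same, h1]
      · rw [add_ev_ne x hl]
    have e2 : rr D (x + ev d M i) = rr D x ∨ rr D (x + ev d M i) = rr D x + ev d N i := by
      rcases h3 with h3 | h3
      · left
        funext l
        unfold rr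
        by_cases hl : l = i
        · subst hl; rw [add_ev_same, h3]
        · rw [add_ev_ne x hl]
      · right
        funext l
        by_cases hl : l = i
        · subst hl; rw [add_ev_same]; unfold rr; rw [add_ev_same, h3]
        · rw [add_ev_ne _ hl]; unfold rr; rw [add_ev_ne x hl]
    have e3 : |xx D (x + ev d M i) - xx D x| ≤ ε := by
      rw [hc, hc x, hP, add_ev_same, ← sub_mul, abs_mul]
      have p0 : 0 ≤ ∏ l ∈ Finset.univ.erase i, D.χ (x l) := Finset.prod_nonneg fun _ _ => D.χ0 _
      have p1 : ∏ l ∈ Finset.univ.erase i, D.χ (x l) ≤ 1 := Finset.prod_le_one (fun _ _ => D.χ0 _) fun _ _ => D.χ1 _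
      rw [abs_of_nonneg p0]
      calc _ ≤ |D.χ (x i + 1) - D.χ (x i)| * 1 := by gcongr
        _ ≤ ε := by rw [mul_one]; exact h2
    have e4 := xx_nonneg D (x + ev d M i)
    have e5 := xx_le D (x + ev d M i)
    have e6 : (xx D (x + ev d M i) - xx D x)^2 ≤ ε^2 := sq_le_sq' (by linarith [abs_le.1 e3]) (abs_le.1 e3).2
    unfold ff
    rw [e1]
    generalize xx D (x + ev d M i) = X' at *
    generalize xx D x = X at *
    have e7 : X'^2 ≤ 1 := by nlinarith
    have fin : ∀ a b : ℝ, (a * X' - b * X)^2 ≤ 2 * (a - b)^2 + 2 * (ε^2 * b^2) := by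
      intro a b
      have t1 : (a * X' - b * X)^2 ≤ 2 * ((a - b)^2 * X'^2) + 2 * (b^2 * (X' - X)^2) := by
        nlinarith [sq_nonneg ((a - b) * X' - b * (X' - X))]
      have t2 : (a - b)^2 * X'^2 ≤ (a - b)^2 * 1 := mul_le_mul_of_nonneg_left e7 (sq_nonneg _)
      have t3 : b^2 * (X' - X)^2 ≤ b^2 * ε^2 := mul_le_mul_of_nonneg_left e6 (sq_nonneg _)
      linarith
    rcases e2 with e2 | e2
    · rw [e2]
      refine (fin _ _).trans ?_
      rw [sub_self]
      nlinarith [sq_nonneg (ψ (bb D x) (rr D x + ev d N i) - ψ (bb D x) (rr D x))]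
    · rw [e2]; exact fin _ _

/-- local term -/
def Sx (D : Blk M N k ε) (a b : ℝ) (ψ : (Fin d → Fin k) → (Fin d → ZMod N) → ℝ) (x : Fin d → ZMod M) (i : Fin d) : ℝ :=
  a + b * ((ψ (bb D x) (rr D x + ev d N i) - ψ (bb D x) (rr D x))^2 + ε^2 * (ψ (bb D x) (rr D x))^2)

lemma bond_ub (D : Blk M N k ε) {U : ℝ → ℝ} {K : ℝ} (hK : 0 < K) (hub : ∀ x, U x ≤ K * (1 + x^2))
    (u : Fin d → ℝ) (ψ : (Fin d → Fin k) → (Fin d → ZMod N) → ℝ) (θ : (Fin d → ZMod M) → ℝ)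
    (hθ : ∀ x, |θ x - ff D ψ x| ≤ 1) (x : Fin d → ZMod M) (i : Fin d) :
    U (θ (x + ev d M i) - θ x + u i) ≤ Sx D (K * (17 + 2 * ∑ l, (u l)^2)) (8 * K) ψ x i := by
  have h1 := ff_grad D ψ x i
  have h2 := abs_le.1 (hθ x)
  have h3 := abs_le.1 (hθ (x + ev d M i))
  have h4 : (u i)^2 ≤ ∑ l, (u l)^2 := Finset.single_le_sum (f := fun l => (u l)^2) (fun _ _ => sq_nonneg _) (Finset.mem_univ i)
  unfold Sx
  refine (hub _).trans ?_
  rw [mul_assoc 8, mul_left_comm 8, ← mul_add]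
  refine mul_le_mul_of_nonneg_left ?_ hK.le
  generalize (ψ (bb D x) (rr D x + ev d N i) - ψ (bb D x) (rr D x))^2 = G at *
  generalize ε^2 * (ψ (bb D x) (rr D x))^2 = G' at *
  generalize ff D ψ (x + ev d M i) = f' at *
  generalize ff D ψ x = f at *
  generalize θ (x + ev d M i) = t' at *
  generalize θ x = t at *
  have h5 : (t' - t)^2 ≤ 2 * (f' - f)^2 + 2 * ((t' - f') - (t - f))^2 := by
    nlinarith [sq_nonneg ((f' - f) - ((t' - f') - (t - f)))]
  have h6 : ((t' - f') - (t - f))^2 ≤ 2^2 := sq_le_sq' (by linarith) (by linarith)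
  have h7 : (t' - t + u i)^2 ≤ 2 * (t' - t)^2 + 2 * (u i)^2 := by nlinarith [sq_nonneg (t' - t - u i)]
  linarith

def DY (d N : ℕ) [NeZero N] : Finset (Fin d → ZMod N) := Fintype.piFinset fun _ => ({-1} : Finset (ZMod N))ᶜ

def DX (D : Blk M N k ε) : Finset (Fin d → ZMod M) :=
  ((Finset.univ : Finset (Fin d → Fin k)) ×ˢ DY d N).map ⟨jj D, jj_inj D⟩

lemma DY_card : (DY d N).card = (N - 1)^d := by
  unfold DY
  rw [Fintype.card_piFinset]
  simp [Finset.card_compl, ZMod.card]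

lemma DX_card (D : Blk M N k ε) : (DX (d := d) D).card = k^d * (N-1)^d := by
  unfold DX
  rw [Finset.card_map, Finset.card_product, DY_card]
  simp

lemma DXc_card (D : Blk M N k ε) : ((DX (d := d) D)ᶜ.card : ℝ) = (M:ℝ)^d - (k:ℝ)^d * ((N:ℝ)-1)^d := by
  have hN : 1 ≤ N := NeZero.one_le
  have h1 := Finset.card_add_card_compl (DX (d := d) D)
  rw [DX_card] at h1
  have h2 : Fintype.card (Fin d → ZMod M) = M^d := by simp [ZMod.card]
  rw [h2] at h1
  have h3 : ((k^d * (N-1)^d + (DX (d := d) D)ᶜ.card : ℕ):ℝ) = ((M^d : ℕ):ℝ) := by rw [h1]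
  push_cast [Nat.cast_sub hN] at h3
  linarith

lemma jj_add_ev (D : Blk M N k ε) (c : Fin d → Fin k) {y : Fin d → ZMod N} (hy : y ∈ DY d N) (i : Fin d) :
    jj D (c, y) + ev d M i = jj D (c, y + ev d N i) := by
  unfold DY at hy
  rw [Fintype.mem_piFinset] at hy
  funext l
  by_cases hl : l = i
  · subst hl
    rw [add_ev_same]
    unfold jj
    dsimp only
    rw [add_ev_same, D.jstep]
    have := hy l
    simpa using this
  · rw [add_ev_ne _ hl]
    unfold jj
    dsimp only
    rw [add_ev_ne _ hl]

lemma energy_ub (D : Blk M N k ε) {U : ℝ → ℝ} {K B' : ℝ} (hK : 0 < K) (hub : ∀ x, U x ≤ K * (1 + x^2))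
    (hB : 0 ≤ B') (hlb : ∀ x, -B' ≤ U x)
    (u : Fin d → ℝ) (ψ : (Fin d → Fin k) → (Fin d → ZMod N) → ℝ) (θ : (Fin d → ZMod M) → ℝ)
    (h1 : ∀ c y, θ (jj D (c, y)) = ψ c y) (h2 : ∀ x, x ∉ Set.range (jj D) → ff D ψ x ≤ θ x ∧ θ x < ff D ψ x + 1) :
    torusH d M U θ u ≤ ∑ c, torusH d N U (ψ c) u +
      ∑ x ∈ (DX D)ᶜ, ∑ i, Sx D (B' + K * (17 + 2 * ∑ l, (u l)^2)) (8 * K) ψ x i := by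
  have hθ : ∀ x, |θ x - ff D ψ x| ≤ 1 := by
    intro x
    by_cases hx : x ∈ Set.range (jj D)
    · obtain ⟨⟨c, y⟩, rfl⟩ := hx
      rw [h1, ff_jj]; simp
    · have := h2 x hx
      rw [abs_le]; constructor <;> linarith [this.1, this.2]
  set hM : (Fin d → ZMod M) → ℝ := fun x => ∑ i, U (θ (x + ev d M i) - θ x + u i) with hhM
  set hN : (Fin d → Fin k) → (Fin d → ZMod N) → ℝ := fun c y => ∑ i, U (ψ c (y + ev d N i) - ψ c y + u i) with hhN
  have e1 : torusH d M U θ u = ∑ x ∈ DX D, hM x + ∑ x ∈ (DX D)ᶜ, hM x := by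
    rw [Finset.sum_add_sum_compl]; rfl
  have e2 : ∑ x ∈ DX D, hM x = ∑ c, ∑ y ∈ DY d N, hN c y := by
    unfold DX
    rw [Finset.sum_map, Finset.sum_product]
    refine Finset.sum_congr rfl fun c _ => Finset.sum_congr rfl fun y hy => ?_
    simp only [hhM, hhN]
    refine Finset.sum_congr rfl fun i _ => ?_
    simp only [Function.Embedding.coeFn_mk]
    rw [jj_add_ev D c hy, h1, h1]
  have e3 : ∀ c, torusH d N U (ψ c) u = ∑ y ∈ DY d N, hN c y + ∑ y ∈ (DY d N)ᶜ, hN c y := by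
    intro c; rw [Finset.sum_add_sum_compl]; rfl
  have e4 : ∀ c y, -(d * B') ≤ hN c y := by
    intro c y
    have : ∑ i : Fin d, (-B') ≤ hN c y := Finset.sum_le_sum fun i _ => hlb _
    simpa using this
  have e5 : ∀ c, ∑ y ∈ DY d N, hN c y ≤ torusH d N U (ψ c) u + (DY d N)ᶜ.card * (d * B') := by
    intro c
    have : ∑ y ∈ (DY d N)ᶜ, (-(d * B')) ≤ ∑ y ∈ (DY d N)ᶜ, hN c y := Finset.sum_le_sum fun y _ => e4 c y
    rw [Finset.sum_const, nsmul_eq_mul] at this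
    rw [e3]; linarith
  have e6 : Fintype.card (Fin d → Fin k) * (DY d N)ᶜ.card ≤ (DX (d := d) D)ᶜ.card := by
    have : (((Finset.univ : Finset (Fin d → Fin k)) ×ˢ (DY d N)ᶜ).map ⟨jj D, jj_inj D⟩) ⊆ (DX D)ᶜ := by
      intro x hx
      simp only [DX, Finset.mem_map, Finset.mem_compl, Finset.mem_product, Function.Embedding.coeFn_mk] at hx ⊢
      obtain ⟨p, hp, rfl⟩ := hx
      rintro ⟨q, hq, hqp⟩
      rw [jj_inj D hqp] at hq
      exact hp.2 hq.2
    have := Finset.card_le_card this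
    rwa [Finset.card_map, Finset.card_product, Finset.card_univ] at this
  have e7 : ∑ c : Fin d → Fin k, ∑ y ∈ DY d N, hN c y ≤ ∑ c, torusH d N U (ψ c) u + (DX (d := d) D)ᶜ.card * (d * B') := by
    have e6' : ((Fintype.card (Fin d → Fin k) : ℕ):ℝ) * (DY d N)ᶜ.card ≤ (DX (d := d) D)ᶜ.card := by exact_mod_cast e6
    have := Finset.sum_le_sum (s := Finset.univ) fun c _ => e5 c
    rw [Finset.sum_add_distrib, Finset.sum_const, nsmul_eq_mul, Finset.card_univ, ← mul_assoc] at this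
    refine this.trans ?_
    gcongr
  have e8 : ∑ x ∈ (DX D)ᶜ, hM x ≤ ∑ x ∈ (DX D)ᶜ, ∑ i, Sx D (K * (17 + 2 * ∑ l, (u l)^2)) (8 * K) ψ x i :=
    Finset.sum_le_sum fun x _ => Finset.sum_le_sum fun i _ => bond_ub D hK hub u ψ θ hθ x i
  have e9 : ∑ x ∈ (DX D)ᶜ, ∑ i, Sx D (B' + K * (17 + 2 * ∑ l, (u l)^2)) (8 * K) ψ x i =
      (DX (d := d) D)ᶜ.card * (d * B') + ∑ x ∈ (DX D)ᶜ, ∑ i, Sx D (K * (17 + 2 * ∑ l, (u l)^2)) (8 * K) ψ x i := by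
    have : ∀ x i, Sx (d := d) D (B' + K * (17 + 2 * ∑ l, (u l)^2)) (8 * K) ψ x i = B' + Sx D (K * (17 + 2 * ∑ l, (u l)^2)) (8 * K) ψ x i := by
      intro x i; unfold Sx; ring
    simp only [this, Finset.sum_add_distrib, Finset.sum_const, nsmul_eq_mul, Finset.card_univ, Fintype.card_fin]
  rw [e1, e2, e9]
  linarith
end

end

section
open scoped ENNReal
set_option linter.all false

section
variable {d M N k : ℕ} [NeZero N] [NeZero M] {ε : ℝ}

/-- product weight -/
def wP {κ : Type*} [Fintype κ] (β : ℝ) (U : ℝ → ℝ) (u : Fin d → ℝ) (ψ : κ → (Fin d → ZMod N) → ℝ) : ℝ≥0∞ :=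
  ∏ c, (wt (ψ c 0) * Gf β U u (ψ c))

lemma one_meas (β : ℝ) {U : ℝ → ℝ} (hU : Continuous U) (u : Fin d → ℝ) :
    Measurable fun φ : (Fin d → ZMod N) → ℝ => wt (φ 0) * Gf β U u φ := (wt_pt_meas _).mul (Gf_meas β hU u)

lemma wP_meas {κ : Type*} [Fintype κ] (β : ℝ) {U : ℝ → ℝ} (hU : Continuous U) (u : Fin d → ℝ) :
    Measurable (wP (N := N) (κ := κ) β U u) :=
  Finset.measurable_prod _ fun c _ => (one_meas β hU u).comp (measurable_pi_apply c)

lemma wP_int {κ : Type*} [Fintype κ] (β : ℝ) {U : ℝ → ℝ} (hU : Continuous U) (u : Fin d → ℝ) :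
    ∫⁻ ψ, wP (N := N) (κ := κ) β U u ψ = Zl d N β U u ^ (Fintype.card κ) := by
  unfold wP
  rw [lintegral_pi_prod (f := fun (_ : κ) (φ : (Fin d → ZMod N) → ℝ) => wt (φ 0) * Gf β U u φ) (fun _ => one_meas β hU u)]
  rw [Finset.prod_const, Finset.card_univ]
  rfl

lemma wP_Ex {κ : Type*} [Fintype κ] (β : ℝ) {U : ℝ → ℝ} (hU : Continuous U) (u : Fin d → ℝ)
    {F : ((Fin d → ZMod N) → ℝ) → ℝ≥0∞} (hF : Measurable F) {a : ℝ≥0∞} (h : Ex β U u F ≤ a * Zl d N β U u) (c : κ) :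
    ∫⁻ ψ : κ → (Fin d → ZMod N) → ℝ, F (ψ c) * wP β U u ψ ≤ a * ∫⁻ ψ, wP (N := N) (κ := κ) β U u ψ := by
  set g : κ → ((Fin d → ZMod N) → ℝ) → ℝ≥0∞ := fun c' φ => (if c' = c then F φ else 1) * (wt (φ 0) * Gf β U u φ) with hg
  have hgm : ∀ c', Measurable (g c') := by
    intro c'
    simp only [hg]
    split_ifs
    · exact hF.mul (one_meas β hU u)
    · exact measurable_const.mul (one_meas β hU u)
  have e1 : ∀ ψ : κ → (Fin d → ZMod N) → ℝ, F (ψ c) * wP β U u ψ = ∏ c', g c' (ψ c') := by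
    intro ψ
    simp only [hg, wP]
    rw [Finset.prod_mul_distrib (f := fun c' => if c' = c then F (ψ c') else 1), Finset.prod_ite_eq']
    simp only [Finset.mem_univ, if_true]
  simp_rw [e1]
  rw [lintegral_pi_prod hgm, wP_int β hU u, ← Finset.mul_prod_erase _ _ (Finset.mem_univ c)]
  have e2 : ∫⁻ y, g c y = Ex β U u F := by
    unfold Ex
    refine lintegral_congr fun φ => ?_
    simp only [hg, if_true]; ring
  have e3 : ∏ c' ∈ Finset.univ.erase c, ∫⁻ y, g c' y = Zl d N β U u ^ (Fintype.card κ - 1) := by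
    rw [Finset.prod_congr rfl (g := fun _ => Zl d N β U u), Finset.prod_const, Finset.card_erase_of_mem (Finset.mem_univ c), Finset.card_univ]
    intro c' hc'
    unfold Zl
    refine lintegral_congr fun φ => ?_
    simp only [hg, if_neg (Finset.ne_of_mem_erase hc'), one_mul]
    rfl
  rw [e2, e3]
  have : 0 < Fintype.card κ := Fintype.card_pos_iff.2 ⟨c⟩
  obtain ⟨n, hn⟩ := Nat.exists_eq_succ_of_ne_zero this.ne'
  rw [hn, Nat.succ_sub_one, pow_succ', ← mul_assoc]
  gcongr

lemma superadd [NeZero d] {U U1 U2 : ℝ → ℝ} {A B C β c : ℝ} (h : Pot U U1 U2 A B C) (hβ : 0 < β)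
    (hsym : ∀ s, U (-s) = U s) (hc0 : 0 < c) (hc : SLC d β U c) (u : Fin d → ℝ) :
    ∃ C' : ℝ, 0 ≤ C' ∧ ∀ (N : ℕ) [NeZero N] (h2 : 2 ∣ N) (l : ℕ) (hl : 1 ≤ l) (hNl : N ≤ l^2) (M k : ℕ) [NeZero M] [NeZero k]
      (hM : k * (N + 2 * l) ≤ M),
      ENNReal.ofReal (exp (-(C' * ((M:ℝ)^d - (k:ℝ)^d * ((N:ℝ) - 1)^d + 1)))) * Zl d N β U u ^ (k^d) ≤ Zl d M β U u := by
  obtain ⟨K, hK, hub⟩ := h.ub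
  obtain ⟨C1, hC1, H1⟩ := bondE h hβ u
  obtain ⟨C2, hC2, H2⟩ := varE h hβ hsym hc0 hc u
  obtain ⟨K3, hK3, H3⟩ := Zl_ub h hβ d
  have hU := h.cU
  set B' := max B 0 with hB'
  have hB0 : 0 ≤ B' := le_max_right _ _
  have hlb : ∀ x, -B' ≤ U x := by
    intro x
    have := h.lb x
    have h1 : B ≤ B' := le_max_left _ _
    nlinarith [h.A_pos, sq_nonneg x, mul_nonneg h.A_pos.le (sq_nonneg x)]
  set Q := ∑ l, (u l)^2 with hQ
  have hQ0 : 0 ≤ Q := Finset.sum_nonneg fun _ _ => sq_nonneg _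
  set a := B' + K * (17 + 2 * Q) with ha
  set b := 8 * K with hb
  have ha0 : 0 ≤ a := by positivity
  have hb0 : 0 ≤ b := by positivity
  set m0 := a + b * (C1 + C2) with hm0
  have hm00 : 0 ≤ m0 := by positivity
  clear_value Q a b m0
  refine ⟨2 * β * (d * m0 + 1) + log 2, by have := log_nonneg one_le_two; positivity, ?_⟩
  intro N _ h2 l hl hNl M k _ _ hM
  obtain ⟨D⟩ := blk_exists M N k l hl hM
  have hl' : (1:ℝ) ≤ l := by exact_mod_cast hl
  set ε : ℝ := 1 / l with hε
  have hεN : ε^2 * N ≤ 1 := by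
    have : (N:ℝ) ≤ (l:ℝ)^2 := by exact_mod_cast hNl
    rw [hε, div_pow, one_pow, one_div_mul_eq_div, div_le_one (by positivity)]
    exact this
  clear_value ε
  set S : ((Fin d → Fin k) → (Fin d → ZMod N) → ℝ) → ℝ := fun ψ => ∑ x ∈ (DX D)ᶜ, ∑ i, Sx D a b ψ x i with hS
  have hSm : Measurable S := by
    refine Finset.measurable_sum _ fun x _ => Finset.measurable_sum _ fun i _ => ?_
    unfold Sx
    fun_prop
  set n : ℝ := ((DX (d := d) D)ᶜ.card : ℝ) with hn
  have hn0 : 0 ≤ n := Nat.cast_nonneg _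
  -- expectation of S
  have hEx : ∀ (y : Fin d → ZMod N) (i : Fin d),
      Ex β U u (fun φ => ENNReal.ofReal (a + b * ((φ (y + ev d N i) - φ y)^2 + ε^2 * (φ y)^2))) ≤ ENNReal.ofReal m0 * Zl d N β U u := by
    intro y i
    have e1 : ∀ φ : (Fin d → ZMod N) → ℝ, ENNReal.ofReal (a + b * ((φ (y + ev d N i) - φ y)^2 + ε^2 * (φ y)^2)) =
        ENNReal.ofReal a + (ENNReal.ofReal b * ENNReal.ofReal ((φ (y + ev d N i) - φ y)^2) + ENNReal.ofReal (b * ε^2) * ENNReal.ofReal ((φ y)^2)) := by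
      intro φ
      rw [← ENNReal.ofReal_mul hb0, ← ENNReal.ofReal_mul (by positivity), ← ENNReal.ofReal_add (by positivity) (by positivity), ← ENNReal.ofReal_add (by positivity) (by positivity)]
      congr 1; ring
    simp_rw [e1]
    have m1 : Measurable fun φ : (Fin d → ZMod N) → ℝ => ENNReal.ofReal ((φ (y + ev d N i) - φ y)^2) := by fun_prop
    have m2 : Measurable fun φ : (Fin d → ZMod N) → ℝ => ENNReal.ofReal ((φ y)^2) := by fun_prop
    rw [Ex_add β hU u measurable_const, Ex_add β hU u (m1.const_mul _), Ex_const_mul β hU u m1, Ex_const_mul β hU u m2, Ex_const β hU]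
    have q1 := H1 N y i
    have q2 := H2 N h2 y
    calc _ ≤ ENNReal.ofReal a * Zl d N β U u + (ENNReal.ofReal b * (ENNReal.ofReal C1 * Zl d N β U u) + ENNReal.ofReal (b * ε^2) * (ENNReal.ofReal (C2 * N) * Zl d N β U u)) := by gcongr
      _ = ENNReal.ofReal (a + (b * C1 + b * ε^2 * (C2 * N))) * Zl d N β U u := by
        rw [ENNReal.ofReal_add (by positivity) (by positivity), ENNReal.ofReal_add (by positivity) (by positivity), ENNReal.ofReal_mul (q := C1) hb0, ENNReal.ofReal_mul (q := C2 * N) (p := b * ε^2) (by positivity)]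
        ring
      _ ≤ _ := by
        gcongr
        have : b * C2 * (ε^2 * N) ≤ b * C2 * 1 := by gcongr
        rw [hm0]
        linarith
  set W := ∫⁻ ψ, wP (N := N) (κ := Fin d → Fin k) β U u ψ with hW
  have hWe : W = Zl d N β U u ^ (k^d) := by
    rw [hW, wP_int β hU u]; simp
  have hWf : W ≠ ∞ := by
    rw [hWe]
    exact ENNReal.pow_ne_top (ne_top_of_le_ne_top ENNReal.ofReal_ne_top (H3 N u))
  have hES : ∫⁻ ψ, ENNReal.ofReal (S ψ) * wP (N := N) β U u ψ ≤ ENNReal.ofReal (n * (d * m0) + 1) * W := by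
    have e0 : ∀ ψ x i, 0 ≤ Sx (d := d) D a b ψ x i := by
      intro ψ x i; unfold Sx; positivity
    have e1 : ∀ ψ, ENNReal.ofReal (S ψ) * wP (N := N) β U u ψ = ∑ x ∈ (DX D)ᶜ, ∑ i, ENNReal.ofReal (Sx D a b ψ x i) * wP (N := N) β U u ψ := by
      intro ψ
      simp only [hS]
      rw [ENNReal.ofReal_sum_of_nonneg (fun x _ => Finset.sum_nonneg fun i _ => e0 ψ x i), Finset.sum_mul]
      refine Finset.sum_congr rfl fun x _ => ?_
      rw [ENNReal.ofReal_sum_of_nonneg (fun i _ => e0 ψ x i), Finset.sum_mul]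
    have m1 : ∀ x i, Measurable fun ψ => ENNReal.ofReal (Sx D a b ψ x i) * wP (N := N) β U u ψ := by
      intro x i
      refine Measurable.mul ?_ (wP_meas β hU u)
      unfold Sx
      fun_prop
    simp_rw [e1]
    rw [lintegral_finsetSum _ (fun x _ => Finset.measurable_fun_sum _ fun i _ => m1 x i)]
    calc _ = ∑ x ∈ (DX D)ᶜ, ∑ i, ∫⁻ ψ, ENNReal.ofReal (Sx D a b ψ x i) * wP (N := N) β U u ψ := by
          refine Finset.sum_congr rfl fun x _ => ?_
          rw [lintegral_finsetSum _ (fun i _ => m1 x i)]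
      _ ≤ ∑ x ∈ (DX (d := d) D)ᶜ, ∑ i : Fin d, ENNReal.ofReal m0 * W := by
          refine Finset.sum_le_sum fun x _ => Finset.sum_le_sum fun i _ => ?_
          exact wP_Ex β hU u (by fun_prop) (hEx (rr D x) i) (bb D x)
      _ = ENNReal.ofReal (n * (d * m0)) * W := by
          simp only [Finset.sum_const, nsmul_eq_mul, Finset.card_univ, Fintype.card_fin]
          rw [ENNReal.ofReal_mul hn0, ENNReal.ofReal_mul (by positivity), hn, ENNReal.ofReal_natCast, ENNReal.ofReal_natCast]
          ring
      _ ≤ _ := by gcongr; linarith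
  have key := markov_exp volume (wP_meas (N := N) (κ := Fin d → Fin k) β hU u) hSm (b := β) (by positivity : 0 < n * (d * m0) + 1) hβ.le hWf hES
  have low : ∫⁻ ψ, ENNReal.ofReal (exp (-(β * S ψ))) * wP (N := N) β U u ψ ≤ Zl d M β U u := by
    have hGm : Measurable fun θ : (Fin d → ZMod M) → ℝ => wt (θ 0) * Gf β U u θ := one_meas β hU u
    refine lower_transfer (jj_inj D) (f := ff D) hGm ?_
    intro ψ θ q1 q2
    have z0 := q2 0 (zero_not_range D)
    have : ff D ψ 0 = 0 := by rw [ff, xx_zero, mul_zero]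
    rw [this, zero_add] at z0
    rw [wt_of_mem (show θ 0 ∈ Set.Ico (0:ℝ) 1 from z0), one_mul]
    have en := energy_ub D hK hub hB0 hlb u ψ θ q1 q2
    rw [← hQ, ← ha, ← hb] at en
    change _ ≤ _ + S ψ at en
    have w1 : wP β U u ψ ≤ ∏ c, Gf β U u (ψ c) := by
      refine Finset.prod_le_prod' fun c _ => ?_
      refine mul_le_of_le_one_left' ?_
      by_cases hh : ψ c 0 ∈ Set.Ico (0:ℝ) 1
      · rw [wt_of_mem hh]
      · rw [wt_of_not hh]; exact zero_le_one
    have w2 : ∏ c, Gf β U u (ψ c) = ENNReal.ofReal (exp (-β * ∑ c, torusH d N U (ψ c) u)) := by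
      unfold Gf
      rw [← ENNReal.ofReal_prod_of_nonneg (fun _ _ => (exp_pos _).le), ← exp_sum, Finset.mul_sum]
    rw [w2] at w1
    refine (mul_le_mul_right w1 _).trans ?_
    rw [← ENNReal.ofReal_mul (exp_pos _).le, ← exp_add]
    refine ENNReal.ofReal_le_ofReal (exp_le_exp.2 ?_)
    have := mul_le_mul_of_nonneg_left en hβ.le
    rw [mul_add] at this
    linarith
  refine le_trans ?_ (key.trans low)
  rw [← hWe]
  refine mul_le_mul_left (ENNReal.ofReal_le_ofReal ?_) _
  rw [← DXc_card D, ← hn]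
  have : exp (-(β * (2 * (n * (d * m0) + 1)))) / 2 = exp (-(β * (2 * (n * (d * m0) + 1))) - log 2) := by
    rw [exp_sub, exp_log two_pos]
  rw [this, exp_le_exp]
  have l2 := log_nonneg one_le_two
  have : 0 ≤ log 2 * n := by positivity
  have : 0 ≤ β * n := by positivity
  have : 0 ≤ β * d * m0 := by positivity
  nlinarith
end

end

section
open scoped ENNReal
set_option linter.all false

def evF : Filter ℕ := atTop ⊓ principal {N | Even N}

instance evF_neBot : evF.NeBot := by
  unfold evF
  rw [inf_principal_neBot_iff]
  intro S hS
  rw [mem_atTop_sets] at hS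
  obtain ⟨a, ha⟩ := hS
  exact ⟨2 * a, ha _ (by omega), by simp⟩

lemma evF_le : evF ≤ atTop := inf_le_left
lemma evF_even : ∀ᶠ N in evF, Even N := by
  unfold evF
  rw [eventually_inf_principal]
  exact Eventually.of_forall fun N h => h

lemma lim1 : Tendsto (fun N : ℕ => ((Nat.sqrt N + 1 : ℕ):ℝ) / N) atTop (nhds 0) := by
  have h1 : Tendsto (fun N : ℕ => 1 / √(N:ℝ) + 1 / (N:ℝ)) atTop (nhds (0 + 0)) := by
    refine Tendsto.add ?_ tendsto_one_div_atTop_nhds_zero_nat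
    have : Tendsto (fun N : ℕ => √(N:ℝ)) atTop atTop := tendsto_sqrt_atTop.comp tendsto_natCast_atTop_atTop
    exact (this.inv_tendsto_atTop).congr fun N => by simp
  rw [add_zero] at h1
  refine squeeze_zero' (Eventually.of_forall fun N => by positivity) ?_ h1
  filter_upwards [eventually_ge_atTop 1] with N hN
  have hN' : (1:ℝ) ≤ N := by exact_mod_cast hN
  have : (0:ℝ) < √(N:ℝ) := Real.sqrt_pos.2 (by linarith)
  have e : 1 / √(N:ℝ) = √(N:ℝ) / N := by
    rw [div_eq_div_iff this.ne' (by linarith)]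
    rw [one_mul, Real.mul_self_sqrt (by linarith)]
  rw [e, ← add_div]
  push_cast
  gcongr
  exact Real.nat_sqrt_le_real_sqrt

lemma lim2 : Tendsto (fun N : ℕ => (N:ℝ) / ((N:ℝ) + 2 * ((Nat.sqrt N + 1 : ℕ):ℝ))) atTop (nhds 1) := by
  have h : Tendsto (fun N : ℕ => 1 / (1 + 2 * (((Nat.sqrt N + 1 : ℕ):ℝ) / N))) atTop (nhds (1 / (1 + 2 * 0))) :=
    Tendsto.div tendsto_const_nhds (tendsto_const_nhds.add (lim1.const_mul 2)) (by norm_num)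
  rw [mul_zero, add_zero, div_one] at h
  refine h.congr' ?_
  filter_upwards [eventually_ge_atTop 1] with N hN
  have hN' : (1:ℝ) ≤ N := by exact_mod_cast hN
  have : (0:ℝ) < N := by linarith
  field_simp

lemma lim3 : Tendsto (fun N : ℕ => ((N:ℝ) - 1) / ((N:ℝ) + 2 * ((Nat.sqrt N + 1 : ℕ):ℝ))) atTop (nhds 1) := by
  have h : Tendsto (fun N : ℕ => ((N:ℝ) / ((N:ℝ) + 2 * ((Nat.sqrt N + 1 : ℕ):ℝ))) * (1 - 1 / (N:ℝ))) atTop (nhds (1 * (1 - 0))) :=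
    lim2.mul (tendsto_const_nhds.sub tendsto_one_div_atTop_nhds_zero_nat)
  rw [sub_zero, one_mul] at h
  refine h.congr' ?_
  filter_upwards [eventually_ge_atTop 1] with N hN
  have hN' : (1:ℝ) ≤ N := by exact_mod_cast hN
  have : (0:ℝ) < N := by linarith
  field_simp

lemma lim4 (L : ℕ) (hL : 1 ≤ L) : Tendsto (fun M : ℕ => ((M / L : ℕ):ℝ) / M) atTop (nhds (1 / L)) := by
  have h := (tendsto_nat_floor_mul_div_atTop (R := ℝ) (a := 1 / (L:ℝ)) (by positivity)).comp tendsto_natCast_atTop_atTop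
  refine h.congr fun M => ?_
  simp only [Function.comp]
  rw [one_div_mul_eq_div, Nat.floor_div_eq_div]

lemma limit_exists {d : ℕ} (hd : 1 ≤ d) (y : ℕ → ℝ) {C K : ℝ} (hC : 0 ≤ C) (hK : 0 ≤ K) (hb : ∀ N, 1 ≤ N → |y N| ≤ K * (N:ℝ)^d)
    (hs : ∀ N, 1 ≤ N → 2 ∣ N → ∀ l, 1 ≤ l → N ≤ l^2 → ∀ (M k : ℕ), 1 ≤ M → 1 ≤ k → k * (N + 2 * l) ≤ M →
      (k:ℝ)^d * y N - C * ((M:ℝ)^d - (k:ℝ)^d * ((N:ℝ) - 1)^d + 1) ≤ y M) :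
    ∃ s, Tendsto (fun N => y N / (N:ℝ)^d) evF (nhds s) := by
  set z : ℕ → ℝ := fun N => y N / (N:ℝ)^d with hz
  have hzb : ∀ N, 1 ≤ N → |z N| ≤ K := by
    intro N hN
    have : (0:ℝ) < (N:ℝ)^d := by positivity
    simp only [hz]
    rw [abs_div, abs_of_pos this, div_le_iff₀ this]
    exact hb N hN
  have ev1 : ∀ᶠ N in evF, 1 ≤ N := evF_le (eventually_ge_atTop 1)
  have bu : IsBoundedUnder (· ≤ ·) evF z := ⟨K, by
    rw [eventually_map]; filter_upwards [ev1] with N hN using (abs_le.1 (hzb N hN)).2⟩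
  have bl : IsBoundedUnder (· ≥ ·) evF z := ⟨-K, by
    rw [eventually_map]; filter_upwards [ev1] with N hN using (abs_le.1 (hzb N hN)).1⟩
  refine ⟨limsup z evF, ?_⟩
  rw [tendsto_order]
  refine ⟨fun a ha => ?_, fun a ha => eventually_lt_of_limsup_lt ha bu⟩
  obtain ⟨a', ha1, ha2⟩ := exists_between ha
  have fr := frequently_lt_of_lt_limsup bl.isCoboundedUnder_le ha2
  -- error term for N
  have er : Tendsto (fun N : ℕ => K * (1 - ((N:ℝ) / ((N:ℝ) + 2 * ((Nat.sqrt N + 1 : ℕ):ℝ)))^d) + C * (1 - (((N:ℝ) - 1) / ((N:ℝ) + 2 * ((Nat.sqrt N + 1 : ℕ):ℝ)))^d)) atTop (nhds (K * (1 - 1^d) + C * (1 - 1^d))) :=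
    ((tendsto_const_nhds.sub (lim2.pow d)).const_mul K).add ((tendsto_const_nhds.sub (lim3.pow d)).const_mul C)
  have er0 : K * (1 - 1^d) + C * (1 - 1^d) = 0 := by simp
  rw [er0] at er
  have er1 : ∀ᶠ N in evF, _ := evF_le (er.eventually (gt_mem_nhds (show 0 < a' - a by linarith)))
  obtain ⟨N, hN1, hN2, hN3, hN4⟩ := (fr.and_eventually (er1.and (ev1.and evF_even))).exists
  have hN2' : K * (1 - ((N:ℝ) / ((N:ℝ) + 2 * ((Nat.sqrt N + 1 : ℕ):ℝ)))^d) + C * (1 - (((N:ℝ) - 1) / ((N:ℝ) + 2 * ((Nat.sqrt N + 1 : ℕ):ℝ)))^d) < a' - a := hN2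
  clear hN2
  set l := Nat.sqrt N + 1 with hl
  set L := N + 2 * l with hL
  have hLr : (N:ℝ) + 2 * (l:ℝ) = (L:ℝ) := by rw [hL]; push_cast; rfl
  rw [hLr] at hN2'
  have hL1 : 1 ≤ L := by omega
  have hL1' : (1:ℝ) ≤ L := by exact_mod_cast hL1
  have hNl : N ≤ l^2 := by
    have := Nat.lt_succ_sqrt N
    rw [hl, sq]; exact this.le
  have hNL : (N:ℝ) ≤ L := by exact_mod_cast (show N ≤ L by omega)
  have t1 : Tendsto (fun M : ℕ => (((M / L : ℕ):ℝ) / M)^d * y N - C * (1 - (((M / L : ℕ):ℝ) / M)^d * ((N:ℝ)-1)^d + (1 / (M:ℝ))^d)) atTop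
      (nhds ((1 / (L:ℝ))^d * y N - C * (1 - (1 / (L:ℝ))^d * ((N:ℝ)-1)^d + 0^d))) :=
    (((lim4 L hL1).pow d).mul_const _).sub (((tendsto_const_nhds.sub (((lim4 L hL1).pow d).mul_const _)).add (tendsto_one_div_atTop_nhds_zero_nat.pow d)).const_mul C)
  have hAN : a < (1 / (L:ℝ))^d * y N - C * (1 - (1 / (L:ℝ))^d * ((N:ℝ)-1)^d + 0^d) := by
    have hNp : (0:ℝ) < N := by exact_mod_cast hN3
    have e1 : (1 / (L:ℝ))^d * y N = z N * ((N:ℝ) / L)^d := by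
      simp only [hz]
      rw [div_pow, div_pow, one_pow]
      field_simp
    have e2 : (1 / (L:ℝ))^d * ((N:ℝ)-1)^d = (((N:ℝ)-1) / L)^d := by
      rw [div_pow, div_pow, one_pow]; field_simp
    rw [e1, e2, zero_pow (by omega), add_zero]
    have p0 : ((N:ℝ) / L)^d ≤ 1 := pow_le_one₀ (by positivity) ((div_le_one (by linarith)).2 hNL)
    have := (abs_le.1 (hzb N hN3)).2
    have q : z N * (1 - ((N:ℝ) / L)^d) ≤ K * (1 - ((N:ℝ) / L)^d) := mul_le_mul_of_nonneg_right this (by linarith)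
    linarith
  have fin : ∀ᶠ N in evF, _ := evF_le (t1.eventually (lt_mem_nhds hAN))
  filter_upwards [fin, evF_le (eventually_ge_atTop L)] with M hM1 hM2
  refine lt_of_lt_of_le hM1 ?_
  have hMp : (0:ℝ) < M := by exact_mod_cast (show 0 < M by omega)
  have := hs N hN3 hN4.two_dvd l (by omega) hNl M (M / L) (by omega) ((Nat.one_le_div_iff (by omega)).2 hM2) (Nat.div_mul_le_self M L)
  simp only [hz]
  rw [le_div_iff₀ (by positivity)]
  refine le_trans (le_of_eq ?_) this
  rw [div_pow, div_pow, one_pow]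
  field_simp

end

section
open scoped ENNReal
set_option linter.all false

section
variable {d : ℕ}

/-- log partition function -/
def yl (β : ℝ) (U : ℝ → ℝ) (u : Fin d → ℝ) (N : ℕ) : ℝ :=
  if hN : N = 0 then 0 else log ((@Zl d N ⟨hN⟩ β U u).toReal)

lemma yl_eq (β : ℝ) (U : ℝ → ℝ) (u : Fin d → ℝ) (N : ℕ) [NeZero N] : yl β U u N = log ((Zl d N β U u).toReal) := by
  unfold yl
  rw [dif_neg (NeZero.ne N)]

variable {U U1 U2 : ℝ → ℝ} {A B C β c : ℝ}

lemma Zl_exp (h : Pot U U1 U2 A B C) (hβ : 0 < β) (u : Fin d → ℝ) (N : ℕ) [NeZero N] :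
    Zl d N β U u = ENNReal.ofReal (exp (yl β U u N)) := by
  obtain ⟨K, hK, H⟩ := Zl_ub h hβ d
  obtain ⟨K', hK', H'⟩ := Zl_lb h hβ u
  have f1 : Zl d N β U u ≠ ∞ := ne_top_of_le_ne_top ENNReal.ofReal_ne_top (H N u)
  have f2 : Zl d N β U u ≠ 0 := by
    have := (ENNReal.ofReal_pos.2 (exp_pos (-(K' * (N:ℝ)^d)))).trans_le (H' N)
    exact this.ne'
  rw [yl_eq, exp_log (ENNReal.toReal_pos f2 f1), ENNReal.ofReal_toReal f1]

lemma yl_lim [NeZero d] (h : Pot U U1 U2 A B C) (hβ : 0 < β)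
    (hsym : ∀ s, U (-s) = U s) (hc0 : 0 < c) (hc : SLC d β U c) (u : Fin d → ℝ) :
    ∃ s, Tendsto (fun N => yl β U u N / (N:ℝ)^d) evF (nhds s) := by
  obtain ⟨K, hK, H⟩ := Zl_ub h hβ d
  obtain ⟨K', hK', H'⟩ := Zl_lb h hβ u
  obtain ⟨C', hC', HS⟩ := superadd h hβ hsym hc0 hc u
  refine limit_exists NeZero.one_le (yl β U u) hC' (add_nonneg hK hK') ?_ ?_
  · intro N hN
    haveI : NeZero N := ⟨by omega⟩
    have h1 := H N u
    have h2 := H' N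
    rw [Zl_exp h hβ u N, ENNReal.ofReal_le_ofReal_iff (exp_pos _).le, exp_le_exp] at h1 h2
    have e1 : 0 ≤ K * (N:ℝ)^d := by positivity
    have e2 : 0 ≤ K' * (N:ℝ)^d := by positivity
    rw [abs_le, add_mul]; constructor <;> linarith
  · intro N hN h2 l hl hNl M k hM hk hkM
    haveI : NeZero N := ⟨by omega⟩
    haveI : NeZero M := ⟨by omega⟩
    haveI : NeZero k := ⟨by omega⟩
    have := HS N h2 l hl hNl M k hkM
    rw [Zl_exp h hβ u N, Zl_exp h hβ u M, ← ENNReal.ofReal_pow (exp_pos _).le, ← ENNReal.ofReal_mul (exp_pos _).le,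
      ENNReal.ofReal_le_ofReal_iff (exp_pos _).le, ← exp_nat_mul, ← exp_add, exp_le_exp] at this
    push_cast at this
    linarith

lemma yl_conv [NeZero d] (h : Pot U U1 U2 A B C) (hβ : 0 < β)
    (hsym : ∀ s, U (-s) = U s) (hc0 : 0 < c) (hc : SLC d β U c) (u0 u1 : Fin d → ℝ) {s t : ℝ} (hs : 0 < s) (ht : 0 < t) (hst : s + t = 1)
    (N : ℕ) (hN : 1 ≤ N) (h2 : 2 ∣ N) :
    s * (yl β U u0 N / (N:ℝ)^d) + t * (yl β U u1 N / (N:ℝ)^d) + s * t * (2 * c * ∑ i, (u1 i - u0 i)^2) ≤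
      yl β U (s • u0 + t • u1) N / (N:ℝ)^d := by
  haveI : NeZero N := ⟨by omega⟩
  have := Zl_conv h hβ hsym hc0 hc h2 u0 u1 hs ht hst
  rw [Zl_exp h hβ u0 N, Zl_exp h hβ u1 N, Zl_exp h hβ _ N, ENNReal.ofReal_rpow_of_pos (exp_pos _), ENNReal.ofReal_rpow_of_pos (exp_pos _),
    ← ENNReal.ofReal_mul (by positivity), ← ENNReal.ofReal_mul (exp_pos _).le, ENNReal.ofReal_le_ofReal_iff (by positivity),
    ← exp_mul, ← exp_mul, ← exp_add, ← exp_add, exp_le_exp] at this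
  have hp : (0:ℝ) < (N:ℝ)^d := by positivity
  rw [le_div_iff₀ hp]
  have e : (s * (yl β U u0 N / (N:ℝ)^d) + t * (yl β U u1 N / (N:ℝ)^d) + s * t * (2 * c * ∑ i, (u1 i - u0 i)^2)) * (N:ℝ)^d =
     s * yl β U u0 N + t * yl β U u1 N + s * t * (2 * c * ∑ i, (u1 i - u0 i)^2) * (N:ℝ)^d := by
    field_simp
  rw [e]
  linarith

lemma sigma_yl (h : Pot U U1 U2 A B C) (hβ : 0 < β) (u : Fin d → ℝ) (N : ℕ) (hN : 1 ≤ N) :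
    torusSigma β d U N u = -(yl β U u N / (N:ℝ)^d - yl β U (0 : Fin d → ℝ) N / (N:ℝ)^d) := by
  haveI : NeZero N := ⟨by omega⟩
  unfold torusSigma
  rw [dif_neg (by omega)]
  unfold torusSigmaAux
  rw [torusZ_eq β h.cU, torusZ_eq β h.cU, Zl_exp h hβ u N, Zl_exp h hβ 0 N, ENNReal.toReal_ofReal (exp_pos _).le,
    ENNReal.toReal_ofReal (exp_pos _).le, ← exp_sub, log_exp]
  ring

lemma main_of [NeZero d] (h : Pot U U1 U2 A B C) (hβ : 0 < β)
    (hsym : ∀ s, U (-s) = U s) (hc0 : 0 < c) (hc : SLC d β U c) :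
    ∃ σlim : (Fin d → ℝ) → ℝ,
      (∀ u : Fin d → ℝ, Tendsto (fun N : ℕ => torusSigma β d U N u) evF (nhds (σlim u))) ∧
      ∃ c : ℝ, 0 < c ∧ ConvexOn ℝ Set.univ (fun u : Fin d → ℝ => σlim u - c * ∑ i, (u i)^2) := by
  choose S hS using fun u => yl_lim h hβ hsym hc0 hc u
  have ev1 : ∀ᶠ N in evF, 1 ≤ N := evF_le (eventually_ge_atTop 1)
  refine ⟨fun u => -(S u - S 0), fun u => ?_, 2 * c, by positivity, ?_⟩
  · refine (((hS u).sub (hS 0)).neg).congr' ?_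
    filter_upwards [ev1] with N hN
    rw [sigma_yl h hβ u N hN]
  · rw [convexOn_iff_forall_pos]
    refine ⟨convex_univ, ?_⟩
    intro x _ y _ s t hs ht hst
    have key : s * S x + t * S y + s * t * (2 * c * ∑ i, (y i - x i)^2) ≤ S (s • x + t • y) := by
      refine le_of_tendsto_of_tendsto ((((hS x).const_mul s).add ((hS y).const_mul t)).add_const _) (hS _) ?_
      filter_upwards [ev1, evF_even] with N h1 h2
      exact yl_conv h hβ hsym hc0 hc x y hs ht hst N h1 h2.two_dvd
    have id : s * ∑ i, (x i)^2 + t * ∑ i, (y i)^2 - ∑ i, ((s • x + t • y) i)^2 = s * t * ∑ i, (y i - x i)^2 := by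
      rw [Finset.mul_sum, Finset.mul_sum, Finset.mul_sum, ← Finset.sum_add_distrib, ← Finset.sum_sub_distrib]
      refine Finset.sum_congr rfl fun i _ => ?_
      simp only [Pi.add_apply, Pi.smul_apply, smul_eq_mul]
      obtain rfl : t = 1 - s := by linarith
      ring
    simp only [smul_eq_mul]
    generalize ∑ i, ((s • x + t • y) i)^2 = Qm at *
    generalize ∑ i, (x i)^2 = Qx at *
    generalize ∑ i, (y i)^2 = Qy at *
    generalize ∑ i, (y i - x i)^2 = Qd at *
    have id2 : s * t * (2 * c * Qd) = 2 * c * (s * Qx + t * Qy - Qm) := by rw [id]; ring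
    rw [id2] at key
    obtain rfl : t = 1 - s := by linarith
    nlinarith
end

end

/-- existence of the thermodynamic limit of the surface tension along
even `N`, and its strict convexity. -/
theorem statement3
    {d : ℕ} {β A B C₀ C₁ C₂ q : ℝ} {U V g : ℝ → ℝ}
    (hd : 1 ≤ d) (hβ : 0 < β)
    -- symmetry
    (hsym : ∀ s, U (-s) = U s)
    -- (A0)
    (hUcont : Continuous U) (hA : 0 < A) (hA0 : ∀ η : ℝ, A * η ^ 2 - B ≤ U η)
    -- (A1)
    (hsum : ∀ s, U s = V s + g s)
    (hV : ContDiff ℝ 2 V) (hg : ContDiff ℝ 2 g)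
    (hC₁ : 0 < C₁) (hC₁₂ : C₁ < C₂) (hC₂₀ : C₂ < C₀)
    (hV'' : ∀ s, C₁ ≤ deriv (deriv V) s ∧ deriv (deriv V) s ≤ C₂)
    (hg'' : ∀ s, -C₀ ≤ deriv (deriv g) s ∧ deriv (deriv g) s ≤ 0)
    -- (A2)
    (hq : 1 ≤ q)
    (hgq : Integrable (fun t : ℝ => |deriv (deriv g) t| ^ q))
    (hA2 : β ^ (1/(2*q)) * LqNorm (deriv (deriv g)) q
      < C₁ ^ ((3:ℝ)/2) / (2 * C₂ ^ ((q+1)/(2*q)) * (2*(d:ℝ)) ^ (1/(2*q)))) :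
    ∃ σlim : (Fin d → ℝ) → ℝ,
      (∀ u : Fin d → ℝ,
        Tendsto (fun N : ℕ => torusSigma β d U N u)
          (atTop ⊓ Filter.principal {N : ℕ | Even N}) (nhds (σlim u))) ∧
      ∃ c : ℝ, 0 < c ∧
        ConvexOn ℝ Set.univ (fun u : Fin d → ℝ => σlim u - c * ∑ i, (u i)^2) := by
  haveI : NeZero d := ⟨by omega⟩
  have hd' : (1:ℝ) ≤ d := by exact_mod_cast hd
  obtain ⟨C, hPot⟩ := pot_of hA hA0 hsum hV hg hC₁ hC₁₂ hC₂₀ hV'' hg''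
  have hΓ : 0 ≤ ∫ t, |deriv (deriv g) t| ^ q := integral_nonneg fun t => by positivity
  have hsm := small_of_A2 hβ hC₁ hC₁₂ hq (n := 2 * (d:ℝ)) (by linarith) hΓ hA2
  have hcard : ((Fintype.card (Fin d × Bool) : ℕ):ℝ) = 2 * (d:ℝ) := by
    simp [mul_comm]
  obtain ⟨c, hc0, hc⟩ := Zs_conv (ι := Fin d × Bool) hPot hβ (m := C₁ / q) (by have : 0 < q := by linarith
                                                                               positivity)
    (ρ := (∫ t, |deriv (deriv g) t| ^ q) / C₁ ^ q) (by positivity) (K := C₂) (by linarith)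
    (fun x r hr => incr_lo hV hg hC₁ hV'' hg'' hq hgq x r hr)
    (fun x r hr => incr_hi hV hg hV'' hg'' x r hr)
    (by rw [hcard]; exact hsm)
  exact main_of hPot hβ hsym hc0 hc

end
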